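/- Let d ≥ 2, Ω = (−1,1)^d, p > d, α > 0, and q > p + α (p−1)/(d−1). Set 𝔇 = (p − d)/(p − 1), λ = 2^{−1/𝔇}, and let γ > 1/(𝔇(p−1)). Then there exist a nonnegative weight a ∈ C^α(Ω̄), an η > 0, and a function v ∈ W^{1,1}(Ω) with ∫_Ω (|∇v|^p/p + a|∇v|^q/q) dx < ∞ which minimizes the double phase functional F(w) = ∫_Ω (|∇w|^p/p + a(x)|∇w|^q/q) dx among all w ∈ W^{1,1}(Ω) with F(w) < ∞ and prescribed boundary data, such that: (i) ∇v ∉ L^s(Ω) for any s > p; and (ii) v has no continuous representative admitting a modulus of continuity ω₁ with ω₁(ρ) = o(ρ^𝔇 (log(e + ρ^{−1}))^{−γ𝔇}) as ρ → 0; that is, the modulus of continuity of v is not better than C ρ^𝔇 (log(e + ρ^{−1}))^{−γ𝔇}. -/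

import Mathlib

open MeasureTheory Real Set Metric Filter Topology NNReal ENNReal

noncomputable section

/-- `ℝ^n` with the Euclidean structure. -/
abbrev Euc (n : ℕ) := EuclideanSpace ℝ (Fin n)

/-- The open cube `(-1,1)^n`. -/
def Box (n : ℕ) : Set (Euc n) := {x | ∀ i, |x i| < 1}

/-- The last coordinate `x_d` of `x ∈ ℝ^{n+1}`. -/
def lastC {n : ℕ} (x : Euc (n + 1)) : ℝ := x (Fin.last n)

/-- The first `n` coordinates `x̄` of `x ∈ ℝ^{n+1}`. -/
def frontC {n : ℕ} (x : Euc (n + 1)) : Euc n := WithLp.toLp 2 fun i => x i.castSucc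

/-- Assemble a point of `ℝ^{n+1}` from `x̄ ∈ ℝ^n` and a last coordinate. -/
def snocC {n : ℕ} (xb : Euc n) (t : ℝ) : Euc (n + 1) :=
  WithLp.toLp 2 (Fin.snoc (α := fun _ => ℝ) xb.ofLp t)

/-- The first `m` coordinates of `x ∈ ℝ^{m+k}`. -/
def barPart {m k : ℕ} (x : Euc (m + k)) : Euc m := WithLp.toLp 2 fun i => x (Fin.castAdd k i)

/-- The last `k` coordinates of `x ∈ ℝ^{m+k}`. -/
def hatPart {m k : ℕ} (x : Euc (m + k)) : Euc k := WithLp.toLp 2 fun i => x (Fin.natAdd m i)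

/-- Admissibility of a sequence of interval lengths for the generalized `(λ,γ)`-Cantor set:
`l 0 = 1`, the lengths decrease fast enough (`l_{j-1} > 2 l_j`, removed gaps decreasing), and
`l j` is comparable to `λ^j j^γ`. -/
def IsCantorLengths (lam gam : ℝ) (l : ℕ → ℝ) : Prop :=
  l 0 = 1 ∧ (∀ j, 0 < l j) ∧ (∀ j, 2 * l (j + 1) < l j) ∧
    (∀ j, l (j + 1) - 2 * l (j + 2) < l j - 2 * l (j + 1)) ∧
    ∃ C : ℝ, 1 ≤ C ∧ ∀ j : ℕ, 1 ≤ j →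
      C⁻¹ * lam ^ j * (j : ℝ) ^ gam ≤ l j ∧ l j ≤ C * lam ^ j * (j : ℝ) ^ gam

/-- The point of the generalized Cantor set with address `ε` (left endpoints of the nested
intervals converge to this point). -/
def gCantorPoint (l : ℕ → ℝ) (ε : ℕ → Bool) : ℝ :=
  -(1 / 2 : ℝ) + ∑' j : ℕ, if ε j then l j - l (j + 1) else 0

/-- The generalized Cantor set determined by the lengths `l`. -/
def gCantorSet (l : ℕ → ℝ) : Set ℝ := Set.range (gCantorPoint l)

/-- The `m`-fold Cartesian power of the generalized Cantor set, inside `ℝ^m`. -/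
def gCantorSetPi (l : ℕ → ℝ) (m : ℕ) : Set (Euc m) := {x | ∀ i, x i ∈ gCantorSet l}

/-- The `j`-th binary digit of `t`. -/
def binDigit (t : ℝ) (j : ℕ) : Bool := ⌊t * 2 ^ (j + 1)⌋ % 2 = 1

/-- The Cantor measure attached to the lengths `l`: the image of the uniform distribution on
`[0,1)` under the map sending `t` to the Cantor point whose address is the binary digit
sequence of `t` (the digits being i.i.d. fair coins, this is the weak limit of the uniform
distributions on the pre-Cantor sets). -/
def gCantorMeasure (l : ℕ → ℝ) : Measure ℝ :=
  Measure.map (fun t => gCantorPoint l (binDigit t)) (volume.restrict (Set.Ico (0 : ℝ) 1))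

/-- The `m`-fold product of the Cantor measure, as a measure on `ℝ^m`. -/
def gCantorMeasurePi (l : ℕ → ℝ) (m : ℕ) : Measure (Euc m) :=
  Measure.map (⇑(MeasurableEquiv.toLp 2 (Fin m → ℝ)))
    (Measure.pi fun _ : Fin m => gCantorMeasure l)

/-- The fractal dimension `𝔇 = m log 2 / log(1/λ)`. -/
def frD (m : ℕ) (lam : ℝ) : ℝ := m * Real.log 2 / Real.log lam⁻¹

/-- `G` is the weak (distributional) differential of `u` on `Ω`:
integration by parts against smooth compactly supported test functions holds. -/
def HasWeakFDerivOn {n : ℕ} (Ω : Set (Euc n)) (u : Euc n → ℝ)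
    (G : Euc n → Euc n →L[ℝ] ℝ) : Prop :=
  ∀ φ : Euc n → ℝ, ContDiff ℝ (⊤ : ℕ∞) φ → HasCompactSupport φ → tsupport φ ⊆ Ω →
    ∫ x in Ω, u x • fderiv ℝ φ x = -∫ x in Ω, φ x • G x

/-- `u ∈ W^{1,1}(Ω)` with weak differential `G`. -/
def W11On {n : ℕ} (Ω : Set (Euc n)) (u : Euc n → ℝ) (G : Euc n → Euc n →L[ℝ] ℝ) : Prop :=
  IntegrableOn u Ω ∧ IntegrableOn G Ω ∧ HasWeakFDerivOn Ω u G

/-- `w ∈ W^{1,1}_0(Ω)` (with weak differential `G`): the extensions by zero form a Sobolev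
function on all of `ℝ^n`. -/
def ZeroBoundary {n : ℕ} (Ω : Set (Euc n)) (w : Euc n → ℝ)
    (G : Euc n → Euc n →L[ℝ] ℝ) : Prop :=
  Integrable (Set.indicator Ω w) ∧ Integrable (Set.indicator Ω G) ∧
    HasWeakFDerivOn Set.univ (Set.indicator Ω w) (Set.indicator Ω G)

/-- The energy `∫_Ω φ(x, g x) dx` for a scalar field `g` (typically `g = |∇w|`). -/
def energyOf {n : ℕ} (Ω : Set (Euc n)) (φ : Euc n → ℝ → ℝ) (g : Euc n → ℝ) : ℝ≥0∞ :=
  ∫⁻ x in Ω, ENNReal.ofReal (φ x (g x))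

/-- The Young (Legendre–Fenchel) conjugate `φ*(s) = sup_{t ≥ 0} (s t − φ(t))`. -/
def conjOrlicz (φ : ℝ → ℝ) (s : ℝ) : ℝ≥0∞ :=
  ⨆ t : ℝ≥0, ENNReal.ofReal (s * t - φ t)

/-- The conjugate energy `∫_Ω φ*(x, g x) dx`. -/
def energyConj {n : ℕ} (Ω : Set (Euc n)) (φ : Euc n → ℝ → ℝ) (g : Euc n → ℝ) : ℝ≥0∞ :=
  ∫⁻ x in Ω, conjOrlicz (φ x) (g x)

/-- `u` (with weak differential `G`, finite energy) is a local minimizer of the functional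
`w ↦ ∫_Ω φ(x,|∇w|) dx`: its energy does not exceed that of any Sobolev competitor that agrees
with `u` a.e. outside a compact subset of `Ω`. -/
def IsLocalMinimizer {n : ℕ} (Ω : Set (Euc n)) (φ : Euc n → ℝ → ℝ) (u : Euc n → ℝ)
    (G : Euc n → Euc n →L[ℝ] ℝ) : Prop :=
  W11On Ω u G ∧ energyOf Ω φ (fun x => ‖G x‖) < ⊤ ∧
    ∀ v Gv, W11On Ω v Gv →
      (∃ K : Set (Euc n), IsCompact K ∧ K ⊆ Ω ∧ ∀ᵐ x ∂(volume.restrict Ω), x ∉ K → v x = u x) →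
      energyOf Ω φ (fun x => ‖G x‖) ≤ energyOf Ω φ (fun x => ‖Gv x‖)

/-- `x` is a non-Lebesgue point of `u`: the averages of `|u − c|` on small balls around `x`
do not converge to `0` for any constant `c`. -/
def IsNonLebesguePoint {n : ℕ} (u : Euc n → ℝ) (x : Euc n) : Prop :=
  ¬ ∃ c : ℝ, Tendsto (fun r : ℝ => ⨍ y in Metric.ball x r, |u y - c| ∂volume)
      (𝓝[>] (0 : ℝ)) (𝓝 0)

/-- Membership in the Hölder class `C^α` on `s` (for `α ≥ 1` interpreted via
`C^{⌊α⌋, α − ⌊α⌋}`). -/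
def InHolderCls {n : ℕ} (α : ℝ) (s : Set (Euc n)) (a : Euc n → ℝ) : Prop :=
  ContDiffOn ℝ (⌊α⌋₊ : ℕ) a s ∧
    ∃ C : ℝ≥0, HolderOnWith C (Real.toNNReal (α - ⌊α⌋₊))
      (fun x => iteratedFDerivWithin ℝ ⌊α⌋₊ a s x) s

/-- The restricted Riesz potential `I₁^⋈(|f|)(x̄,0) = ∫_{C((x̄,0))} |f(y)| |x−y|^{1−d} dy`,
where `C(x)` is the double cone `{y : |ȳ − x̄| ≤ |y_d − x_d|/2}` (here `d = n+1`). -/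
def rieszBow {n : ℕ} (f : Euc (n + 1) → ℝ) (xb : Euc n) : ℝ≥0∞ :=
  ∫⁻ y : Euc (n + 1),
    ENNReal.ofReal ((if dist (frontC y) xb ≤ |lastC y| / 2 then (1 : ℝ) else 0) *
      |f y| * Real.sqrt (dist (frontC y) xb ^ 2 + lastC y ^ 2) ^ (-(n : ℝ)))

/-- The upper average `⟨f⟩⁺_{x̄,r} = ∫_{B_1} ω(y) f(x̄ + |r| ȳ, |r| y_d + |r|) dy`. -/
def avgPlus {n : ℕ} (ω : Euc (n + 1) → ℝ) (f : Euc (n + 1) → ℝ) (xb : Euc n) (r : ℝ) : ℝ :=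
  ∫ y in Metric.ball (0 : Euc (n + 1)) 1,
    ω y * f (snocC (xb + |r| • frontC y) (|r| * lastC y + |r|))

/-- The lower average `⟨f⟩⁻_{x̄,r} = ∫_{B_1} ω(y) f(x̄ + |r| ȳ, |r| y_d − |r|) dy`. -/
def avgMinus {n : ℕ} (ω : Euc (n + 1) → ℝ) (f : Euc (n + 1) → ℝ) (xb : Euc n) (r : ℝ) : ℝ :=
  ∫ y in Metric.ball (0 : Euc (n + 1)) 1,
    ω y * f (snocC (xb + |r| • frontC y) (|r| * lastC y - |r|))

open Classical in
/-- The function `u_d(x) = (1/2) sgn(x_d) θ(|x_d|/|x̄|)` (extended by its natural limit value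
`(1/2) sgn(x_d)` on the line `x̄ = 0`). -/
def uD {n : ℕ} (θ : ℝ → ℝ) (x : Euc (n + 1)) : ℝ :=
  if frontC x = 0 then (1 / 2) * Real.sign (lastC x)
  else (1 / 2) * Real.sign (lastC x) * θ (|lastC x| / ‖frontC x‖)

/-- Hypotheses on the profile function `θ`:
smooth on `(0,∞)`, `1_{(1/2,∞)} ≤ θ ≤ 1_{(1/4,∞)}` and `‖θ'‖_∞ ≤ 6`. -/
def IsProfile (θ : ℝ → ℝ) : Prop :=
  ContDiffOn ℝ (⊤ : ℕ∞) θ (Set.Ioi 0) ∧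
    (∀ t : ℝ, 0 < t → (if 1 / 2 < t then (1 : ℝ) else 0) ≤ θ t) ∧
    (∀ t : ℝ, 0 < t → θ t ≤ if 1 / 4 < t then 1 else 0) ∧
    (∀ t : ℝ, 0 < t → |deriv θ t| ≤ 6)

end

/-- weighted average of `f` around `z` -/
noncomputable def Avg {m : ℕ} (f φ : Euc m → ℝ) (z : Euc m) : ℝ := ∫ y, f y * φ (y - z)

lemma supp_zero {m : ℕ} {φ : Euc m → ℝ} {ρ : ℝ} (hs : tsupport φ ⊆ closedBall 0 ρ)
    {x : Euc m} (hx : ρ < ‖x‖) : φ x = 0 := by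
  apply image_eq_zero_of_notMem_tsupport
  intro h
  have := hs h
  simp at this
  linarith

lemma supp_fderiv_zero {m : ℕ} {φ : Euc m → ℝ} {ρ : ℝ} (hs : tsupport φ ⊆ closedBall 0 ρ)
    {x : Euc m} (hx : ρ < ‖x‖) : fderiv ℝ φ x = 0 := by
  apply image_eq_zero_of_notMem_tsupport
  intro h
  have := hs (tsupport_fderiv_subset ℝ h)
  simp at this
  linarith

lemma loc_mul {m : ℕ} {f φ : Euc m → ℝ} (hf : LocallyIntegrable f) (hc : Continuous φ)
    (hcs : HasCompactSupport φ) : Integrable (fun y => f y * φ y) := by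
  have := hf.integrable_smul_right_of_hasCompactSupport hc hcs
  simpa using this

lemma hcs_of {m : ℕ} {φ : Euc m → ℝ} {ρ : ℝ} (hs : tsupport φ ⊆ closedBall 0 ρ) :
    HasCompactSupport φ :=
  HasCompactSupport.of_support_subset_isCompact (isCompact_closedBall 0 ρ)
    ((subset_tsupport φ).trans hs)

lemma hcs_shift {m : ℕ} {φ : Euc m → ℝ} (h : HasCompactSupport φ) (z : Euc m) :
    HasCompactSupport (fun y => φ (y - z)) := by
  have := h.comp_homeomorph (Homeomorph.addRight (-z))
  simpa [Function.comp_def, sub_eq_add_neg] using this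

lemma avg_hasDerivAt {m : ℕ} {f : Euc m → ℝ} {G : Euc m → Euc m →L[ℝ] ℝ}
    (hf : LocallyIntegrable f) (hG : HasWeakFDerivOn univ f G)
    {φ : Euc m → ℝ} {ρ : ℝ} (hφ : ContDiff ℝ (⊤ : ℕ∞) φ) (hs : tsupport φ ⊆ closedBall 0 ρ)
    (hGi : LocallyIntegrable G)
    (z ζ : Euc m) (t : ℝ) :
    HasDerivAt (fun τ : ℝ => Avg f φ (z + τ • ζ)) (∫ y, φ (y - (z + t • ζ)) * G y ζ) t := by
  have hd : Differentiable ℝ φ := hφ.differentiable (by simp)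
  have hcf : Continuous (fderiv ℝ φ) := hφ.continuous_fderiv (by simp)
  have hcs : HasCompactSupport φ := hcs_of hs
  obtain ⟨M, hM⟩ := (hcs.fderiv (𝕜 := ℝ)).exists_bound_of_continuous hcf
  have hM0 : 0 ≤ M := (norm_nonneg _).trans (hM 0)
  set R := ρ + (|t| + 1) * ‖ζ‖ with hR
  have key := hasDerivAt_integral_of_dominated_loc_of_deriv_le (μ := volume)
    (F := fun (τ : ℝ) (y : Euc m) => f y * φ (y - (z + τ • ζ)))
    (F' := fun (τ : ℝ) (y : Euc m) => - (f y * fderiv ℝ φ (y - (z + τ • ζ)) ζ))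
    (bound := (closedBall z R).indicator (fun y => ‖f y‖ * (M * ‖ζ‖)))
    (x₀ := t) (s := ball t 1) (ball_mem_nhds t one_pos) ?_ ?_ ?_ ?_ ?_ ?_
  · have h2 := key.2
    have h3 : ∫ y, -(f y * fderiv ℝ φ (y - (z + t • ζ)) ζ) = ∫ y, φ (y - (z + t • ζ)) * G y ζ := by
      have hcomp : ∀ y, fderiv ℝ (fun y => φ (y - (z + t • ζ))) y = fderiv ℝ φ (y - (z + t • ζ)) := by
        intro y
        rw [fderiv_comp_sub]
      have hw := hG (fun y => φ (y - (z + t • ζ))) (hφ.comp (contDiff_id.sub contDiff_const))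
        (hcs_shift hcs _) (subset_univ _)
      simp only [Measure.restrict_univ, hcomp] at hw
      have hw2 := congrArg (fun L : Euc m →L[ℝ] ℝ => L ζ) hw
      simp only [_root_.neg_apply] at hw2
      have i1 : Integrable (fun y => f y • fderiv ℝ φ (y - (z + t • ζ))) := by
        apply hf.integrable_smul_right_of_hasCompactSupport
        · fun_prop
        · have := (hcs_shift hcs (z + t • ζ)).fderiv (𝕜 := ℝ)
          have e : (fderiv ℝ fun y => φ (y - (z + t • ζ))) = fun y => fderiv ℝ φ (y - (z + t • ζ)) := funext hcomp
          rwa [e] at this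
      have i2 : Integrable (fun y => φ (y - (z + t • ζ)) • G y) := by
        apply hGi.integrable_smul_left_of_hasCompactSupport
        · exact hφ.continuous.comp (by fun_prop)
        · exact hcs_shift hcs _
      rw [ContinuousLinearMap.integral_apply i1, ContinuousLinearMap.integral_apply i2] at hw2
      simp only [_root_.smul_apply, smul_eq_mul] at hw2
      rw [integral_neg, hw2, neg_neg]
    rw [h3] at h2
    exact h2
  · refine Eventually.of_forall fun τ => ?_
    exact hf.aestronglyMeasurable.mul (hφ.continuous.comp (by fun_prop)).aestronglyMeasurable
  · exact loc_mul hf (hφ.continuous.comp (by fun_prop)) (hcs_shift hcs _)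
  · refine (hf.aestronglyMeasurable.mul ?_).neg
    apply Continuous.aestronglyMeasurable
    fun_prop
  · refine Eventually.of_forall fun y τ hτ => ?_
    by_cases hy : y ∈ closedBall z R
    · rw [indicator_of_mem hy, norm_neg, norm_mul]
      gcongr
      exact (ContinuousLinearMap.le_opNorm _ _).trans (by gcongr; exact hM _)
    · rw [indicator_of_notMem hy]
      rw [supp_fderiv_zero hs]
      · simp
      · simp only [mem_closedBall, not_le, dist_eq_norm] at hy
        have h1 : ‖y - z‖ ≤ ‖y - (z + τ • ζ)‖ + ‖τ • ζ‖ := by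
          have : y - z = (y - (z + τ • ζ)) + τ • ζ := by abel
          rw [this]; exact norm_add_le _ _
        have h2 : ‖τ • ζ‖ ≤ (|t| + 1) * ‖ζ‖ := by
          rw [norm_smul]
          gcongr
          have := hτ
          rw [mem_ball, Real.dist_eq] at this
          rw [Real.norm_eq_abs]
          have := abs_sub_abs_le_abs_sub τ t
          linarith
        linarith
  · rw [integrable_indicator_iff measurableSet_closedBall]
    exact ((hf.integrableOn_isCompact (isCompact_closedBall _ _)).norm).mul_const _
  · refine Eventually.of_forall fun y τ _ => ?_
    have h1 : HasDerivAt (fun τ : ℝ => y - (z + τ • ζ)) (-ζ) τ := by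
      have := (((hasDerivAt_id τ).smul_const ζ).const_add z).const_sub y
      simpa using this
    have h2 := (hd (y - (z + τ • ζ))).hasFDerivAt.comp_hasDerivAt τ h1
    have h3 := h2.const_mul (f y)
    simpa using h3

lemma avg_translate {m : ℕ} {f : Euc m → ℝ} {G : Euc m → Euc m →L[ℝ] ℝ}
    (hf : LocallyIntegrable f) (hG : HasWeakFDerivOn univ f G)
    {φ : Euc m → ℝ} {ρ M : ℝ} (hφ : ContDiff ℝ (⊤ : ℕ∞) φ) (hs : tsupport φ ⊆ closedBall 0 ρ)
    (hGi : LocallyIntegrable G) (hM : ∀ x, |φ x| ≤ M) (hM0 : 0 ≤ M)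
    (z ζ : Euc m) (K : Set (Euc m)) (hKm : MeasurableSet K)
    (hK : ∀ τ ∈ Icc (0:ℝ) 1, closedBall (z + τ • ζ) ρ ⊆ K) :
    ENNReal.ofReal |Avg f φ (z + ζ) - Avg f φ z| ≤
      ENNReal.ofReal (‖ζ‖ * M) * ∫⁻ x in K, ‖G x‖ₑ := by
  set K' := K ∩ closedBall z (ρ + ‖ζ‖) with hK'
  have hK'm : MeasurableSet K' := hKm.inter measurableSet_closedBall
  have hint : IntegrableOn G K' :=
    (hGi.integrableOn_isCompact (isCompact_closedBall z (ρ + ‖ζ‖))).mono_set inter_subset_right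
  have hb : ∀ τ ∈ Icc (0:ℝ) 1, ‖∫ y, φ (y - (z + τ • ζ)) * G y ζ‖ ≤ ‖ζ‖ * M * ∫ x in K', ‖G x‖ := by
    intro τ hτ
    have e : ∫ y, φ (y - (z + τ • ζ)) * G y ζ = ∫ y in K', φ (y - (z + τ • ζ)) * G y ζ := by
      symm
      apply setIntegral_eq_integral_of_forall_compl_eq_zero
      intro x hx
      rw [supp_zero hs, zero_mul]
      by_contra hcon
      push Not at hcon
      apply hx
      refine ⟨hK τ hτ (by rwa [mem_closedBall, dist_eq_norm]), ?_⟩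
      rw [mem_closedBall, dist_eq_norm]
      have : x - z = (x - (z + τ • ζ)) + τ • ζ := by abel
      rw [this]
      refine (norm_add_le _ _).trans ?_
      rw [norm_smul, Real.norm_eq_abs, abs_of_nonneg hτ.1]
      have := mul_le_of_le_one_left (norm_nonneg ζ) hτ.2
      linarith
    rw [e]
    calc ‖∫ y in K', φ (y - (z + τ • ζ)) * G y ζ‖ ≤ ∫ y in K', ‖ζ‖ * M * ‖G y‖ := by
          apply norm_integral_le_of_norm_le (hint.norm.const_mul _)
          refine Eventually.of_forall fun y => ?_
          rw [norm_mul, Real.norm_eq_abs]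
          calc |φ (y - (z + τ • ζ))| * ‖G y ζ‖ ≤ M * (‖G y‖ * ‖ζ‖) := by
                gcongr
                · exact hM _
                · exact ContinuousLinearMap.le_opNorm _ _
            _ = _ := by ring
      _ = _ := by rw [integral_const_mul]
  have hmv := norm_image_sub_le_of_norm_deriv_le_segment_01' (f := fun τ : ℝ => Avg f φ (z + τ • ζ))
    (f' := fun τ => ∫ y, φ (y - (z + τ • ζ)) * G y ζ) (C := ‖ζ‖ * M * ∫ x in K', ‖G x‖)
    (fun τ _ => (avg_hasDerivAt hf hG hφ hs hGi z ζ τ).hasDerivWithinAt)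
    (fun τ hτ => hb τ ⟨hτ.1, hτ.2.le⟩)
  simp only [one_smul, zero_smul, add_zero, Real.norm_eq_abs] at hmv
  calc ENNReal.ofReal |Avg f φ (z + ζ) - Avg f φ z|
      ≤ ENNReal.ofReal (‖ζ‖ * M * ∫ x in K', ‖G x‖) := ENNReal.ofReal_le_ofReal hmv
    _ = ENNReal.ofReal (‖ζ‖ * M) * ∫⁻ x in K', ‖G x‖ₑ := by
        rw [ENNReal.ofReal_mul (by positivity), ofReal_integral_norm_eq_lintegral_enorm hint]
    _ ≤ _ := by
        gcongr
        exact inter_subset_left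

lemma avg_swap {m : ℕ} {f : Euc m → ℝ}
    (hf : LocallyIntegrable f)
    {φ χ : Euc m → ℝ} {ρ : ℝ} (hφ : Continuous φ) (hs : tsupport φ ⊆ closedBall 0 ρ)
    (hχ : Continuous χ) (hs' : tsupport χ ⊆ closedBall 0 ρ) (z : Euc m) :
    ∫ s, χ s * Avg f φ (z + s) = ∫ y, f y * ∫ s, χ s * φ (y - z - s) := by
  have hcs : HasCompactSupport φ := hcs_of hs
  have hcs' : HasCompactSupport χ := hcs_of hs'
  obtain ⟨M, hM⟩ := hcs.exists_bound_of_continuous hφ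
  set B := closedBall z (2 * ρ) with hB
  have hfB : Integrable (B.indicator f) := by
    rw [integrable_indicator_iff measurableSet_closedBall]
    exact hf.integrableOn_isCompact (isCompact_closedBall _ _)
  have hpt : ∀ s y, χ s * (f y * φ (y - (z + s))) = χ s * (B.indicator f y) * φ (y - z - s) := by
    intro s y
    have e : y - (z + s) = y - z - s := by abel
    rw [e]
    by_cases hy : y ∈ B
    · rw [indicator_of_mem hy]; ring
    · rw [indicator_of_notMem hy]
      by_cases h1 : ρ < ‖s‖
      · rw [supp_zero hs' h1]; simp
      · rw [supp_zero hs (x := y - z - s)]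
        · simp
        · simp only [hB, mem_closedBall, not_le, dist_eq_norm] at hy
          have : ‖y - z‖ ≤ ‖y - z - s‖ + ‖s‖ := by
            have e2 : y - z = (y - z - s) + s := by abel
            calc ‖y - z‖ = ‖(y - z - s) + s‖ := by rw [← e2]
              _ ≤ _ := norm_add_le _ _
          linarith
  have hint : Integrable (fun p : Euc m × Euc m => χ p.1 * (B.indicator f p.2) * φ (p.2 - z - p.1))
      (volume.prod volume) := by
    have h1 := (hχ.integrable_of_hasCompactSupport hcs' (μ := volume)).mul_prod hfB
    exact h1.mul_bdd (c := M) (by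
      apply Continuous.aestronglyMeasurable
      exact hφ.comp (by fun_prop)) (Eventually.of_forall fun p => hM _)
  calc ∫ s, χ s * Avg f φ (z + s) = ∫ s, ∫ y, χ s * (B.indicator f y) * φ (y - z - s) := by
        congr 1; ext s
        rw [Avg, ← integral_const_mul]
        simp_rw [hpt]
    _ = ∫ y, ∫ s, χ s * (B.indicator f y) * φ (y - z - s) := integral_integral_swap hint
    _ = _ := by
        congr 1; ext y
        rw [← integral_const_mul]
        congr 1; ext s
        rw [← hpt]
        have e : y - (z + s) = y - z - s := by abel
        rw [e]; ring

lemma avg_comm {m : ℕ} {f : Euc m → ℝ}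
    (hf : LocallyIntegrable f)
    {φ χ : Euc m → ℝ} {ρ : ℝ} (hφ : Continuous φ) (hs : tsupport φ ⊆ closedBall 0 ρ)
    (hχ : Continuous χ) (hs' : tsupport χ ⊆ closedBall 0 ρ) (z : Euc m) :
    ∫ s, χ s * Avg f φ (z + s) = ∫ s, φ s * Avg f χ (z + s) := by
  rw [avg_swap hf hφ hs hχ hs', avg_swap hf hχ hs' hφ hs]
  congr 1; ext y; congr 1
  rw [← integral_sub_left_eq_self _ volume (y - z)]
  congr 1; ext s
  have e : y - z - (y - z - s) = s := by abel
  rw [e, mul_comm]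

lemma avg_continuous {m : ℕ} {f : Euc m → ℝ}
    (hf : LocallyIntegrable f)
    {φ : Euc m → ℝ} {ρ : ℝ} (hφ : Continuous φ) (hs : tsupport φ ⊆ closedBall 0 ρ) :
    Continuous (Avg f φ) := by
  have hcs : HasCompactSupport φ := hcs_of hs
  obtain ⟨M, hM⟩ := hcs.exists_bound_of_continuous hφ
  rw [continuous_iff_continuousAt]
  intro z
  apply continuousAt_of_dominated (bound := (closedBall z (ρ + 1)).indicator (fun y => ‖f y‖ * M))
  · exact Eventually.of_forall fun w => hf.aestronglyMeasurable.mul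
      (hφ.comp (by fun_prop)).aestronglyMeasurable
  · filter_upwards [ball_mem_nhds z one_pos] with w hw
    refine Eventually.of_forall fun y => ?_
    by_cases hy : y ∈ closedBall z (ρ + 1)
    · rw [indicator_of_mem hy, norm_mul]
      gcongr
      exact hM _
    · rw [indicator_of_notMem hy, supp_zero hs]
      · simp
      · simp only [mem_closedBall, not_le] at hy
        rw [← dist_eq_norm]
        have := dist_triangle y w z
        rw [mem_ball] at hw
        linarith
  · rw [integrable_indicator_iff measurableSet_closedBall]
    exact ((hf.integrableOn_isCompact (isCompact_closedBall _ _)).norm).mul_const _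
  · refine Eventually.of_forall fun y => ?_
    exact (continuous_const.mul (hφ.comp (by fun_prop))).continuousAt

/-- one half of the scale change -/
lemma avg_scale_half {m : ℕ} {f : Euc m → ℝ} {G : Euc m → Euc m →L[ℝ] ℝ}
    (hf : LocallyIntegrable f) (hG : HasWeakFDerivOn univ f G)
    {φ χ : Euc m → ℝ} {ρ M : ℝ} (hφ : ContDiff ℝ (⊤ : ℕ∞) φ) (hs : tsupport φ ⊆ closedBall 0 ρ)
    (hGi : LocallyIntegrable G) (hM : ∀ x, |φ x| ≤ M) (hM0 : 0 ≤ M)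
    (hχ : Continuous χ) (hs' : tsupport χ ⊆ closedBall 0 ρ) (hχ0 : ∀ x, 0 ≤ χ x)
    (hχ1 : ∫ x, χ x = 1) (hρ : 0 ≤ ρ)
    (z : Euc m) (K : Set (Euc m)) (hKm : MeasurableSet K)
    (hK : closedBall z (2 * ρ) ⊆ K) (hKfin : ∫⁻ x in K, ‖G x‖ₑ ≠ ⊤) :
    |(∫ s, χ s * Avg f φ (z + s)) - Avg f φ z| ≤
      ρ * M * (∫⁻ x in K, ‖G x‖ₑ).toReal := by
  have hcs' : HasCompactSupport χ := hcs_of hs'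
  have hχi := hχ.integrable_of_hasCompactSupport hcs' (μ := volume)
  have hA := avg_continuous hf hφ.continuous hs
  have e1 : (∫ s, χ s * Avg f φ (z + s)) - Avg f φ z = ∫ s, χ s * (Avg f φ (z + s) - Avg f φ z) := by
    simp_rw [mul_sub]
    rw [integral_sub, integral_mul_const, hχ1, one_mul]
    · apply Continuous.integrable_of_hasCompactSupport
      · exact hχ.mul (hA.comp (by fun_prop))
      · exact hcs'.mul_right
    · exact hχi.mul_const _
  rw [e1]
  calc |∫ s, χ s * (Avg f φ (z + s) - Avg f φ z)|
      ≤ ∫ s, χ s * (ρ * M * (∫⁻ x in K, ‖G x‖ₑ).toReal) := by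
        rw [← Real.norm_eq_abs]
        apply norm_integral_le_of_norm_le (hχi.mul_const _)
        refine Eventually.of_forall fun s => ?_
        rw [norm_mul, Real.norm_eq_abs, abs_of_nonneg (hχ0 s)]
        by_cases h1 : ρ < ‖s‖
        · rw [supp_zero hs' h1]; simp
        · push Not at h1
          gcongr
          · exact hχ0 s
          have h2 := avg_translate hf hG hφ hs hGi hM hM0 z s K hKm (by
            intro τ hτ
            refine subset_trans ?_ hK
            apply closedBall_subset_closedBall'
            rw [dist_eq_norm]
            simp only [add_sub_cancel_left, norm_smul, Real.norm_eq_abs, abs_of_nonneg hτ.1]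
            have := mul_le_of_le_one_left (norm_nonneg s) hτ.2
            linarith)
          have h3 := ENNReal.toReal_mono (ENNReal.mul_ne_top ENNReal.ofReal_ne_top hKfin) h2
          rw [ENNReal.toReal_ofReal (abs_nonneg _), ENNReal.toReal_mul,
            ENNReal.toReal_ofReal (by positivity)] at h3
          rw [Real.norm_eq_abs]
          refine h3.trans ?_
          gcongr
    _ = _ := by rw [integral_mul_const, hχ1, one_mul]

lemma avg_scale {m : ℕ} {f : Euc m → ℝ} {G : Euc m → Euc m →L[ℝ] ℝ}
    (hf : LocallyIntegrable f) (hG : HasWeakFDerivOn univ f G)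
    {φ χ : Euc m → ℝ} {ρ M : ℝ} (hφ : ContDiff ℝ (⊤ : ℕ∞) φ) (hs : tsupport φ ⊆ closedBall 0 ρ)
    (hGi : LocallyIntegrable G) (hM : ∀ x, |φ x| ≤ M) (hM0 : 0 ≤ M)
    (hφ0 : ∀ x, 0 ≤ φ x) (hφ1 : ∫ x, φ x = 1)
    (hχ : ContDiff ℝ (⊤ : ℕ∞) χ) (hs' : tsupport χ ⊆ closedBall 0 ρ) (hχ0 : ∀ x, 0 ≤ χ x)
    (hχ1 : ∫ x, χ x = 1) (hχM : ∀ x, |χ x| ≤ M) (hρ : 0 ≤ ρ)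
    (z : Euc m) (K : Set (Euc m)) (hKm : MeasurableSet K)
    (hK : closedBall z (2 * ρ) ⊆ K) :
    ENNReal.ofReal |Avg f φ z - Avg f χ z| ≤
      ENNReal.ofReal (2 * ρ * M) * ∫⁻ x in K, ‖G x‖ₑ := by
  have hfin : ∫⁻ x in closedBall z (2 * ρ), ‖G x‖ₑ ≠ ⊤ :=
    (hGi.integrableOn_isCompact (isCompact_closedBall z (2 * ρ))).2.ne
  have h1 := avg_scale_half hf hG hφ hs hGi hM hM0 hχ.continuous hs' hχ0 hχ1 hρ z _
    measurableSet_closedBall subset_rfl hfin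
  have h2 := avg_scale_half hf hG hχ hs' hGi hχM hM0 hφ.continuous hs hφ0 hφ1 hρ z _
    measurableSet_closedBall subset_rfl hfin
  rw [avg_comm hf hφ.continuous hs hχ.continuous hs'] at h1
  have h3 : |Avg f φ z - Avg f χ z| ≤ 2 * ρ * M * (∫⁻ x in closedBall z (2 * ρ), ‖G x‖ₑ).toReal := by
    rw [abs_le] at *
    constructor <;> linarith [h1.1, h1.2, h2.1, h2.2]
  calc ENNReal.ofReal |Avg f φ z - Avg f χ z| ≤ _ := ENNReal.ofReal_le_ofReal h3
    _ = ENNReal.ofReal (2 * ρ * M) * ∫⁻ x in closedBall z (2 * ρ), ‖G x‖ₑ := by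
        rw [ENNReal.ofReal_mul (by positivity), ENNReal.ofReal_toReal hfin]
    _ ≤ _ := by gcongr

lemma avg_L1 {m : ℕ} {h φ : Euc m → ℝ} (hh : AEStronglyMeasurable h volume) (hφ : Continuous φ) :
    ∫⁻ x, ‖Avg h φ x‖ₑ ≤ (∫⁻ y, ‖h y‖ₑ) * ∫⁻ y, ‖φ y‖ₑ := by
  calc ∫⁻ x, ‖Avg h φ x‖ₑ ≤ ∫⁻ x, ∫⁻ y, ‖h y‖ₑ * ‖φ (y - x)‖ₑ := by
        gcongr with x
        refine (enorm_integral_le_lintegral_enorm _).trans ?_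
        gcongr with y
        rw [enorm_mul]
    _ = ∫⁻ y, ∫⁻ x, ‖h y‖ₑ * ‖φ (y - x)‖ₑ := by
        apply lintegral_lintegral_swap
        refine AEMeasurable.mul (f := fun p : Euc m × Euc m => ‖h p.2‖ₑ)
          (g := fun p : Euc m × Euc m => ‖φ (p.2 - p.1)‖ₑ) ?_ ?_
        · exact hh.enorm.comp_snd
        · have : Continuous (fun p : Euc m × Euc m => ‖φ (p.2 - p.1)‖ₑ) := by fun_prop
          exact this.aemeasurable
    _ = ∫⁻ y, ‖h y‖ₑ * ∫⁻ x, ‖φ x‖ₑ := by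
        congr 1; ext y
        rw [lintegral_const_mul]
        · rw [lintegral_sub_left_eq_self (fun x => ‖φ x‖ₑ) y]
        · have : Continuous (fun x : Euc m => ‖φ (y - x)‖ₑ) := by fun_prop
          exact this.measurable
    _ = _ := by
        rw [lintegral_mul_const'' _ hh.enorm]

lemma poincare_avg {m : ℕ} {f : Euc m → ℝ} {G : Euc m → Euc m →L[ℝ] ℝ}
    (hf : Integrable f) (hG : HasWeakFDerivOn univ f G) (hGi : Integrable G)
    {R : ℝ} (hR : 0 ≤ R) (hfR : ∀ x, R < ‖x‖ → f x = 0) (ζ : Euc m) (hζ : 2 * R + 4 ≤ ‖ζ‖)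
    {φ : Euc m → ℝ} (hφ : ContDiff ℝ (⊤ : ℕ∞) φ) (hs : tsupport φ ⊆ closedBall 0 1)
    (hφ0 : ∀ x, 0 ≤ φ x) (hφ1 : ∫ x, φ x = 1) :
    ∫⁻ x, ‖Avg f φ x‖ₑ ≤ ‖ζ‖ₑ * ∫⁻ y, ‖G y‖ₑ := by
  set h : Euc m → ℝ := fun y => G y ζ with hh
  have hhi : Integrable h := hGi.apply_continuousLinearMap ζ
  have hhc : Continuous (Avg h φ) := avg_continuous hhi.locallyIntegrable hφ.continuous hs
  have hφi : ∫⁻ y, ‖φ y‖ₑ = 1 := by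
    have hi := hφ.continuous.integrable_of_hasCompactSupport (hcs_of hs) (μ := volume)
    rw [← ofReal_integral_norm_eq_lintegral_enorm hi]
    simp only [Real.norm_eq_abs]
    simp_rw [abs_of_nonneg (hφ0 _)]
    rw [hφ1]; simp
  have hz : ∀ x : Euc m, R + 1 < ‖x‖ → Avg f φ x = 0 := by
    intro x hx
    rw [Avg]
    rw [← integral_zero (Euc m) ℝ]
    congr 1; ext y
    by_cases hy : R < ‖y‖
    · rw [hfR y hy, zero_mul]
    · rw [supp_zero hs (x := y - x), mul_zero]
      have : ‖x‖ ≤ ‖y - x‖ + ‖y‖ := by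
        have := norm_sub_norm_le x y
        rw [norm_sub_rev] at this; linarith
      linarith
  have hpt : ∀ x, ‖Avg f φ x‖ₑ ≤ ∫⁻ τ in Ioc (0:ℝ) 1, ‖Avg h φ (x + τ • ζ)‖ₑ := by
    intro x
    by_cases hx : R + 1 < ‖x‖
    · rw [hz x hx]; simp
    · push Not at hx
      have h1 : Avg f φ (x + ζ) = 0 := by
        apply hz
        have : ‖ζ‖ ≤ ‖x + ζ‖ + ‖x‖ := by
          have := norm_sub_le (x + ζ) x
          simpa using this
        linarith
      have hder : ∀ τ ∈ uIcc (0:ℝ) 1, HasDerivAt (fun τ : ℝ => Avg f φ (x + τ • ζ)) (Avg h φ (x + τ • ζ)) τ := by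
        intro τ _
        have := avg_hasDerivAt hf.locallyIntegrable hG hφ hs hGi.locallyIntegrable x ζ τ
        have e : Avg h φ (x + τ • ζ) = ∫ y, φ (y - (x + τ • ζ)) * G y ζ := by
          rw [Avg]; congr 1; ext y; rw [mul_comm]
        rw [e]; exact this
      have hcont : Continuous (fun τ : ℝ => Avg h φ (x + τ • ζ)) := hhc.comp (by fun_prop)
      have h2 := intervalIntegral.integral_eq_sub_of_hasDerivAt hder (hcont.intervalIntegrable _ _)
      simp only [one_smul, zero_smul, add_zero, h1, zero_sub] at h2
      rw [← enorm_neg, ← h2, intervalIntegral.integral_of_le zero_le_one]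
      exact enorm_integral_le_lintegral_enorm _
  calc ∫⁻ x, ‖Avg f φ x‖ₑ ≤ ∫⁻ x, ∫⁻ τ in Ioc (0:ℝ) 1, ‖Avg h φ (x + τ • ζ)‖ₑ := lintegral_mono hpt
    _ = ∫⁻ τ in Ioc (0:ℝ) 1, ∫⁻ x, ‖Avg h φ (x + τ • ζ)‖ₑ := by
        apply lintegral_lintegral_swap
        have : Continuous (fun p : Euc m × ℝ => ‖Avg h φ (p.1 + p.2 • ζ)‖ₑ) := by fun_prop
        exact this.aemeasurable
    _ = ∫⁻ τ in Ioc (0:ℝ) 1, ∫⁻ x, ‖Avg h φ x‖ₑ := by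
        congr 1; ext τ
        exact lintegral_add_right_eq_self (fun x => ‖Avg h φ x‖ₑ) (τ • ζ)
    _ = ∫⁻ x, ‖Avg h φ x‖ₑ := by simp
    _ ≤ (∫⁻ y, ‖h y‖ₑ) * 1 := by rw [← hφi]; exact avg_L1 hhi.aestronglyMeasurable hφ.continuous
    _ ≤ ∫⁻ y, ‖ζ‖ₑ * ‖G y‖ₑ := by
        rw [mul_one]
        gcongr with y
        rw [mul_comm]
        exact (G y).le_opENorm ζ
    _ = _ := by rw [lintegral_const_mul'' _ hGi.aestronglyMeasurable.enorm]

lemma poincare {m : ℕ} {f : Euc m → ℝ} {G : Euc m → Euc m →L[ℝ] ℝ}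
    (hf : Integrable f) (hG : HasWeakFDerivOn univ f G) (hGi : Integrable G)
    {R : ℝ} (hR : 0 ≤ R) (hfR : ∀ x, R < ‖x‖ → f x = 0) (ζ : Euc m) (hζ : 2 * R + 4 ≤ ‖ζ‖) :
    ∫⁻ x, ‖f x‖ₑ ≤ ‖ζ‖ₑ * ∫⁻ y, ‖G y‖ₑ := by
  let φ : ℕ → ContDiffBump (0 : Euc m) := fun k =>
    { rIn := 1 / (k + 1) / 2, rOut := 1 / (k + 1), rIn_pos := by positivity,
      rIn_lt_rOut := half_lt_self (by positivity) }
  have h1 := ContDiffBump.ae_convolution_tendsto_right_of_locallyIntegrable (φ := φ) (l := atTop)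
    (K := 2) (μ := volume) (g := f) tendsto_one_div_add_atTop_nhds_zero_nat
    (Eventually.of_forall fun k => by simp only [φ]; linarith) hf.locallyIntegrable
  have hconv : ∀ k x, convolution ((φ k).normed volume) f (ContinuousLinearMap.lsmul ℝ ℝ) volume x =
      Avg f ((φ k).normed volume) x := by
    intro k x
    rw [MeasureTheory.convolution_def, Avg, ← integral_sub_left_eq_self _ volume x]
    congr 1; ext y
    have e : x - (x - y) = y := by abel
    have e2 : x - y = - (y - x) := by abel
    simp only [ContinuousLinearMap.lsmul_apply, smul_eq_mul]
    rw [e, e2, ContDiffBump.normed_neg, mul_comm]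
  simp_rw [hconv] at h1
  have hb : ∀ k, ∫⁻ x, ‖Avg f ((φ k).normed volume) x‖ₑ ≤ ‖ζ‖ₑ * ∫⁻ y, ‖G y‖ₑ := by
    intro k
    apply poincare_avg hf hG hGi hR hfR ζ hζ (ContDiffBump.contDiff_normed _) ?_
      (ContDiffBump.nonneg_normed _) (ContDiffBump.integral_normed _)
    rw [ContDiffBump.tsupport_normed_eq]
    apply closedBall_subset_closedBall
    simp only [φ]
    rw [div_le_one (by positivity)]
    linarith [(Nat.cast_nonneg k : (0:ℝ) ≤ k)]
  have hcont : ∀ k, Continuous (Avg f ((φ k).normed volume)) := fun k =>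
    avg_continuous hf.locallyIntegrable (ContDiffBump.continuous_normed _)
      (ρ := (φ k).rOut) (by rw [ContDiffBump.tsupport_normed_eq])
  calc ∫⁻ x, ‖f x‖ₑ = ∫⁻ x, liminf (fun k => ‖Avg f ((φ k).normed volume) x‖ₑ) atTop := by
        apply lintegral_congr_ae
        filter_upwards [h1] with x hx
        exact (((continuous_enorm.tendsto _).comp hx).liminf_eq).symm
    _ ≤ liminf (fun k => ∫⁻ x, ‖Avg f ((φ k).normed volume) x‖ₑ) atTop :=
        lintegral_liminf_le fun k => ((hcont k).enorm).measurable
    _ ≤ liminf (fun _ : ℕ => ‖ζ‖ₑ * ∫⁻ y, ‖G y‖ₑ) atTop :=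
        liminf_le_liminf (Eventually.of_forall hb)
    _ = _ := by simp

lemma dual_parallelogram {m : ℕ} (A B : Euc m →L[ℝ] ℝ) :
    ‖A + B‖ ^ 2 + ‖A - B‖ ^ 2 = 2 * (‖A‖ ^ 2 + ‖B‖ ^ 2) := by
  set T := (InnerProductSpace.toDual ℝ (Euc m)).symm with hT
  have h := parallelogram_law_with_norm ℝ (T A) (T B)
  rw [← map_add, ← map_sub] at h
  simp only [LinearIsometryEquiv.norm_map] at h
  simp only [pow_two]
  linarith

lemma clarkson {m : ℕ} {p : ℝ} (hp : 2 ≤ p) (A B : Euc m →L[ℝ] ℝ) :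
    ‖(1 / 2 : ℝ) • (A + B)‖ ^ p + ‖(1 / 2 : ℝ) • (A - B)‖ ^ p ≤ (‖A‖ ^ p + ‖B‖ ^ p) / 2 := by
  have hpp : ∀ x : ℝ, 0 ≤ x → x ^ p = (x ^ 2) ^ (p / 2) := by
    intro x hx
    rw [← Real.rpow_natCast, ← Real.rpow_mul hx]
    congr 1; push_cast; ring
  have h1 : 1 ≤ p / 2 := by linarith
  rw [hpp _ (norm_nonneg _), hpp _ (norm_nonneg _), hpp _ (norm_nonneg A), hpp _ (norm_nonneg B)]
  have h2 : ‖(1 / 2 : ℝ) • (A + B)‖ ^ 2 + ‖(1 / 2 : ℝ) • (A - B)‖ ^ 2 = (‖A‖ ^ 2 + ‖B‖ ^ 2) / 2 := by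
    rw [norm_smul, norm_smul]
    have := dual_parallelogram A B
    norm_num
    nlinarith
  calc _ ≤ (‖(1 / 2 : ℝ) • (A + B)‖ ^ 2 + ‖(1 / 2 : ℝ) • (A - B)‖ ^ 2) ^ (p / 2) :=
        Real.add_rpow_le_rpow_add (by positivity) (by positivity) h1
    _ = ((1/2) * ‖A‖ ^ 2 + (1/2) * ‖B‖ ^ 2) ^ (p / 2) := by rw [h2]; congr 1; ring
    _ ≤ (1/2) * (‖A‖ ^ 2) ^ (p / 2) + (1/2) * (‖B‖ ^ 2) ^ (p / 2) := by
        have := (convexOn_rpow h1).2 (show ‖A‖^2 ∈ Ici (0:ℝ) from mem_Ici.2 (by positivity))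
          (show ‖B‖^2 ∈ Ici (0:ℝ) from mem_Ici.2 (by positivity))
          (by norm_num : (0:ℝ) ≤ 1/2) (by norm_num : (0:ℝ) ≤ 1/2) (by norm_num)
        simpa only [smul_eq_mul] using this
    _ = _ := by ring

lemma mid_convex {m : ℕ} {q : ℝ} (hq : 1 ≤ q) (A B : Euc m →L[ℝ] ℝ) :
    ‖(1 / 2 : ℝ) • (A + B)‖ ^ q ≤ (‖A‖ ^ q + ‖B‖ ^ q) / 2 := by
  have h0 : ‖(1 / 2 : ℝ) • (A + B)‖ ≤ (1/2) * ‖A‖ + (1/2) * ‖B‖ := by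
    rw [norm_smul]
    have := norm_add_le A B
    norm_num
    linarith
  calc _ ≤ ((1/2) * ‖A‖ + (1/2) * ‖B‖) ^ q := by gcongr
    _ ≤ (1/2) * ‖A‖ ^ q + (1/2) * ‖B‖ ^ q := by
        have := (convexOn_rpow hq).2 (show ‖A‖ ∈ Ici (0:ℝ) from mem_Ici.2 (by positivity))
          (show ‖B‖ ∈ Ici (0:ℝ) from mem_Ici.2 (by positivity))
          (by norm_num : (0:ℝ) ≤ 1/2) (by norm_num : (0:ℝ) ≤ 1/2) (by norm_num)
        simpa only [smul_eq_mul] using this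
    _ = _ := by ring

lemma box_norm {m : ℕ} {x : Euc m} (hx : x ∈ Box m) : ‖x‖ ≤ m := by
  rw [EuclideanSpace.norm_eq]
  have h : ∑ i, ‖x i‖ ^ 2 ≤ (m:ℝ) ^ 2 := by
    calc ∑ i, ‖x i‖ ^ 2 ≤ ∑ _i : Fin m, (1:ℝ) := by
          gcongr with i
          have h1 := hx i
          rw [Real.norm_eq_abs]
          nlinarith [abs_nonneg (x i)]
      _ = m := by simp
      _ ≤ _ := by
          have : (m:ℝ) ≤ m * m := by exact_mod_cast Nat.le_mul_self m
          nlinarith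
  exact Real.sqrt_le_iff.2 ⟨by positivity, h⟩

lemma box_measurable {m : ℕ} : MeasurableSet (Box m) := by
  have : Box m = ⋂ i, {x : Euc m | |x i| < 1} := by ext x; simp [Box]
  rw [this]
  refine MeasurableSet.iInter fun i => (isOpen_lt ?_ continuous_const).measurableSet
  fun_prop

lemma box_open {m : ℕ} : IsOpen (Box m) := by
  have : Box m = ⋂ i, {x : Euc m | |x i| < 1} := by ext x; simp [Box]
  rw [this]
  refine isOpen_iInter_of_finite fun i => (isOpen_lt ?_ continuous_const)
  fun_prop

lemma box_bdd {m : ℕ} : Box m ⊆ closedBall 0 m := by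
  intro x hx
  simpa using box_norm hx

lemma box_finite {m : ℕ} : volume (Box m) < ⊤ :=
  (measure_mono box_bdd).trans_lt measure_closedBall_lt_top

instance box_fin_inst {m : ℕ} : IsFiniteMeasure (volume.restrict (Box m)) :=
  ⟨by simpa using box_finite⟩

lemma test_bound {m : ℕ} {φ : Euc m → ℝ} (hφ : ContDiff ℝ (⊤ : ℕ∞) φ) (hc : HasCompactSupport φ) :
    ∃ M, 0 ≤ M ∧ (∀ x, ‖φ x‖ ≤ M) ∧ ∀ x, ‖fderiv ℝ φ x‖ ≤ M := by
  obtain ⟨M1, h1⟩ := hc.exists_bound_of_continuous hφ.continuous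
  obtain ⟨M2, h2⟩ := (hc.fderiv (𝕜 := ℝ)).exists_bound_of_continuous (hφ.continuous_fderiv (by simp))
  refine ⟨max M1 M2, ?_, fun x => (h1 x).trans (le_max_left _ _), fun x => (h2 x).trans (le_max_right _ _)⟩
  exact (norm_nonneg _).trans ((h1 0).trans (le_max_left _ _))

lemma test_int1 {m : ℕ} {μ : Measure (Euc m)} {u φ : Euc m → ℝ} (hu : Integrable u μ)
    (hφ : ContDiff ℝ (⊤ : ℕ∞) φ) (hc : HasCompactSupport φ) :
    Integrable (fun x => u x • fderiv ℝ φ x) μ := by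
  obtain ⟨M, _, _, h2⟩ := test_bound hφ hc
  exact hu.smul_bdd M (hφ.continuous_fderiv (by simp)).aestronglyMeasurable (Eventually.of_forall h2)

lemma test_int2 {m : ℕ} {μ : Measure (Euc m)} {φ : Euc m → ℝ} {G : Euc m → Euc m →L[ℝ] ℝ} (hu : Integrable G μ)
    (hφ : ContDiff ℝ (⊤ : ℕ∞) φ) (hc : HasCompactSupport φ) :
    Integrable (fun x => φ x • G x) μ := by
  obtain ⟨M, _, h1, _⟩ := test_bound hφ hc
  exact hu.bdd_smul M hφ.continuous.aestronglyMeasurable (Eventually.of_forall h1)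

lemma weak_add {m : ℕ} {Ω : Set (Euc m)} {u v : Euc m → ℝ} {G H : Euc m → Euc m →L[ℝ] ℝ}
    (hu : IntegrableOn u Ω) (hv : IntegrableOn v Ω) (hG : IntegrableOn G Ω) (hH : IntegrableOn H Ω)
    (h1 : HasWeakFDerivOn Ω u G) (h2 : HasWeakFDerivOn Ω v H) :
    HasWeakFDerivOn Ω (fun x => u x + v x) (fun x => G x + H x) := by
  intro φ hφ hc hs
  simp only [add_smul, smul_add]
  rw [integral_add (test_int1 hu hφ hc) (test_int1 hv hφ hc),
    integral_add (test_int2 hG hφ hc) (test_int2 hH hφ hc), h1 φ hφ hc hs, h2 φ hφ hc hs, neg_add]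

lemma weak_smul {m : ℕ} {Ω : Set (Euc m)} {u : Euc m → ℝ} {G : Euc m → Euc m →L[ℝ] ℝ} (c : ℝ)
    (h1 : HasWeakFDerivOn Ω u G) :
    HasWeakFDerivOn Ω (fun x => c * u x) (fun x => c • G x) := by
  intro φ hφ hc hs
  have e1 : ∀ x, (c * u x) • fderiv ℝ φ x = c • (u x • fderiv ℝ φ x) := fun x => mul_smul _ _ _
  have e2 : ∀ x, φ x • (c • G x) = c • (φ x • G x) := fun x => smul_comm _ _ _
  simp only [e1, e2]
  rw [integral_smul, integral_smul, h1 φ hφ hc hs, smul_neg]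

lemma weak_mono {m : ℕ} {Ω : Set (Euc m)} {u : Euc m → ℝ} {G : Euc m → Euc m →L[ℝ] ℝ}
    (h1 : HasWeakFDerivOn univ u G) :
    HasWeakFDerivOn Ω u G := by
  intro φ hφ hc hs
  have := h1 φ hφ hc (subset_univ _)
  simp only [Measure.restrict_univ] at this
  rw [setIntegral_eq_integral_of_forall_compl_eq_zero, setIntegral_eq_integral_of_forall_compl_eq_zero, this]
  · intro x hx
    rw [image_eq_zero_of_notMem_tsupport (fun h => hx (hs h)), zero_smul]
  · intro x hx
    rw [image_eq_zero_of_notMem_tsupport (f := fderiv ℝ φ) (fun h => hx (hs (tsupport_fderiv_subset ℝ h))), smul_zero]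

lemma weak_lim {m : ℕ} {u : ℕ → Euc m → ℝ} {G : ℕ → Euc m → Euc m →L[ℝ] ℝ}
    {v : Euc m → ℝ} {H : Euc m → Euc m →L[ℝ] ℝ}
    (hu : ∀ k, Integrable (u k)) (hG : ∀ k, Integrable (G k)) (hv : Integrable v) (hH : Integrable H)
    (h : ∀ k, HasWeakFDerivOn univ (u k) (G k))
    (l1 : Tendsto (fun k => ∫⁻ x, ‖u k x - v x‖ₑ) atTop (𝓝 0))
    (l2 : Tendsto (fun k => ∫⁻ x, ‖G k x - H x‖ₑ) atTop (𝓝 0)) :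
    HasWeakFDerivOn univ v H := by
  intro φ hφ hc hs
  obtain ⟨M, hM, hb1, hb2⟩ := test_bound hφ hc
  simp only [Measure.restrict_univ]
  have t1 : Tendsto (fun k => ∫ x, u k x • fderiv ℝ φ x) atTop (𝓝 (∫ x, v x • fderiv ℝ φ x)) := by
    apply tendsto_integral_of_L1 _ (test_int1 hv hφ hc).aestronglyMeasurable
      (Eventually.of_forall fun k => test_int1 (hu k) hφ hc)
    have : Tendsto (fun k => ENNReal.ofReal M * ∫⁻ x, ‖u k x - v x‖ₑ) atTop (𝓝 0) := by
      have := ENNReal.Tendsto.const_mul (a := ENNReal.ofReal M) l1 (Or.inr ENNReal.ofReal_ne_top)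
      simpa using this
    refine tendsto_of_tendsto_of_tendsto_of_le_of_le tendsto_const_nhds this (fun _ => zero_le) fun k => ?_
    simp only
    rw [← lintegral_const_mul' _ _ ENNReal.ofReal_ne_top]
    gcongr with x
    rw [← sub_smul, enorm_smul, mul_comm]
    gcongr
    rw [← ofReal_norm]
    exact ENNReal.ofReal_le_ofReal (hb2 x)
  have t2 : Tendsto (fun k => ∫ x, φ x • G k x) atTop (𝓝 (∫ x, φ x • H x)) := by
    apply tendsto_integral_of_L1 _ (test_int2 hH hφ hc).aestronglyMeasurable
      (Eventually.of_forall fun k => test_int2 (hG k) hφ hc)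
    have : Tendsto (fun k => ENNReal.ofReal M * ∫⁻ x, ‖G k x - H x‖ₑ) atTop (𝓝 0) := by
      have := ENNReal.Tendsto.const_mul (a := ENNReal.ofReal M) l2 (Or.inr ENNReal.ofReal_ne_top)
      simpa using this
    refine tendsto_of_tendsto_of_tendsto_of_le_of_le tendsto_const_nhds this (fun _ => zero_le) fun k => ?_
    simp only
    rw [← lintegral_const_mul' _ _ ENNReal.ofReal_ne_top]
    gcongr with x
    have e : φ x • G k x - φ x • H x = φ x • (G k x - H x) := (smul_sub _ _ _).symm
    rw [e, enorm_smul]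
    gcongr
    rw [← ofReal_norm]
    exact ENNReal.ofReal_le_ofReal (hb1 x)
  have t3 : (fun k => ∫ x, u k x • fderiv ℝ φ x) = fun k => - ∫ x, φ x • G k x := by
    ext1 k
    have := h k φ hφ hc hs
    simpa only [Measure.restrict_univ] using this
  rw [t3] at t1
  exact tendsto_nhds_unique t1 t2.neg

noncomputable def dpE {m : ℕ} (p q : ℝ) (a : Euc m → ℝ) (x : Euc m) (A : Euc m →L[ℝ] ℝ) : ℝ≥0∞ :=
  ENNReal.ofReal (‖A‖ ^ p / p + a x * ‖A‖ ^ q / q)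

lemma dpE_mid {m : ℕ} {p q : ℝ} (hp : 2 ≤ p) (hq : 1 ≤ q) {a : Euc m → ℝ} (ha : ∀ x, 0 ≤ a x)
    (x : Euc m) (A B : Euc m →L[ℝ] ℝ) :
    2 * dpE p q a x ((1 / 2 : ℝ) • (A + B)) + 2 * ENNReal.ofReal (‖(1 / 2 : ℝ) • (A - B)‖ ^ p / p)
      ≤ dpE p q a x A + dpE p q a x B := by
  have h1 := clarkson hp A B
  have h2 := mid_convex hq A B
  have hax := ha x
  have hp0 : 0 < p := by linarith
  have hq0 : 0 < q := by linarith
  unfold dpE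
  have e2 : ∀ t : ℝ, 2 * ENNReal.ofReal t = ENNReal.ofReal (2 * t) := fun t => by
    rw [ENNReal.ofReal_mul (by norm_num)]; simp
  rw [e2, e2, ← ENNReal.ofReal_add (by positivity) (by positivity),
    ← ENNReal.ofReal_add (by positivity) (by positivity)]
  apply ENNReal.ofReal_le_ofReal
  have h3 : (‖(1 / 2 : ℝ) • (A + B)‖ ^ p + ‖(1 / 2 : ℝ) • (A - B)‖ ^ p) / p ≤ ((‖A‖ ^ p + ‖B‖ ^ p) / 2) / p := by
    gcongr
  have h4 : a x * ‖(1 / 2 : ℝ) • (A + B)‖ ^ q / q ≤ a x * ((‖A‖ ^ q + ‖B‖ ^ q) / 2) / q := by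
    gcongr
  have e3 : ((‖A‖ ^ p + ‖B‖ ^ p) / 2) / p = (‖A‖ ^ p / p + ‖B‖ ^ p / p) / 2 := by ring
  have e4 : a x * ((‖A‖ ^ q + ‖B‖ ^ q) / 2) / q = (a x * ‖A‖ ^ q / q + a x * ‖B‖ ^ q / q) / 2 := by ring
  rw [e3, add_div] at h3
  rw [e4] at h4
  linarith

lemma ofReal_pow_div {m : ℕ} {p : ℝ} (hp : 0 < p) (A : Euc m →L[ℝ] ℝ) :
    ENNReal.ofReal (‖A‖ ^ p / p) = ENNReal.ofReal (1 / p) * ‖A‖ₑ ^ p := by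
  rw [← ofReal_norm, ENNReal.ofReal_rpow_of_nonneg (norm_nonneg _) hp.le,
    ← ENNReal.ofReal_mul (by positivity)]
  congr 1; ring

lemma dpE_low {m : ℕ} {p q : ℝ} (hp : 0 < p) (hq : 0 < q) {a : Euc m → ℝ} (ha : ∀ x, 0 ≤ a x)
    (x : Euc m) (A : Euc m →L[ℝ] ℝ) :
    ENNReal.ofReal (1 / p) * ‖A‖ₑ ^ p ≤ dpE p q a x A := by
  rw [← ofReal_pow_div hp]
  apply ENNReal.ofReal_le_ofReal
  have := ha x
  have : 0 ≤ a x * ‖A‖ ^ q / q := by positivity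
  linarith

lemma dpE_cont {m : ℕ} {p q : ℝ} (hp : 0 < p) (hq : 0 < q) {a : Euc m → ℝ}
    (x : Euc m) : Continuous (dpE p q a x) := by
  unfold dpE
  apply ENNReal.continuous_ofReal.comp
  have h1 : Continuous fun A : Euc m →L[ℝ] ℝ => ‖A‖ ^ p := continuous_norm.rpow_const (fun _ => Or.inr hp.le)
  have h2 : Continuous fun A : Euc m →L[ℝ] ℝ => ‖A‖ ^ q := continuous_norm.rpow_const (fun _ => Or.inr hq.le)
  exact (h1.div_const _).add ((continuous_const.mul h2).div_const _)

lemma dpE_meas {m : ℕ} {p q : ℝ} {a : Euc m → ℝ} (ham : Measurable a)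
    {μ : Measure (Euc m)} {f : Euc m → Euc m →L[ℝ] ℝ} (hf : AEStronglyMeasurable f μ) :
    AEMeasurable (fun x => dpE p q a x (f x)) μ := by
  unfold dpE
  have := hf.norm.aemeasurable
  have h1 := this.pow_const p
  have h2 := this.pow_const q
  exact ((h1.div_const _).add ((ham.aemeasurable.mul h2).div_const _)).ennreal_ofReal

lemma lp_min {m : ℕ} {p q : ℝ} (hp : 2 ≤ p) (hq : 1 ≤ q) {a : Euc m → ℝ} (ha : ∀ x, 0 ≤ a x)
    (ham : Measurable a) (μ : Measure (Euc m)) (S : Set (Euc m → Euc m →L[ℝ] ℝ))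
    (hS : ∀ f ∈ S, AEStronglyMeasurable f μ)
    (hmid : ∀ f ∈ S, ∀ g ∈ S, (fun x => (1 / 2 : ℝ) • (f x + g x)) ∈ S)
    (f0 : Euc m → Euc m →L[ℝ] ℝ) (hf0 : f0 ∈ S) (hfin : ∫⁻ x, dpE p q a x (f0 x) ∂μ < ⊤) :
    ∃ (f : ℕ → Euc m → Euc m →L[ℝ] ℝ) (fl : Euc m → Euc m →L[ℝ] ℝ),
      (∀ k, f k ∈ S) ∧ MemLp fl (ENNReal.ofReal p) μ ∧
      (∀ N k l, N ≤ k → N ≤ l → eLpNorm (f k - f l) (ENNReal.ofReal p) μ ≤ (1 / 2) ^ N) ∧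
      Tendsto (fun k => eLpNorm (f k - fl) (ENNReal.ofReal p) μ) atTop (𝓝 0) ∧
      ∀ g ∈ S, ∫⁻ x, dpE p q a x (fl x) ∂μ ≤ ∫⁻ x, dpE p q a x (g x) ∂μ := by
  have hp0 : 0 < p := by linarith
  have hq0 : 0 < q := by linarith
  set e : (Euc m → Euc m →L[ℝ] ℝ) → ℝ≥0∞ := fun f => ∫⁻ x, dpE p q a x (f x) ∂μ with he
  set m0 : ℝ≥0∞ := ⨅ f ∈ S, e f with hm0
  have hm0fin : m0 ≠ ⊤ := ((iInf₂_le f0 hf0).trans_lt hfin).ne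
  set c : ℝ≥0∞ := ENNReal.ofReal (1 / p) * (ENNReal.ofReal (1 / 2)) ^ p with hc
  have hc0 : c ≠ 0 := by
    refine mul_ne_zero (by simpa using hp0) ?_
    simp [hp0.ne']
  have hct : c ≠ ⊤ := ENNReal.mul_ne_top ENNReal.ofReal_ne_top (ENNReal.rpow_ne_top_of_nonneg hp0.le ENNReal.ofReal_ne_top)
  set B : ℕ → ℝ≥0∞ := fun N => (1 / 2) ^ N with hB
  have hB0 : ∀ N, B N ≠ 0 := fun N => pow_ne_zero _ (by simp)
  have hBt : ∀ N, B N ≠ ⊤ := fun N => ENNReal.pow_ne_top (by simp)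
  have hBp0 : ∀ N, c * B N ^ p ≠ 0 := fun N => mul_ne_zero hc0 (by
    rw [Ne, ENNReal.rpow_eq_zero_iff]; push Not; exact ⟨fun h => absurd h (hB0 N), fun h => absurd h (hBt N)⟩)
  have hBpt : ∀ N, c * B N ^ p ≠ ⊤ := fun N => ENNReal.mul_ne_top hct (ENNReal.rpow_ne_top_of_nonneg hp0.le (hBt N))
  have hBanti : ∀ N k, N ≤ k → B k ≤ B N := fun N k h => pow_le_pow_right_of_le_one' (by simp) h
  have hex : ∀ k, ∃ f ∈ S, e f < m0 + c * B k ^ p := by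
    intro k
    have := ENNReal.lt_add_right hm0fin (hBp0 k)
    rw [hm0] at this
    simpa only [iInf_lt_iff, exists_prop] using this
  choose f hfS hfe using hex
  have hcauchy : ∀ N k l, N ≤ k → N ≤ l → eLpNorm (f k - f l) (ENNReal.ofReal p) μ ≤ B N := by
    intro N k l hk hl
    have hmeas : AEStronglyMeasurable (fun x => (1/2:ℝ) • (f k x + f l x)) μ := (((hS _ (hfS k)).add (hS _ (hfS l))).const_smul (1/2 : ℝ))
    have h1 : 2 * e (fun x => (1 / 2 : ℝ) • (f k x + f l x)) +
        2 * ∫⁻ x, ENNReal.ofReal (‖(1 / 2 : ℝ) • (f k x - f l x)‖ ^ p / p) ∂μ ≤ e (f k) + e (f l) := by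
      simp only [he]
      rw [← lintegral_add_left' (dpE_meas ham (hS _ (hfS k))), ← lintegral_const_mul' _ _ (by simp),
        ← lintegral_const_mul' _ _ (by simp), ← lintegral_add_left' ((dpE_meas ham hmeas).const_mul 2)]
      exact lintegral_mono fun x => dpE_mid hp hq ha x _ _
    have h2 : m0 ≤ e (fun x => (1 / 2 : ℝ) • (f k x + f l x)) :=
      iInf₂_le _ (hmid _ (hfS k) _ (hfS l))
    have h3 : e (f k) + e (f l) ≤ 2 * m0 + 2 * (c * B N ^ p) := by
      have hk' := (hfe k).le
      have hl' := (hfe l).le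
      calc e (f k) + e (f l) ≤ (m0 + c * B k ^ p) + (m0 + c * B l ^ p) := by gcongr
        _ ≤ (m0 + c * B N ^ p) + (m0 + c * B N ^ p) := by
            gcongr <;> first | exact hBanti N k hk | exact hBanti N l hl
        _ = _ := by ring
    have h4 : ∫⁻ x, ENNReal.ofReal (‖(1 / 2 : ℝ) • (f k x - f l x)‖ ^ p / p) ∂μ ≤ c * B N ^ p := by
      have h5 : 2 * m0 + 2 * ∫⁻ x, ENNReal.ofReal (‖(1 / 2 : ℝ) • (f k x - f l x)‖ ^ p / p) ∂μ ≤
          2 * m0 + 2 * (c * B N ^ p) := by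
        refine le_trans ?_ (h1.trans h3)
        gcongr
      have h6 := (ENNReal.add_le_add_iff_left (ENNReal.mul_ne_top (by simp) hm0fin)).1 h5
      exact (ENNReal.mul_le_mul_iff_right (by simp) (by simp)).1 h6
    have h7 : ∀ x, ENNReal.ofReal (‖(1 / 2 : ℝ) • (f k x - f l x)‖ ^ p / p) = c * ‖f k x - f l x‖ₑ ^ p := by
      intro x
      rw [ofReal_pow_div hp0, enorm_smul, ENNReal.mul_rpow_of_nonneg _ _ hp0.le, hc, mul_assoc]
      congr 2
      rw [← ofReal_norm]; simp
    simp only [h7] at h4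
    rw [lintegral_const_mul' _ _ hct, ENNReal.mul_le_mul_iff_right hc0 hct] at h4
    rw [eLpNorm_eq_lintegral_rpow_enorm_toReal (by simpa using hp0) ENNReal.ofReal_ne_top, ENNReal.toReal_ofReal hp0.le,
      one_div, ENNReal.rpow_inv_le_iff hp0]
    exact h4
  have hmem : ∀ k, MemLp (f k) (ENNReal.ofReal p) μ := by
    intro k
    refine ⟨hS _ (hfS k), ?_⟩
    rw [eLpNorm_lt_top_iff_lintegral_rpow_enorm_lt_top (by simpa using hp0) ENNReal.ofReal_ne_top, ENNReal.toReal_ofReal hp0.le]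
    have h1 : e (f k) < ⊤ := (hfe k).trans (ENNReal.add_lt_top.2 ⟨hm0fin.lt_top, (hBpt k).lt_top⟩)
    have h2 : ENNReal.ofReal (1 / p) * ∫⁻ x, ‖f k x‖ₑ ^ p ∂μ ≤ e (f k) := by
      rw [← lintegral_const_mul' _ _ ENNReal.ofReal_ne_top]
      exact lintegral_mono fun x => dpE_low hp0 hq0 ha x _
    by_contra h
    have h' : ∫⁻ x, ‖f k x‖ₑ ^ p ∂μ = ⊤ := not_lt_top_iff.1 h
    rw [h', ENNReal.mul_top (by simpa using hp0)] at h2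
    exact absurd h1 (not_lt.2 h2)
  have hsum : ∑' i, (2 * B i) ≠ ⊤ := by
    rw [ENNReal.tsum_mul_left]
    refine ENNReal.mul_ne_top (by simp) ?_
    simp only [hB, ENNReal.tsum_geometric]
    simp
  obtain ⟨fl, hfl, hlim⟩ := Lp.cauchy_complete_eLpNorm (p := ENNReal.ofReal p) (μ := μ)
    (by rw [← ENNReal.ofReal_one]; exact ENNReal.ofReal_le_ofReal (by linarith)) hmem hsum (by
      intro N k l hk hl
      refine (hcauchy N k l hk hl).trans_lt ?_
      rw [two_mul]
      exact ENNReal.lt_add_right (hBt N) (hB0 N))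
  refine ⟨f, fl, hfS, hfl, hcauchy, hlim, ?_⟩
  obtain ⟨ns, hns, hae⟩ := (tendstoInMeasure_of_tendsto_eLpNorm (by simpa using hp0) (fun k => (hmem k).1) hfl.1 hlim).exists_seq_tendsto_ae
  have hfatou : e fl ≤ m0 := by
    calc e fl = ∫⁻ x, liminf (fun i => dpE p q a x (f (ns i) x)) atTop ∂μ := by
          apply lintegral_congr_ae
          filter_upwards [hae] with x hx
          exact ((((dpE_cont hp0 hq0 x).tendsto _).comp hx).liminf_eq).symm
      _ ≤ liminf (fun i => e (f (ns i))) atTop := lintegral_liminf_le' fun i => dpE_meas ham (hS _ (hfS _))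
      _ ≤ liminf (fun i => m0 + c * B i ^ p) atTop := by
          refine liminf_le_liminf (Eventually.of_forall fun i => ?_)
          refine (hfe (ns i)).le.trans ?_
          gcongr
          exact hBanti _ _ (hns.id_le i)
      _ = m0 := by
          apply Tendsto.liminf_eq
          have h1 : Tendsto B atTop (𝓝 0) := ENNReal.tendsto_pow_atTop_nhds_zero_of_lt_one (by simp)
          have h2 : Tendsto (fun i => B i ^ p) atTop (𝓝 0) := by
            have := h1.ennrpow_const p
            rwa [ENNReal.zero_rpow_of_pos hp0] at this
          have h3 := (ENNReal.Tendsto.const_mul (a := c) h2 (Or.inr hct)).const_add m0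
          simpa using h3
  intro g hg
  exact hfatou.trans (iInf₂_le g hg)

lemma int_add' {X F : Type*} [MeasurableSpace X] [NormedAddCommGroup F] {μ : Measure X} {f g : X → F}
    (h1 : Integrable f μ) (h2 : Integrable g μ) : Integrable (fun x => f x + g x) μ := h1.add h2

lemma enorm_zero' {F : Type*} [NormedAddCommGroup F] : ‖(0:F)‖ₑ = 0 := by simp

lemma exists_minimizer {n : ℕ} {p q : ℝ} (hp : 2 ≤ p) (hq : 1 ≤ q) {a : Euc (n+1) → ℝ} (ha : ∀ x, 0 ≤ a x)
    (ham : Measurable a) (g : Euc (n+1) → ℝ) (Gg : Euc (n+1) → Euc (n+1) →L[ℝ] ℝ)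
    (hg : W11On (Box (n+1)) g Gg)
    (hE : energyOf (Box (n + 1)) (fun x t => t ^ p / p + a x * t ^ q / q) (fun x => ‖Gg x‖) < ⊤) :
    ∃ (v : Euc (n+1) → ℝ) (G : Euc (n+1) → Euc (n+1) →L[ℝ] ℝ),
      W11On (Box (n + 1)) v G ∧
      ZeroBoundary (Box (n + 1)) (fun x => v x - g x) (fun x => G x - Gg x) ∧
      energyOf (Box (n + 1)) (fun x t => t ^ p / p + a x * t ^ q / q) (fun x => ‖G x‖) ≤
      energyOf (Box (n + 1)) (fun x t => t ^ p / p + a x * t ^ q / q) (fun x => ‖Gg x‖) ∧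
      (∀ (w : Euc (n + 1) → ℝ) (Gw : Euc (n + 1) → Euc (n + 1) →L[ℝ] ℝ),
        W11On (Box (n + 1)) w Gw →
        ZeroBoundary (Box (n + 1)) (fun x => w x - g x) (fun x => Gw x - Gg x) →
        energyOf (Box (n + 1)) (fun x t => t ^ p / p + a x * t ^ q / q)
            (fun x => ‖G x‖) ≤
          energyOf (Box (n + 1)) (fun x t => t ^ p / p + a x * t ^ q / q)
            (fun x => ‖Gw x‖)) := by
  set Ω := Box (n+1) with hΩ
  set μ := (volume : Measure (Euc (n+1))).restrict Ω with hμ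
  have hΩm : MeasurableSet Ω := box_measurable
  have hp0 : 0 < p := by linarith
  let Adm : (Euc (n+1) → ℝ) → (Euc (n+1) → Euc (n+1) →L[ℝ] ℝ) → Prop := fun D H =>
    Integrable D ∧ Integrable H ∧ HasWeakFDerivOn univ D H ∧ (∀ x, x ∉ Ω → D x = 0) ∧ ∀ x, x ∉ Ω → H x = 0
  have adm0 : Adm (fun _ => 0) (fun _ => 0) := by
    refine ⟨integrable_zero _ _ _, integrable_zero (Euc (n+1)) (Euc (n+1) →L[ℝ] ℝ) volume, ?_, fun _ _ => rfl, fun _ _ => rfl⟩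
    intro φ _ _ _
    simp
  have admadd : ∀ D H D' H' c, Adm D H → Adm D' H' → Adm (fun x => D x + c * D' x) (fun x => H x + c • H' x) := by
    rintro D H D' H' c ⟨h1, h2, h3, h4, h5⟩ ⟨g1, g2, g3, g4, g5⟩
    refine ⟨h1.add (g1.const_mul c), h2.add (g2.smul c), ?_, ?_, ?_⟩
    · exact weak_add h1.integrableOn (g1.const_mul c).integrableOn h2.integrableOn (g2.smul c).integrableOn h3 (weak_smul c g3)
    · intro x hx; simp [h4 x hx, g4 x hx]
    · intro x hx; simp [h5 x hx, g5 x hx]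
  let S : Set (Euc (n+1) → Euc (n+1) →L[ℝ] ℝ) := {f | ∃ D H, Adm D H ∧ f = fun x => Gg x + H x}
  have hS : ∀ f ∈ S, Integrable f μ := by
    rintro f ⟨D, H, hA, rfl⟩
    have h1 : Integrable Gg μ := hg.2.1
    have h2 : Integrable H μ := hA.2.1.integrableOn
    exact int_add' h1 h2
  have hmid : ∀ f ∈ S, ∀ g ∈ S, (fun x => (1 / 2 : ℝ) • (f x + g x)) ∈ S := by
    rintro f ⟨D, H, hA, rfl⟩ f' ⟨D', H', hA', rfl⟩
    refine ⟨_, _, admadd _ _ _ _ (1/2) (admadd _ _ _ _ (1/2) adm0 hA) hA', ?_⟩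
    ext1 x
    module
  have hGS : Gg ∈ S := ⟨_, _, adm0, by ext1 x; simp⟩
  obtain ⟨f, fl, hfS, hfl, hcau, hlim, hmin⟩ := lp_min hp hq ha ham μ S (fun f hf => (hS f hf).aestronglyMeasurable)
    hmid Gg hGS hE
  choose D H hA hfeq using hfS
  have h1p : (1:ℝ≥0∞) ≤ ENNReal.ofReal p := by
    rw [← ENNReal.ofReal_one]; exact ENNReal.ofReal_le_ofReal (by linarith)
  set V : ℝ≥0∞ := μ univ ^ (1 / (1:ℝ≥0∞).toReal - 1 / (ENNReal.ofReal p).toReal) with hV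
  have hVt : V ≠ ⊤ := by
    apply ENNReal.rpow_ne_top_of_nonneg
    · rw [ENNReal.toReal_ofReal hp0.le]; simp
      exact inv_le_one_of_one_le₀ (by linarith)
    · exact measure_ne_top _ _
  have hfli : Integrable fl μ := hfl.integrable h1p
  have hHeq : ∀ k l, ∫⁻ x, ‖H k x - H l x‖ₑ = eLpNorm (f k - f l) 1 μ := by
    intro k l
    rw [eLpNorm_one_eq_lintegral_enorm, hμ, ← lintegral_indicator hΩm]
    congr 1
    ext1 x
    by_cases hx : x ∈ Ω
    · simp only [indicator_of_mem hx, hfeq, Pi.sub_apply]; congr 1; abel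
    · simp only [indicator_of_notMem hx, (hA k).2.2.2.2 x hx, (hA l).2.2.2.2 x hx, sub_self]; exact enorm_zero'
  have hH1 : ∀ N k l, N ≤ k → N ≤ l → ∫⁻ x, ‖H k x - H l x‖ₑ ≤ (1/2)^N * V := by
    intro N k l hk hl
    rw [hHeq]
    refine (eLpNorm_le_eLpNorm_mul_rpow_measure_univ h1p ?_).trans ?_
    · exact ((hS _ ⟨D k, H k, hA k, hfeq k⟩).sub (hS _ ⟨D l, H l, hA l, hfeq l⟩)).aestronglyMeasurable
    · gcongr; exact hcau N k l hk hl
  set ζ : Euc (n+1) := EuclideanSpace.single 0 (2 * ((n+1 : ℕ) : ℝ) + 4) with hζ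
  have hζn : 2 * ((n+1 : ℕ) : ℝ) + 4 ≤ ‖ζ‖ := by
    rw [hζ]; simp only [PiLp.norm_single]
    exact le_abs_self _
  have hD1 : ∀ N k l, N ≤ k → N ≤ l → eLpNorm (D k - D l) 1 volume < ‖ζ‖ₑ * ((1/2)^N * V) + (1/2)^N := by
    intro N k l hk hl
    rw [eLpNorm_one_eq_lintegral_enorm]
    have hadm := admadd _ _ _ _ (-1) (hA k) (hA l)
    have := poincare hadm.1 hadm.2.2.1 hadm.2.1 (R := ((n+1:ℕ):ℝ)) (by positivity) (by
      intro x hx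
      exact hadm.2.2.2.1 x (fun h => absurd (box_norm h) (not_le.2 hx))) ζ hζn
    have e1 : ∀ x, D k x + -1 * D l x = (D k - D l) x := fun x => by simp; ring
    have e2 : ∀ x, H k x + (-1:ℝ) • H l x = H k x - H l x := fun x => by module
    simp only [e1, e2] at this
    refine this.trans_lt (lt_of_le_of_lt (mul_le_mul_right (hH1 N k l hk hl) _) ?_)
    apply ENNReal.lt_add_right
    · exact ENNReal.mul_ne_top enorm_ne_top (ENNReal.mul_ne_top (ENNReal.pow_ne_top (by simp)) hVt)
    · exact pow_ne_zero _ (by simp)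
  have hg2 : ∑' N, ((1/2:ℝ≥0∞)^N) ≠ ⊤ := by
    simp only [ENNReal.tsum_geometric]; simp
  obtain ⟨Dl, hDl, hDlim⟩ := Lp.cauchy_complete_eLpNorm (p := 1) le_rfl (fun k => memLp_one_iff_integrable.2 (hA k).1)
    (B := fun N => ‖ζ‖ₑ * ((1/2)^N * V) + (1/2)^N) (by
      rw [ENNReal.tsum_add, ENNReal.tsum_mul_left, ENNReal.tsum_mul_right]
      exact ENNReal.add_ne_top.2 ⟨ENNReal.mul_ne_top enorm_ne_top (ENNReal.mul_ne_top hg2 hVt), hg2⟩) hD1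
  have hDli : Integrable Dl := memLp_one_iff_integrable.1 hDl
  set Df := indicator Ω Dl with hDf
  set Hf := indicator Ω (fun x => fl x - Gg x) with hHf
  have i1 : Integrable Df := hDli.indicator hΩm
  have i2 : Integrable Hf := (integrable_indicator_iff hΩm).2 (hfli.sub hg.2.1)
  have l1 : Tendsto (fun k => ∫⁻ x, ‖D k x - Df x‖ₑ) atTop (𝓝 0) := by
    refine tendsto_of_tendsto_of_tendsto_of_le_of_le tendsto_const_nhds hDlim (fun _ => zero_le) fun k => ?_
    simp only [eLpNorm_one_eq_lintegral_enorm]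
    refine lintegral_mono fun x => ?_
    by_cases hx : x ∈ Ω
    · simp [hDf, indicator_of_mem hx]
    · simp [hDf, indicator_of_notMem hx, (hA k).2.2.2.1 x hx]
  have l2 : Tendsto (fun k => ∫⁻ x, ‖H k x - Hf x‖ₑ) atTop (𝓝 0) := by
    have h3 : Tendsto (fun k => eLpNorm (f k - fl) (ENNReal.ofReal p) μ * V) atTop (𝓝 0) := by
      have := ENNReal.Tendsto.mul_const (b := V) hlim (Or.inr hVt)
      simpa using this
    refine tendsto_of_tendsto_of_tendsto_of_le_of_le tendsto_const_nhds h3 (fun _ => zero_le) fun k => ?_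
    refine le_trans (le_of_eq ?_) (eLpNorm_le_eLpNorm_mul_rpow_measure_univ h1p
      ((hS _ ⟨D k, H k, hA k, hfeq k⟩).sub hfli).aestronglyMeasurable)
    rw [eLpNorm_one_eq_lintegral_enorm, hμ, ← lintegral_indicator hΩm]
    congr 1
    ext1 x
    by_cases hx : x ∈ Ω
    · simp only [hHf, indicator_of_mem hx, hfeq, Pi.sub_apply]; congr 1; abel
    · simp only [hHf, indicator_of_notMem hx, (hA k).2.2.2.2 x hx, sub_self]; exact enorm_zero'
  have hw := weak_lim (fun k => (hA k).1) (fun k => (hA k).2.1) i1 i2 (fun k => (hA k).2.2.1) l1 l2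
  have hen : ∀ K : Euc (n+1) → Euc (n+1) →L[ℝ] ℝ, energyOf Ω (fun x t => t ^ p / p + a x * t ^ q / q) (fun x => ‖K x‖)
      = ∫⁻ x, dpE p q a x (K x) ∂μ := fun K => rfl
  have henf : energyOf Ω (fun x t => t ^ p / p + a x * t ^ q / q) (fun x => ‖Gg x + Hf x‖)
      = ∫⁻ x, dpE p q a x (fl x) ∂μ := by
    rw [hen (fun x => Gg x + Hf x)]
    apply setLIntegral_congr_fun hΩm
    intro x hx
    simp [hHf, indicator_of_mem hx]
  have hadd : IntegrableOn (fun x => Gg x + Hf x) Ω := by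
    have h1 : Integrable Gg μ := hg.2.1
    have h2 : Integrable Hf μ := i2.integrableOn
    exact int_add' h1 h2
  refine ⟨fun x => g x + Df x, fun x => Gg x + Hf x, ⟨hg.1.add i1.integrableOn, hadd, ?_⟩, ?_, ?_, ?_⟩
  · exact weak_add hg.1 i1.integrableOn hg.2.1 i2.integrableOn hg.2.2 (weak_mono hw)
  · have e1 : indicator Ω (fun x => g x + Df x - g x) = Df := by
      ext1 x; by_cases hx : x ∈ Ω <;> simp [hDf, hx]
    have e2 : indicator Ω (fun x => Gg x + Hf x - Gg x) = Hf := by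
      ext1 x; by_cases hx : x ∈ Ω <;> simp [hHf, hx]
    unfold ZeroBoundary
    rw [e1, e2]
    exact ⟨i1, i2, hw⟩
  · rw [henf]
    exact hmin _ hGS
  · intro w Gw hW hZ
    rw [henf]
    have : (fun x => Gg x + indicator Ω (fun x => Gw x - Gg x) x) ∈ S :=
      ⟨_, _, ⟨hZ.1, hZ.2.1, hZ.2.2, fun x hx => by simp [hx], fun x hx => by simp [hx]⟩, rfl⟩
    refine (hmin _ this).trans (le_of_eq ?_)
    rw [hen Gw]
    apply setLIntegral_congr_fun hΩm
    intro x hx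
    simp [indicator_of_mem hx]

structure CD (lam lp : ℝ) (l : ℕ → ℝ) : Prop where
  lam_pos : 0 < lam
  lp_lt : lp < 1 / 2
  l0 : l 0 = 1
  pos : ∀ j, 0 < l j
  lo : ∀ j, lam * l j ≤ l (j + 1)
  hi : ∀ j, l (j + 1) ≤ lp * l j
  gap : ∀ j, l (j + 1) - 2 * l (j + 2) < l j - 2 * l (j + 1)

lemma exists_lengths {lam gam : ℝ} (h0 : 0 < lam) (h1 : lam < 1 / 2) (hg : 0 < gam) :
    ∃ (N : ℕ) (lp : ℝ), 1 ≤ N ∧ CD lam lp (fun j => lam ^ j * (((j : ℝ) + N) / N) ^ gam) ∧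
      IsCantorLengths lam gam (fun j => lam ^ j * (((j : ℝ) + N) / N) ^ gam) := by
  have ht : Tendsto (fun N : ℕ => lam * (1 + 1 / ((N:ℝ))) ^ gam) atTop (𝓝 lam) := by
    have h2 : Tendsto (fun N : ℕ => (1:ℝ) + 1 / ((N:ℝ))) atTop (𝓝 1) := by
      simpa using (tendsto_one_div_atTop_nhds_zero_nat (𝕜 := ℝ)).const_add (1:ℝ)
    have h3 := (h2.rpow_const (p := gam) (Or.inl one_ne_zero)).const_mul lam
    simpa using h3
  have e1 := ht.eventually (gt_mem_nhds h1)
  have e2 := ht.eventually (gt_mem_nhds (show lam < 1 / (3 - 2 * lam) by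
    rw [lt_div_iff₀ (by linarith)]; nlinarith))
  obtain ⟨N, ⟨hN1, hN2⟩, hN⟩ := ((e1.and e2).and (eventually_ge_atTop 1)).exists
  have hNp : (0:ℝ) < N := by exact_mod_cast hN
  set lp := lam * (1 + 1 / ((N:ℝ))) ^ gam with hlp
  rw [lt_div_iff₀ (by linarith)] at hN2
  set l : ℕ → ℝ := fun j => lam ^ j * (((j : ℝ) + N) / N) ^ gam with hl
  have hpos : ∀ j, 0 < l j := fun j => by simp only [hl]; positivity
  have hl0 : l 0 = 1 := by simp [hl, hNp.ne']
  have hlo : ∀ j, lam * l j ≤ l (j + 1) := by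
    intro j
    simp only [hl]
    rw [pow_succ, mul_comm (lam ^ j) lam, ← mul_assoc]
    gcongr
    simp
  have hhi : ∀ j, l (j + 1) ≤ lp * l j := by
    intro j
    simp only [hl, hlp]
    have : (((j + 1 : ℕ) : ℝ) + N) / N ≤ (1 + 1 / (N:ℝ)) * (((j : ℝ) + N) / N) := by
      push_cast
      rw [div_le_iff₀ hNp]
      field_simp
      have : (0:ℝ) ≤ j := by positivity
      nlinarith
    calc lam ^ (j+1) * ((((j + 1 : ℕ) : ℝ) + N) / N) ^ gam
        ≤ lam ^ (j+1) * ((1 + 1 / (N:ℝ)) * (((j : ℝ) + N) / N)) ^ gam := by gcongr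
      _ = _ := by rw [Real.mul_rpow (by positivity) (by positivity)]; ring
  have hgap : ∀ j, l (j + 1) - 2 * l (j + 2) < l j - 2 * l (j + 1) := by
    intro j
    have a1 := hlo (j+1)
    have a2 := hhi j
    have a3 := hpos j
    have a4 : (3 - 2 * lam) * l (j+1) ≤ (3 - 2 * lam) * (lp * l j) := by gcongr; linarith
    have a5 : (lp * (3 - 2 * lam)) * l j < 1 * l j := by gcongr
    have e : l (j + 1 + 1) = l (j + 2) := rfl
    rw [e] at a1
    linarith
  refine ⟨N, lp, hN, ⟨h0, hN1, hl0, hpos, hlo, hhi, hgap⟩, hl0, hpos, ?_, hgap, (2 * N) ^ gam, ?_, ?_⟩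
  · intro j
    have a2 := hhi j
    have a3 := hpos j
    show 2 * l (j+1) < l j
    nlinarith
  · apply Real.one_le_rpow _ hg.le
    have : (1:ℝ) ≤ N := by exact_mod_cast hN
    linarith
  · intro j hj
    have hj' : (1:ℝ) ≤ j := by exact_mod_cast hj
    have hN' : (1:ℝ) ≤ N := by exact_mod_cast hN
    constructor
    · rw [mul_comm _ (lam ^ j), mul_assoc]
      simp only
      gcongr
      rw [← Real.inv_rpow (by positivity), ← Real.mul_rpow (by positivity) (by positivity)]
      gcongr
      rw [inv_mul_eq_div, div_le_div_iff₀ (by positivity) (by positivity)]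
      nlinarith
    · rw [mul_comm _ (lam ^ j), mul_assoc]
      simp only
      gcongr
      rw [← Real.mul_rpow (by positivity) (by positivity)]
      gcongr
      rw [div_le_iff₀ hNp]
      nlinarith [mul_nonneg (sub_nonneg.2 hN') (sub_nonneg.2 hj')]

noncomputable def gp (l : ℕ → ℝ) : ℕ → ℝ
  | 0 => 4
  | j + 1 => l j - 2 * l (j + 1)

noncomputable def cc (l : ℕ → ℝ) : ℕ → ℕ → ℝ
  | 0, _ => 0
  | j + 1, k => cc l j (k / 2) + (if k % 2 = 1 then 1 else -1) * ((l j - l (j + 1)) / 2)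

def CS (l : ℕ → ℝ) : Set ℝ := {t | ∀ j, ∃ k, k < 2 ^ j ∧ |t - cc l j k| ≤ l j / 2}

lemma gp_succ (l : ℕ → ℝ) (j : ℕ) : gp l (j+1) = l j - 2 * l (j + 1) := rfl

namespace CD

lemma lp_pos {lam lp : ℝ} {l : ℕ → ℝ} (h : CD lam lp l) : 0 < lp := by
  have h1 := h.hi 0
  have h2 := h.pos 1
  rw [h.l0] at h1
  simp at h1
  linarith

lemma gp_lo {lam lp : ℝ} {l : ℕ → ℝ} (h : CD lam lp l) (j : ℕ) : (1 - 2 * lp) * l j ≤ gp l (j + 1) := by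
  rw [gp_succ]; have := h.hi j; linarith

lemma gp_pos {lam lp : ℝ} {l : ℕ → ℝ} (h : CD lam lp l) (j : ℕ) : 0 < gp l j := by
  cases j with
  | zero => simp [gp]
  | succ j => exact lt_of_lt_of_le (mul_pos (by linarith [h.lp_lt]) (h.pos j)) (h.gp_lo j)

lemma gp_anti {lam lp : ℝ} {l : ℕ → ℝ} (h : CD lam lp l) (j : ℕ) : gp l (j + 1) ≤ gp l j := by
  cases j with
  | zero =>
    have h1 := h.pos 1
    simp only [gp, h.l0]; linarith
  | succ j => exact (h.gap j).le

lemma l_le {lam lp : ℝ} {l : ℕ → ℝ} (h : CD lam lp l) (j : ℕ) : l (j+1) ≤ l j := by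
  have h1 := h.hi j
  have h2 := h.pos j
  have h3 := h.lp_lt
  nlinarith

lemma l_le_pow {lam lp : ℝ} {l : ℕ → ℝ} (h : CD lam lp l) (j : ℕ) : l j ≤ (1/2) ^ j := by
  induction j with
  | zero => simp [h.l0]
  | succ j ih =>
    rw [pow_succ]
    have h1 := h.hi j
    have h3 := h.lp_lt
    have h2 := h.pos j
    nlinarith

lemma l_le_one {lam lp : ℝ} {l : ℕ → ℝ} (h : CD lam lp l) (j : ℕ) : l j ≤ 1 := (h.l_le_pow j).trans (pow_le_one₀ (by norm_num) (by norm_num))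

lemma l_tendsto {lam lp : ℝ} {l : ℕ → ℝ} (h : CD lam lp l) : Tendsto l atTop (𝓝 0) := by
  refine tendsto_of_tendsto_of_tendsto_of_le_of_le tendsto_const_nhds
    (tendsto_pow_atTop_nhds_zero_of_lt_one (r := (1/2:ℝ)) (by norm_num) (by norm_num)) (fun j => (h.pos j).le)
    h.l_le_pow

lemma cc_sep {lam lp : ℝ} {l : ℕ → ℝ} (h : CD lam lp l) (j : ℕ) : ∀ k k', k < k' → k' < 2 ^ j → l j + gp l j ≤ cc l j k' - cc l j k := by
  induction j with
  | zero => intro k k' h1 h2; simp at h2; omega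
  | succ j ih =>
    intro k k' h1 h2
    have hK : k' / 2 < 2 ^ j := by rw [pow_succ] at h2; omega
    have hlj := h.l_le j
    simp only [cc]
    rcases Nat.lt_or_ge (k / 2) (k' / 2) with hlt | hge
    · have := ih _ _ hlt hK
      have hg := h.gp_anti j
      split_ifs <;> linarith
    · have e : k / 2 = k' / 2 := by omega
      have e1 : k % 2 = 0 := by omega
      have e2 : k' % 2 = 1 := by omega
      rw [e, if_pos e2, if_neg (by omega), gp_succ]
      linarith

lemma cc_sep' {lam lp : ℝ} {l : ℕ → ℝ} (h : CD lam lp l) (j k k' : ℕ) (hk : k < 2 ^ j) (hk' : k' < 2 ^ j) (hne : k ≠ k') :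
    l j + gp l j ≤ |cc l j k' - cc l j k| := by
  rcases lt_or_gt_of_ne hne with h1 | h1
  · exact (h.cc_sep j k k' h1 hk').trans (le_abs_self _)
  · rw [abs_sub_comm]; exact (h.cc_sep j k' k h1 hk).trans (le_abs_self _)

lemma cc_abs {lam lp : ℝ} {l : ℕ → ℝ} (h : CD lam lp l) (j k : ℕ) : |cc l j k| ≤ (1 - l j) / 2 := by
  induction j generalizing k with
  | zero => simp [cc, h.l0]
  | succ j ih =>
    have := ih (k / 2)
    have hlj := h.l_le j
    simp only [cc]
    rw [abs_le] at *
    split_ifs <;> constructor <;> linarith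

lemma near {lam lp : ℝ} {l : ℕ → ℝ} (h : CD lam lp l) {t : ℝ} (ht : t ∈ CS l) {j k : ℕ} (hk : k < 2 ^ j) :
    (gp l (j+1) / 2 ≤ |t - cc l j k| ∧ |t - cc l j k| ≤ l j / 2) ∨ l j / 2 + gp l j ≤ |t - cc l j k| := by
  obtain ⟨k1, hk1, h1⟩ := ht (j+1)
  have hlj := h.l_le j
  have hK : k1 / 2 < 2 ^ j := by rw [pow_succ] at hk1; omega
  have hg := h.gp_pos (j+1)
  simp only [cc] at h1
  rw [gp_succ] at *
  rw [abs_le] at h1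
  by_cases hkk : k1 / 2 = k
  · left
    rw [hkk] at h1
    split_ifs at h1
    · rw [abs_of_nonneg (by linarith)]
      constructor <;> linarith
    · rw [abs_of_nonpos (by linarith)]
      constructor <;> linarith
  · right
    have h2 := h.cc_sep' j _ _ hK hk hkk
    have h3 : |t - cc l j (k1/2)| ≤ l j / 2 := by
      rw [abs_le]; split_ifs at h1 <;> constructor <;> linarith
    have h4 : |cc l j k - cc l j (k1/2)| ≤ |t - cc l j k| + |t - cc l j (k1/2)| := by
      rw [abs_sub_comm t (cc l j k)]
      have := abs_add_le (cc l j k - t) (t - cc l j (k1/2))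
      simpa using this
    linarith

/-- points of the paths stay away from the Cantor set -/
lemma far {lam lp : ℝ} {l : ℕ → ℝ} (h : CD lam lp l) {t : ℝ} (ht : t ∈ CS l) {j k : ℕ} (hk : k < 2 ^ j) {s : ℝ}
    (hs : |s - cc l j k| ≤ gp l (j+1) / 4 ∨
      (l j / 2 + gp l (j+1) / 4 ≤ |s - cc l j k| ∧ |s - cc l j k| ≤ l j / 2 + gp l j / 4)) :
    gp l (j+1) / 4 ≤ |s - t| := by
  have h1 := h.near ht hk
  have h0 := h.pos j
  have h2 := h.gp_anti j
  have h3 := h.gp_pos (j+1)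
  have h4 : |s - cc l j k| ≤ |s - t| + |t - cc l j k| := by
    have := abs_add_le (s - t) (t - cc l j k); simpa using this
  have h5 : |t - cc l j k| ≤ |s - t| + |s - cc l j k| := by
    have := abs_add_le (t - s) (s - cc l j k)
    rw [abs_sub_comm t s] at this; simpa using this
  rcases hs with hs | hs <;> rcases h1 with h1 | h1 <;> linarith

lemma CS_closed {lam lp : ℝ} {l : ℕ → ℝ} (_h : CD lam lp l) : IsClosed (CS l) := by
  have : CS l = ⋂ j, ⋃ k ∈ Finset.range (2 ^ j), closedBall (cc l j k) (l j / 2) := by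
    ext t; simp [CS, Real.dist_eq]
  rw [this]
  exact isClosed_iInter fun j => (Finset.finite_toSet _).isClosed_biUnion fun k _ => isClosed_closedBall

lemma CS_abs {lam lp : ℝ} {l : ℕ → ℝ} (h : CD lam lp l) {t : ℝ} (ht : t ∈ CS l) : |t| ≤ 1 / 2 := by
  obtain ⟨k, hk, h1⟩ := ht 0
  simpa [cc, h.l0] using h1

end CD

lemma partial_cc {l : ℕ → ℝ} (hl0 : l 0 = 1) {τ : ℝ} (hτ : 0 ≤ τ) (j : ℕ) :
    cc l j ⌊τ * 2 ^ j⌋₊ - l j / 2 =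
      -(1 / 2) + ∑ i ∈ Finset.range j, (if binDigit τ i then l i - l (i + 1) else 0) := by
  induction j with
  | zero => simp [cc, hl0]
  | succ j ih =>
    rw [Finset.sum_range_succ, ← add_assoc, ← ih]
    have e1 : ⌊τ * 2 ^ (j+1)⌋₊ / 2 = ⌊τ * 2 ^ j⌋₊ := by
      rw [← Nat.floor_div_ofNat]
      congr 1
      rw [pow_succ]; ring
    have e2 : (binDigit τ j = true) ↔ ⌊τ * 2 ^ (j+1)⌋₊ % 2 = 1 := by
      unfold binDigit
      rw [decide_eq_true_iff, ← Int.natCast_floor_eq_floor (by positivity : 0 ≤ τ * 2 ^ (j+1))]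
      omega
    simp only [cc, e1]
    by_cases hb : binDigit τ j = true
    · rw [if_pos hb, if_pos (e2.1 hb)]; ring
    · rw [if_neg hb, if_neg (fun h => hb (e2.2 h))]; ring

namespace CD

lemma point_near {lam lp : ℝ} {l : ℕ → ℝ} (h : CD lam lp l) {τ : ℝ} (hτ : 0 ≤ τ) (j : ℕ) :
    |gCantorPoint l (binDigit τ) - cc l j ⌊τ * 2 ^ j⌋₊| ≤ l j / 2 := by
  set f : ℕ → ℝ := fun i => if binDigit τ i then l i - l (i + 1) else 0 with hf
  have hf0 : ∀ i, 0 ≤ f i := by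
    intro i; simp only [hf]; have := h.l_le i
    split_ifs <;> linarith
  have hf1 : ∀ i, f i ≤ l i - l (i+1) := by
    intro i; simp only [hf]; have := h.l_le i
    split_ifs <;> linarith
  have htel : ∀ m, ∑ i ∈ Finset.range m, (l (i + j) - l (i + j + 1)) = l j - l (m + j) := by
    intro m
    have := Finset.sum_range_sub' (fun i => l (i + j)) m
    simp only [zero_add] at this
    rw [← this]
    refine Finset.sum_congr rfl fun i _ => ?_
    rw [add_right_comm]
  have hb : ∀ m, ∑ i ∈ Finset.range m, f (i + j) ≤ l j := by
    intro m
    calc _ ≤ ∑ i ∈ Finset.range m, (l (i + j) - l (i + j + 1)) := Finset.sum_le_sum fun i _ => hf1 _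
      _ = l j - l (m + j) := htel m
      _ ≤ l j := by linarith [h.pos (m+j)]
  have hs' : Summable fun i => f (i + j) := summable_of_sum_range_le (fun i => hf0 _) hb
  have hs : Summable f := (_root_.summable_nat_add_iff j).1 hs'
  have ht0 : 0 ≤ ∑' i, f (i + j) := tsum_nonneg fun i => hf0 _
  have ht1 : ∑' i, f (i + j) ≤ l j := Real.tsum_le_of_sum_range_le (fun i => hf0 _) hb
  have hsplit := hs.sum_add_tsum_nat_add j
  have hp := partial_cc h.l0 hτ j
  have e : gCantorPoint l (binDigit τ) = -(1/2) + ∑' i, f i := by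
    simp only [gCantorPoint, hf]
  rw [e, ← hsplit, abs_le]
  constructor <;> linarith

lemma floor_lt (τ : ℝ) (hτ : τ ∈ Ico (0:ℝ) 1) (j : ℕ) : ⌊τ * 2 ^ j⌋₊ < 2 ^ j := by
  rw [Nat.floor_lt (mul_nonneg hτ.1 (by positivity))]
  push_cast
  have : (0:ℝ) < 2 ^ j := by positivity
  nlinarith [hτ.2]

lemma point_mem {lam lp : ℝ} {l : ℕ → ℝ} (h : CD lam lp l) {τ : ℝ} (hτ : τ ∈ Ico (0:ℝ) 1) :
    gCantorPoint l (binDigit τ) ∈ CS l :=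
  fun j => ⟨_, floor_lt τ hτ j, h.point_near hτ.1 j⟩

lemma point_aemeas {lam lp : ℝ} {l : ℕ → ℝ} (h : CD lam lp l) :
    AEMeasurable (fun t => gCantorPoint l (binDigit t)) (volume.restrict (Set.Ico (0 : ℝ) 1)) := by
  refine aemeasurable_of_tendsto_metrizable_ae (f := fun j (τ : ℝ) => cc l j ⌊τ * 2 ^ j⌋₊) atTop ?_ ?_
  · intro j
    have h1 : Measurable fun τ : ℝ => ⌊τ * 2 ^ j⌋₊ := Nat.measurable_floor.comp (measurable_id.mul_const _)
    exact ((measurable_from_nat (f := cc l j)).comp h1).aemeasurable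
  · rw [ae_restrict_iff' measurableSet_Ico]
    refine Eventually.of_forall fun τ hτ => ?_
    rw [tendsto_iff_dist_tendsto_zero]
    refine tendsto_of_tendsto_of_tendsto_of_le_of_le tendsto_const_nhds (g := fun _ => 0) (h := fun j => l j / 2) ?_ (fun _ => dist_nonneg) ?_
    · simpa using h.l_tendsto.div_const 2
    · intro j
      show dist _ _ ≤ _
      rw [dist_comm, Real.dist_eq]
      exact h.point_near hτ.1 j

lemma prob {lam lp : ℝ} {l : ℕ → ℝ} (h : CD lam lp l) : IsProbabilityMeasure (gCantorMeasure l) := by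
  have : IsProbabilityMeasure ((volume : Measure ℝ).restrict (Set.Ico (0 : ℝ) 1)) := ⟨by simp⟩
  exact Measure.isProbabilityMeasure_map h.point_aemeas

lemma ae_mem {lam lp : ℝ} {l : ℕ → ℝ} (h : CD lam lp l) : ∀ᵐ t ∂(gCantorMeasure l), t ∈ CS l := by
  unfold gCantorMeasure
  rw [ae_map_iff (p := fun t => t ∈ CS l) h.point_aemeas h.CS_closed.measurableSet, ae_restrict_iff' measurableSet_Ico]
  exact Eventually.of_forall fun τ hτ => h.point_mem hτ

lemma ball_le {lam lp : ℝ} {l : ℕ → ℝ} (h : CD lam lp l) (j : ℕ) (s r : ℝ) (hr : 2 * r < gp l j) :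
    gCantorMeasure l (closedBall s r) ≤ ENNReal.ofReal ((1/2) ^ j) := by
  unfold gCantorMeasure
  rw [Measure.map_apply_of_aemeasurable h.point_aemeas measurableSet_closedBall,
    Measure.restrict_apply' measurableSet_Ico]
  set P := (fun t => gCantorPoint l (binDigit t)) ⁻¹' closedBall s r ∩ Ico 0 1 with hP
  rcases P.eq_empty_or_nonempty with he | ⟨τ0, hτ0, hτ0'⟩
  · rw [he]; simp
  · have hsub : P ⊆ Icc (⌊τ0 * 2 ^ j⌋₊ / 2 ^ j : ℝ) ((⌊τ0 * 2 ^ j⌋₊ + 1) / 2 ^ j) := by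
      rintro τ ⟨hτ, hτ'⟩
      have hk : ⌊τ * 2 ^ j⌋₊ = ⌊τ0 * 2 ^ j⌋₊ := by
        by_contra hne
        have h1 := h.cc_sep' j _ _ (floor_lt τ hτ' j) (floor_lt τ0 hτ0' j) hne
        have h2 := h.point_near hτ'.1 j
        have h3 := h.point_near hτ0'.1 j
        simp only [mem_preimage, mem_closedBall, Real.dist_eq] at hτ hτ0
        rw [le_abs] at h1
        rw [abs_le] at h2 h3 hτ hτ0
        rcases h1 with h1 | h1 <;> linarith
      rw [← hk]
      have hpos : (0:ℝ) < 2 ^ j := by positivity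
      constructor
      · rw [div_le_iff₀ hpos]; exact Nat.floor_le (mul_nonneg hτ'.1 hpos.le)
      · rw [le_div_iff₀ hpos]; exact (Nat.lt_floor_add_one _).le
    refine (measure_mono hsub).trans ?_
    rw [Real.volume_Icc]
    apply ENNReal.ofReal_le_ofReal
    rw [one_div, inv_pow]
    apply le_of_eq
    field_simp
    ring
end CD

noncomputable def cv {m : ℕ} {F : Type} [NormedAddCommGroup F] [NormedSpace ℝ F] (T : Set (Euc m)) (g : Euc m → F) :
    Euc m → F :=
  fun x => ∫ y, (indicator T (fun _ => (1:ℝ)) y) • g (x - y)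

lemma ind_locInt {m : ℕ} {T : Set (Euc m)} (hT : MeasurableSet T) :
    LocallyIntegrable (indicator T (fun _ => (1:ℝ))) := by
  have : LocallyIntegrable (fun _ : Euc m => (1:ℝ)) := continuous_const.locallyIntegrable
  exact this.indicator hT

lemma cv_eq {m : ℕ} {F : Type} [NormedAddCommGroup F] [NormedSpace ℝ F] (T : Set (Euc m)) (g : Euc m → F) :
    cv T g = convolution (indicator T (fun _ => (1:ℝ))) g (ContinuousLinearMap.lsmul ℝ ℝ) volume := by
  ext x; simp [cv, convolution]

lemma cv_contDiff {m : ℕ} {F : Type} [NormedAddCommGroup F] [NormedSpace ℝ F] {T : Set (Euc m)}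
    (hT : MeasurableSet T) {g : Euc m → F} (hg : ContDiff ℝ (⊤ : ℕ∞) g) (hc : HasCompactSupport g) :
    ContDiff ℝ (⊤ : ℕ∞) (cv T g) := by
  rw [cv_eq]
  exact hc.contDiff_convolution_right _ (ind_locInt hT) hg

lemma cv_fderiv {m : ℕ} {F : Type} [NormedAddCommGroup F] [NormedSpace ℝ F] [CompleteSpace F] {T : Set (Euc m)}
    (hT : MeasurableSet T) {g : Euc m → F} (hg : ContDiff ℝ (⊤ : ℕ∞) g) (hc : HasCompactSupport g) :
    fderiv ℝ (cv T g) = cv T (fderiv ℝ g) := by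
  ext1 x
  have := hc.hasFDerivAt_convolution_right (ContinuousLinearMap.lsmul ℝ ℝ) (ind_locInt hT) (hg.of_le (by simp)) x
  rw [← cv_eq] at this
  rw [this.fderiv]
  simp only [cv, convolution]
  congr 1

lemma cv_bound {m : ℕ} (k : ℕ) : ∀ (F : Type) [NormedAddCommGroup F] [NormedSpace ℝ F] [CompleteSpace F]
    (g : Euc m → F) (_ : ContDiff ℝ (⊤ : ℕ∞) g) (_ : HasCompactSupport g),
    ∃ M : ℝ, 0 ≤ M ∧ ∀ T : Set (Euc m), MeasurableSet T → ∀ x, ‖iteratedFDeriv ℝ k (cv T g) x‖ ≤ M := by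
  induction k with
  | zero =>
    intro F _ _ _ g hg hc
    have hi : Integrable (fun x => ‖g x‖) := (hg.continuous.integrable_of_hasCompactSupport hc).norm
    refine ⟨∫ x, ‖g x‖, integral_nonneg fun _ => norm_nonneg _, fun T hT x => ?_⟩
    rw [norm_iteratedFDeriv_zero]
    rw [← integral_sub_left_eq_self (fun y => ‖g y‖) volume x]
    unfold cv
    refine norm_integral_le_of_norm_le (hi.comp_sub_left x) (Eventually.of_forall fun y => ?_)
    rw [norm_smul]
    by_cases hy : y ∈ T <;> simp [hy]
  | succ k ih =>
    intro F _ _ _ g hg hc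
    obtain ⟨M, hM0, hM⟩ := ih (Euc m →L[ℝ] F) (fderiv ℝ g) (hg.fderiv_right (by simp)) (hc.fderiv (𝕜 := ℝ))
    refine ⟨M, hM0, fun T hT x => ?_⟩
    rw [← norm_iteratedFDeriv_fderiv, cv_fderiv hT hg hc]
    exact hM T hT x

lemma cv_nonneg {m : ℕ} {T : Set (Euc m)} {g : Euc m → ℝ} (hg : ∀ x, 0 ≤ g x) (x : Euc m) : 0 ≤ cv T g x := by
  refine integral_nonneg fun y => ?_
  by_cases hy : y ∈ T <;> simp [hy, hg]

lemma cv_one {m : ℕ} {T : Set (Euc m)} {g : Euc m → ℝ} (hg1 : ∫ x, g x = 1)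
    (hgs : ∀ x, 1 < ‖x‖ → g x = 0) {x : Euc m} (hx : closedBall x 1 ⊆ T) : cv T g x = 1 := by
  rw [← hg1, ← integral_sub_left_eq_self g volume x]
  unfold cv
  congr 1
  ext1 y
  by_cases hy : y ∈ T
  · simp [hy]
  · have : y ∉ closedBall x 1 := fun h => hy (hx h)
    rw [mem_closedBall, dist_comm, dist_eq_norm] at this
    rw [hgs _ (not_le.1 this), smul_zero]

lemma cv_zero {m : ℕ} {T : Set (Euc m)} {g : Euc m → ℝ}
    (hgs : ∀ x, 1 < ‖x‖ → g x = 0) {x : Euc m} (hx : Disjoint (closedBall x 1) T) : cv T g x = 0 := by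
  unfold cv
  rw [← integral_zero (Euc m) ℝ]
  congr 1
  ext1 y
  by_cases hy : y ∈ T
  · have : y ∉ closedBall x 1 := fun h => (Set.disjoint_left.1 hx h) hy
    rw [mem_closedBall, dist_comm, dist_eq_norm] at this
    rw [hgs _ (not_le.1 this), smul_zero]
  · simp [hy]

lemma box_convex {m : ℕ} : Convex ℝ (Box m) := by
  intro x hx y hy a b ha hb hab i
  have h1 := hx i
  have h2 := hy i
  simp only [PiLp.add_apply, PiLp.smul_apply, smul_eq_mul]
  have h3 : |a * x i + b * y i| ≤ a * |x i| + b * |y i| := by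
    refine (abs_add_le _ _).trans ?_
    rw [abs_mul, abs_mul, abs_of_nonneg ha, abs_of_nonneg hb]
  refine h3.trans_lt ?_
  rcases ha.eq_or_lt with h | h
  · have hb1 : b = 1 := by linarith
    rw [← h, hb1]; linarith
  · have h4 := mul_lt_mul_of_pos_left h1 h
    have h5 := mul_le_mul_of_nonneg_left h2.le hb
    linarith

lemma box_uniqueDiff {m : ℕ} : UniqueDiffOn ℝ (closure (Box m)) := by
  refine uniqueDiffOn_convex box_convex.closure ⟨0, ?_⟩
  refine interior_mono subset_closure ?_
  rw [box_open.interior_eq]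
  intro i; simp

lemma min_le_pow {t β : ℝ} (ht : 0 ≤ t) (h0 : 0 ≤ β) (h1 : β ≤ 1) : min 1 t ≤ t ^ β := by
  rcases le_total t 1 with h | h
  · rw [min_eq_right h]
    exact Real.self_le_rpow_of_le_one ht h h1
  · rw [min_eq_left h]
    exact Real.one_le_rpow h h0

lemma exists_weight {m : ℕ} {α α' κ : ℝ} (hα : 0 < α) (hα' : α < α') (hκ : 0 < κ) {l : ℕ → ℝ}
    (hl : ∀ j, 0 < l j) (hl2 : ∀ j, l j ≤ (1/2) ^ j) (S : ℕ → Set (Euc m)) (hS : ∀ j, MeasurableSet (S j)) :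
    ∃ a : Euc m → ℝ, (∀ x, 0 ≤ a x) ∧ Measurable a ∧ InHolderCls α (closure (Box m)) a ∧
      (∀ j x, closedBall x (κ * l j) ⊆ S j → l j ^ α' ≤ a x) ∧
      (∀ x, (∀ j, Disjoint (closedBall x (κ * l j)) (S j)) → a x = 0) := by
  let ψ : ContDiffBump (0 : Euc m) := ⟨1/2, 1, by norm_num, by norm_num⟩
  set g : Euc m → ℝ := ψ.normed volume with hg
  have hgsm : ContDiff ℝ (⊤ : ℕ∞) g := ψ.contDiff_normed
  have hgc : HasCompactSupport g := ψ.hasCompactSupport_normed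
  have hg0 : ∀ x, 0 ≤ g x := fun x => ψ.nonneg_normed x
  have hg1 : ∫ x, g x = 1 := ψ.integral_normed
  have hgs : ∀ x, 1 < ‖x‖ → g x = 0 := by
    intro x hx
    have : x ∉ Function.support g := by
      rw [hg, ψ.support_normed_eq]; simp; exact hx.le
    simpa using this
  have hll1 : ∀ j, l j ≤ 1 := fun j => (hl2 j).trans (pow_le_one₀ (by norm_num) (by norm_num))
  choose Mk hMk0 hMk using fun k => cv_bound (m := m) k ℝ g hgsm hgc
  set T : ℕ → Set (Euc m) := fun j => (fun y : Euc m => (κ * l j) • y) ⁻¹' S j with hT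
  have hTm : ∀ j, MeasurableSet (T j) := fun j => (measurable_const_smul _) (hS j)
  have hr : ∀ j, 0 < κ * l j := fun j => mul_pos hκ (hl j)
  set b : ℕ → Euc m → ℝ := fun j x => cv (T j) g ((κ * l j)⁻¹ • x) with hb
  have hcvs : ∀ j, ContDiff ℝ (⊤ : ℕ∞) (cv (T j) g) := fun j => cv_contDiff (hTm j) hgsm hgc
  have hbs : ∀ j, ContDiff ℝ (⊤ : ℕ∞) (b j) := fun j => (hcvs j).comp (contDiff_const_smul _)
  have hbk : ∀ j k x, ‖iteratedFDeriv ℝ k (b j) x‖ ≤ (κ⁻¹) ^ k * Mk k * (l j)⁻¹ ^ k := by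
    intro j k x
    simp only [hb]
    rw [iteratedFDeriv_comp_const_smul _ ((hcvs j).of_le (by exact_mod_cast le_top)), norm_smul, norm_pow, norm_inv,
      Real.norm_of_nonneg (hr j).le, mul_inv, mul_pow]
    rw [mul_right_comm]
    have h1 := hl j
    gcongr
    exact hMk k (T j) (hTm j) _
  set f : ℕ → Euc m → ℝ := fun j x => (l j ^ α') * b j x with hf
  have hfs : ∀ j, ContDiff ℝ (⊤ : ℕ∞) (f j) := fun j => contDiff_const.mul (hbs j)
  have hfit : ∀ j k x, iteratedFDeriv ℝ k (f j) x = (l j ^ α') • iteratedFDeriv ℝ k (b j) x := by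
    intro j k x
    have : f j = (l j ^ α') • b j := by ext x; simp [hf]
    rw [this, iteratedFDeriv_const_smul_apply]
    exact ((hbs j).of_le (by exact_mod_cast le_top)).contDiffAt
  have hsum : ∀ s : ℝ, 0 < s → Summable fun j => l j ^ s := by
    intro s hs
    refine Summable.of_nonneg_of_le (fun j => Real.rpow_nonneg (hl j).le s) (fun j => Real.rpow_le_rpow (hl j).le (hl2 j) hs.le) ?_
    have : (fun j : ℕ => (((1:ℝ)/2)^j)^s) = fun j => (((1:ℝ)/2)^s)^j := by
      ext j; rw [← Real.rpow_natCast, ← Real.rpow_natCast, ← Real.rpow_mul (by norm_num), ← Real.rpow_mul (by norm_num), mul_comm]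
    rw [this]
    exact summable_geometric_of_lt_one (by positivity) (Real.rpow_lt_one (by norm_num) (by norm_num) hs)
  set N := ⌊α⌋₊ with hN
  have hNα : (N:ℝ) ≤ α := Nat.floor_le hα.le
  have hαN : α < N + 1 := Nat.lt_floor_add_one α
  set v : ℕ → ℕ → ℝ := fun k j => (κ⁻¹) ^ k * Mk k * l j ^ (α' - k) with hv
  have hrw : ∀ j (k : ℕ), l j ^ α' * ((l j)⁻¹ ^ k) = l j ^ (α' - k) := by
    intro j k
    rw [Real.rpow_sub (hl j), Real.rpow_natCast, inv_pow]; rfl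
  have hfv : ∀ k j x, ‖iteratedFDeriv ℝ k (f j) x‖ ≤ v k j := by
    intro k j x
    rw [hfit, norm_smul, Real.norm_of_nonneg (Real.rpow_nonneg (hl j).le _)]
    simp only [hv]
    rw [← hrw j k]
    calc _ ≤ l j ^ α' * ((κ⁻¹) ^ k * Mk k * (l j)⁻¹ ^ k) := by
          gcongr
          · exact Real.rpow_nonneg (hl j).le _
          · exact hbk j k x
      _ = _ := by ring
  have hvs : ∀ k : ℕ, k ≤ N → Summable (v k) := by
    intro k hk
    refine (hsum _ ?_).mul_left _
    have : (k:ℝ) ≤ N := by exact_mod_cast hk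
    linarith
  have hcd : ContDiff ℝ ((N:ℕ∞):WithTop ℕ∞) (fun x => ∑' j, f j x) :=
    contDiff_tsum (N := (N:ℕ∞)) (v := v) (fun j => (hfs j).of_le (by exact_mod_cast le_top))
      (fun k hk => hvs k (by exact_mod_cast hk)) (fun k j x _ => hfv k j x)
  have hb0 : ∀ j x, 0 ≤ b j x := fun j x => cv_nonneg hg0 _
  have hf0 : ∀ j x, 0 ≤ f j x := fun j x => mul_nonneg (Real.rpow_nonneg (hl j).le _) (hb0 j x)
  have hfsm : ∀ x, Summable fun j => f j x := by
    intro x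
    refine Summable.of_nonneg_of_le (fun j => hf0 j x) (fun j => ?_) (hvs 0 (Nat.zero_le _))
    have := hfv 0 j x
    rw [norm_iteratedFDeriv_zero] at this
    exact (le_abs_self _).trans this
  refine ⟨fun x => ∑' j, f j x, fun x => tsum_nonneg fun j => hf0 j x, hcd.continuous.measurable, ⟨?_, ?_⟩, ?_, ?_⟩
  · exact hcd.contDiffOn
  · set β := α - N with hβ
    have hβ0 : 0 ≤ β := by linarith
    have hβ1 : β ≤ 1 := by linarith
    set Q : ℝ := 2 * ((κ⁻¹) ^ N * Mk N + (κ⁻¹) ^ (N+1) * Mk (N+1)) with hQ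
    have hQ0 : 0 ≤ Q := by have := hMk0 N; have := hMk0 (N+1); positivity
    have hit : ∀ x, iteratedFDeriv ℝ N (fun x => ∑' j, f j x) x = ∑' j, iteratedFDeriv ℝ N (f j) x := fun x =>
      iteratedFDeriv_tsum_apply (N := (N:ℕ∞)) (v := v) (fun j => (hfs j).of_le (by exact_mod_cast le_top))
      (fun k hk => hvs k (by exact_mod_cast hk)) (fun k j x _ => hfv k j x) le_rfl x
    have hsm : ∀ x, Summable fun j => iteratedFDeriv ℝ N (f j) x := fun x =>
      Summable.of_norm_bounded (hvs N le_rfl) fun j => hfv N j x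
    have hj : ∀ j x y, ‖iteratedFDeriv ℝ N (f j) x - iteratedFDeriv ℝ N (f j) y‖ ≤ Q * l j ^ (α' - α) * ‖x - y‖ ^ β := by
      intro j x y
      have a1 : ‖iteratedFDeriv ℝ N (f j) x - iteratedFDeriv ℝ N (f j) y‖ ≤ Q * l j ^ (α' - N) := by
        refine (norm_sub_le _ _).trans ?_
        have h1 := hfv N j x
        have h2 := hfv N j y
        have h3 : 0 ≤ (κ⁻¹) ^ (N+1) * Mk (N+1) * l j ^ (α' - N) := by
          have := hMk0 (N+1); have := hl j; positivity
        simp only [hv] at h1 h2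
        rw [hQ]; linarith
      have a2 : ‖iteratedFDeriv ℝ N (f j) x - iteratedFDeriv ℝ N (f j) y‖ ≤ (Q * l j ^ (α' - N)) * (‖x - y‖ / l j) := by
        have h1 : ∀ z ∈ (univ : Set (Euc m)), ‖fderiv ℝ (iteratedFDeriv ℝ N (f j)) z‖ ≤ v (N+1) j := by
          intro z _
          rw [norm_fderiv_iteratedFDeriv]; exact hfv (N+1) j z
        have h2 := convex_univ.norm_image_sub_le_of_norm_fderiv_le (𝕜 := ℝ) (fun z _ =>
          ((hfs j).differentiable_iteratedFDeriv (by exact_mod_cast ENat.natCast_lt_top N)) z) h1 (mem_univ y) (mem_univ x)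
        refine h2.trans ?_
        have h4 : v (N+1) j = (κ⁻¹) ^ (N+1) * Mk (N+1) * (l j ^ (α' - N) / l j) := by
          simp only [hv]; push_cast
          rw [← sub_sub, Real.rpow_sub_one (hl j).ne']
        rw [h4]
        have h5 : 0 ≤ (κ⁻¹) ^ (N+1) * Mk (N+1) := by have := hMk0 (N+1); positivity
        have h6 : 0 ≤ (κ⁻¹) ^ (N) * Mk (N) := by have := hMk0 (N); positivity
        have h7 : (κ⁻¹) ^ (N+1) * Mk (N+1) ≤ Q := by rw [hQ]; linarith
        have h8 : 0 ≤ l j ^ (α' - N) / l j * ‖x - y‖ := by have := hl j; positivity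
        calc _ = ((κ⁻¹) ^ (N+1) * Mk (N+1)) * (l j ^ (α' - N) / l j * ‖x - y‖) := by ring
          _ ≤ Q * (l j ^ (α' - N) / l j * ‖x - y‖) := by gcongr
          _ = _ := by ring
      have hq0 : 0 ≤ Q * l j ^ (α' - N) := by have := hl j; positivity
      have a3 : ‖iteratedFDeriv ℝ N (f j) x - iteratedFDeriv ℝ N (f j) y‖ ≤ (Q * l j ^ (α' - N)) * min 1 (‖x - y‖ / l j) := by
        rcases min_choice (1:ℝ) (‖x - y‖ / l j) with h | h <;> rw [h]
        · simpa using a1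
        · exact a2
      refine a3.trans ?_
      have hl' := hl j
      calc _ ≤ (Q * l j ^ (α' - N)) * (‖x - y‖ / l j) ^ β := by
            gcongr; exact min_le_pow (by positivity) hβ0 hβ1
        _ = Q * (l j ^ (α' - N) / l j ^ β) * ‖x - y‖ ^ β := by
            rw [Real.div_rpow (norm_nonneg _) hl'.le]; ring
        _ = _ := by
            rw [← Real.rpow_sub hl']; congr 3; rw [hβ]; ring
    set Z : ℝ := ∑' j, Q * l j ^ (α' - α) with hZ
    have hZs : Summable fun j => Q * l j ^ (α' - α) := (hsum _ (by linarith)).mul_left _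
    have hZ0 : 0 ≤ Z := tsum_nonneg fun j => by have := hl j; positivity
    have hfin : ∀ x y, ‖(∑' j, iteratedFDeriv ℝ N (f j) x) - ∑' j, iteratedFDeriv ℝ N (f j) y‖ ≤ Z * ‖x - y‖ ^ β := by
      intro x y
      rw [← (hsm x).tsum_sub (hsm y), hZ, ← _root_.tsum_mul_right]
      exact tsum_of_norm_bounded (hZs.mul_right _).hasSum fun j => hj j x y
    refine ⟨Z.toNNReal, ?_⟩
    intro x hx y hy
    simp only
    rw [iteratedFDerivWithin_eq_iteratedFDeriv box_uniqueDiff hcd.contDiffAt hx,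
      iteratedFDerivWithin_eq_iteratedFDeriv box_uniqueDiff hcd.contDiffAt hy, hit, hit, edist_dist, dist_eq_norm, edist_dist,
      dist_eq_norm, Real.coe_toNNReal _ hβ0, ENNReal.ofReal_rpow_of_nonneg (norm_nonneg _) hβ0]
    rw [show ((Z.toNNReal : ℝ≥0) : ℝ≥0∞) = ENNReal.ofReal Z from rfl, ← ENNReal.ofReal_mul hZ0]
    exact ENNReal.ofReal_le_ofReal (hfin x y)
  · intro j x hx
    have h1 : b j x = 1 := by
      refine cv_one hg1 hgs ?_
      intro y hy
      apply hx
      rw [mem_closedBall, dist_eq_norm] at hy ⊢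
      have : (κ * l j) • y - x = (κ * l j) • (y - (κ * l j)⁻¹ • x) := by
        rw [smul_sub, smul_smul, mul_inv_cancel₀ (hr j).ne', one_smul]
      rw [this, norm_smul, Real.norm_of_nonneg (hr j).le]
      exact mul_le_of_le_one_right (hr j).le hy
    have h2 : f j x = l j ^ α' := by simp [hf, h1]
    rw [← h2]
    exact (hfsm x).le_tsum j fun i _ => hf0 i x
  · intro x hx
    have : ∀ j, f j x = 0 := by
      intro j
      have : b j x = 0 := by
        refine cv_zero hgs ?_
        rw [Set.disjoint_left]
        intro y hy hyT
        refine (Set.disjoint_left.1 (hx j)) ?_ hyT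
        rw [mem_closedBall, dist_eq_norm] at hy ⊢
        have : (κ * l j) • y - x = (κ * l j) • (y - (κ * l j)⁻¹ • x) := by
          rw [smul_sub, smul_smul, mul_inv_cancel₀ (hr j).ne', one_smul]
        rw [this, norm_smul, Real.norm_of_nonneg (hr j).le]
        exact mul_le_of_le_one_right (hr j).le hy
      simp [hf, this]
    simp [this]

lemma exists_profile : ∃ θ : ℝ → ℝ, ContDiff ℝ (⊤ : ℕ∞) θ ∧ (∀ t, t ≤ 1/4 → θ t = 0) ∧ (∀ t, 1/2 ≤ t → θ t = 1) ∧
    (∀ t, 0 ≤ θ t) ∧ (∀ t, θ t ≤ 1) ∧ (∀ t, |deriv θ t| ≤ 6) := by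
  let ψ : ContDiffBump (3/8 : ℝ) := ⟨1/10, 1/8, by norm_num, by norm_num⟩
  set g : ℝ → ℝ := ψ.normed volume with hg
  have hgsm : ContDiff ℝ (⊤ : ℕ∞) g := ψ.contDiff_normed
  have hg0 : ∀ x, 0 ≤ g x := fun x => ψ.nonneg_normed x
  have hg1 : ∫ x, g x = 1 := ψ.integral_normed
  have hsup : Function.support g = ball (3/8) (1/8) := ψ.support_normed_eq
  have hz : ∀ x, x ∉ ball (3/8 : ℝ) (1/8) → g x = 0 := by
    intro x hx; rw [← hsup] at hx; simpa using hx
  have hg5 : ∀ x, g x ≤ 6 := by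
    intro x
    refine (ψ.normed_le_div_measure_closedBall_rIn volume x).trans ?_
    have : (volume : Measure ℝ).real (closedBall (3/8:ℝ) ψ.rIn) = 2 * (1/10) := by
      rw [measureReal_def, Real.volume_closedBall, ENNReal.toReal_ofReal (by positivity)]
    rw [this]; norm_num
  have hint : ∀ a b, IntervalIntegrable g volume a b := fun a b => hgsm.continuous.intervalIntegrable a b
  have hd : ∀ t, HasDerivAt (fun t => ∫ y in (0:ℝ)..t, g y) (g t) t := fun t =>
    intervalIntegral.integral_hasDerivAt_right (hint _ _) hgsm.continuous.aestronglyMeasurable.stronglyMeasurableAtFilter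
      hgsm.continuous.continuousAt
  have hde : deriv (fun t => ∫ y in (0:ℝ)..t, g y) = g := funext fun t => (hd t).deriv
  have h0 : ∀ t, t ≤ 1/4 → ∫ y in (0:ℝ)..t, g y = 0 := by
    intro t ht
    have : ∫ y in (0:ℝ)..t, g y = ∫ y in (0:ℝ)..t, (0:ℝ) := ?_
    · rw [this]; simp
    refine intervalIntegral.integral_congr fun y hy => ?_
    apply hz
    rw [Real.ball_eq_Ioo]
    rw [mem_uIcc] at hy
    rintro ⟨h1, h2⟩
    norm_num at h1
    rcases hy with hy | hy <;> linarith [hy.1, hy.2]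
  have h1 : ∀ t, 1/2 ≤ t → ∫ y in (0:ℝ)..t, g y = 1 := by
    intro t ht
    rw [intervalIntegral.integral_eq_integral_of_support_subset, hg1]
    rw [hsup, Real.ball_eq_Ioo]
    rintro y ⟨h1, h2⟩
    norm_num at h1 h2
    constructor <;> linarith
  have hmono : Monotone (fun t => ∫ y in (0:ℝ)..t, g y) := by
    apply monotone_of_deriv_nonneg (fun t => (hd t).differentiableAt)
    intro t; rw [hde]; exact hg0 t
  refine ⟨fun t => ∫ y in (0:ℝ)..t, g y, ?_, h0, h1, ?_, ?_, ?_⟩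
  · rw [contDiff_infty_iff_deriv]
    exact ⟨fun t => (hd t).differentiableAt, by rw [hde]; exact hgsm⟩
  · intro t
    rcases le_total t (1/4) with h | h
    · exact (h0 t h).ge
    · have h3 := hmono h
      simp only at h3
      rwa [h0 (1/4) le_rfl] at h3
  · intro t
    rcases le_total t (1/2) with h | h
    · have h3 := hmono h
      simp only at h3
      rwa [h1 (1/2) le_rfl] at h3
    · exact (h1 t h).le
  · intro t
    rw [hde, abs_of_nonneg (hg0 t)]; exact hg5 t

noncomputable def ax {n : ℕ} (t : ℝ) : Euc (n+1) := snocC 0 t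

noncomputable def frL (n : ℕ) : Euc (n+1) →L[ℝ] Euc n :=
  LinearMap.toContinuousLinearMap
    { toFun := frontC, map_add' := fun x y => by ext i; simp [frontC], map_smul' := fun c x => by ext i; simp [frontC] }

noncomputable def laL (n : ℕ) : Euc (n+1) →L[ℝ] ℝ :=
  LinearMap.toContinuousLinearMap
    { toFun := lastC, map_add' := fun x y => by simp [lastC], map_smul' := fun c x => by simp [lastC] }

lemma frL_apply {n : ℕ} (x : Euc (n+1)) : frL n x = frontC x := rfl
lemma laL_apply {n : ℕ} (x : Euc (n+1)) : laL n x = lastC x := rfl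

lemma norm_sq_split {n : ℕ} (x : Euc (n+1)) : ‖x‖^2 = ‖frontC x‖^2 + lastC x ^ 2 := by
  rw [EuclideanSpace.norm_sq_eq, EuclideanSpace.norm_sq_eq, Fin.sum_univ_castSucc]
  simp [frontC, lastC]

lemma norm_front_le {n : ℕ} (x : Euc (n+1)) : ‖frontC x‖ ≤ ‖x‖ := by
  have := norm_sq_split x
  nlinarith [norm_nonneg x, norm_nonneg (frontC x), sq_nonneg (lastC x)]

lemma abs_last_le {n : ℕ} (x : Euc (n+1)) : |lastC x| ≤ ‖x‖ := by
  have := norm_sq_split x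
  apply abs_le_of_sq_le_sq _ (norm_nonneg x)
  nlinarith [sq_nonneg ‖frontC x‖]

lemma norm_le_split {n : ℕ} (x : Euc (n+1)) : ‖x‖ ≤ ‖frontC x‖ + |lastC x| := by
  have := norm_sq_split x
  have h := sq_abs (lastC x)
  have h0 := norm_nonneg (frontC x)
  have h1 := abs_nonneg (lastC x)
  apply le_of_sq_le_sq _ (by positivity)
  nlinarith

lemma frL_norm {n : ℕ} : ‖frL n‖ ≤ 1 :=
  ContinuousLinearMap.opNorm_le_bound _ zero_le_one fun x => by rw [one_mul]; exact norm_front_le x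

lemma laL_norm {n : ℕ} : ‖laL n‖ ≤ 1 :=
  ContinuousLinearMap.opNorm_le_bound _ zero_le_one fun x => by rw [one_mul]; exact abs_last_le x

lemma front_ax {n : ℕ} (t : ℝ) : frontC (ax t : Euc (n+1)) = 0 := by
  ext i; simp [frontC, ax, snocC]

lemma last_ax {n : ℕ} (t : ℝ) : lastC (ax t : Euc (n+1)) = t := by
  simp [lastC, ax, snocC]

lemma front_sub {n : ℕ} (x y : Euc (n+1)) : frontC (x - y) = frontC x - frontC y := (frL n).map_sub x y
lemma last_sub {n : ℕ} (x y : Euc (n+1)) : lastC (x - y) = lastC x - lastC y := (laL n).map_sub x y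
lemma front_add {n : ℕ} (x y : Euc (n+1)) : frontC (x + y) = frontC x + frontC y := (frL n).map_add x y
lemma last_add {n : ℕ} (x y : Euc (n+1)) : lastC (x + y) = lastC x + lastC y := (laL n).map_add x y

lemma euc_ext {n : ℕ} {x y : Euc (n+1)} (h1 : frontC x = frontC y) (h2 : lastC x = lastC y) : x = y := by
  have h : x - y = 0 := by
    have := norm_sq_split (x - y)
    rw [front_sub, last_sub, h1, h2] at this
    simpa using this
  exact sub_eq_zero.1 h

lemma snoc_eq {n : ℕ} (x : Euc (n+1)) (t : ℝ) : snocC (frontC x) (lastC x - t) = x - ax t := by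
  apply euc_ext
  · rw [front_sub, front_ax, sub_zero]; ext i; simp [frontC, snocC]
  · rw [last_sub, last_ax]; simp [lastC, snocC]

lemma ax_norm {n : ℕ} (t : ℝ) : ‖(ax t : Euc (n+1))‖ = |t| := by
  have := norm_sq_split (ax t : Euc (n+1))
  rw [front_ax, last_ax] at this
  rw [← sqrt_sq (norm_nonneg _), this]; simp [sqrt_sq_eq_abs]

lemma ax_sub {n : ℕ} (s t : ℝ) : (ax s : Euc (n+1)) - ax t = ax (s - t) := by
  apply euc_ext
  · rw [front_sub, front_ax, front_ax, front_ax, sub_zero]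
  · rw [last_sub, last_ax, last_ax, last_ax]

lemma ax_cont {n : ℕ} : Continuous (ax : ℝ → Euc (n+1)) := by
  have : (ax : ℝ → Euc (n+1)) = fun t => t • ax 1 := by
    ext1 t
    apply euc_ext
    · rw [← frL_apply, ← frL_apply, map_smul, frL_apply, frL_apply, front_ax, front_ax, smul_zero]
    · rw [← laL_apply, ← laL_apply, map_smul, laL_apply, laL_apply, last_ax, last_ax]; simp
  rw [this]; fun_prop

lemma front_null {n : ℕ} (hn : 1 ≤ n) : ∀ᵐ x : Euc (n+1), frontC x ≠ 0 := by
  have h := Measure.addHaar_submodule (volume : Measure (Euc (n+1))) (LinearMap.ker (frL n : Euc (n+1) →ₗ[ℝ] Euc n)) ?_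
  · rw [ae_iff]
    convert h using 2
    ext x; simp [frL_apply]
  · intro h
    have h2 : (EuclideanSpace.single (0 : Fin (n+1)) (1:ℝ)) ∈ LinearMap.ker (frL n : Euc (n+1) →ₗ[ℝ] Euc n) := by rw [h]; trivial
    rw [LinearMap.mem_ker] at h2
    have h3 : frontC (EuclideanSpace.single (0 : Fin (n+1)) (1:ℝ)) = 0 := h2
    have h4 : (frontC (EuclideanSpace.single (0 : Fin (n+1)) (1:ℝ))) ⟨0, hn⟩ = 0 := by rw [h3]; rfl
    simp [frontC] at h4

structure Prof (θ : ℝ → ℝ) : Prop where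
  sm : ContDiff ℝ (⊤ : ℕ∞) θ
  z : ∀ t, t ≤ 1/4 → θ t = 0
  o : ∀ t, 1/2 ≤ t → θ t = 1
  n : ∀ t, 0 ≤ θ t
  le : ∀ t, θ t ≤ 1
  d : ∀ t, |deriv θ t| ≤ 6

lemma Prof.isProfile {θ : ℝ → ℝ} (h : Prof θ) : IsProfile θ := by
  refine ⟨h.sm.contDiffOn, fun t _ => ?_, fun t _ => ?_, fun t _ => h.d t⟩
  · split_ifs with h1
    · exact (h.o t h1.le).ge
    · exact h.n t
  · split_ifs with h1
    · exact h.le t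
    · exact (h.z t (not_lt.1 h1)).le

noncomputable def Th (θ : ℝ → ℝ) (t : ℝ) : ℝ := (θ t - θ (-t)) / 2
noncomputable def rho {n : ℕ} (ε : ℝ) (x : Euc (n+1)) : ℝ := √(‖frontC x‖^2 + ε^2)
noncomputable def ue {n : ℕ} (θ : ℝ → ℝ) (ε : ℝ) (x : Euc (n+1)) : ℝ := Th θ (lastC x * (rho ε x)⁻¹)
noncomputable def DUe {n : ℕ} (θ : ℝ → ℝ) (ε : ℝ) (x : Euc (n+1)) : Euc (n+1) →L[ℝ] ℝ :=
  deriv (Th θ) (lastC x * (rho ε x)⁻¹) •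
    ((rho ε x)⁻¹ • laL n - (lastC x * (rho ε x)⁻¹ ^ 3) • (innerSL ℝ (frontC x)).comp (frL n))

namespace Prof

lemma Th_sm {θ : ℝ → ℝ} (h : Prof θ) : ContDiff ℝ (⊤ : ℕ∞) (Th θ) := by
  unfold Th
  exact (h.sm.sub (h.sm.comp contDiff_neg)).div_const 2

lemma Th_deriv {θ : ℝ → ℝ} (h : Prof θ) (t : ℝ) : deriv (Th θ) t = (deriv θ t + deriv θ (-t)) / 2 := by
  have hd : ∀ t, HasDerivAt θ (deriv θ t) t := fun t => (h.sm.differentiable (by simp) t).hasDerivAt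
  have h2 : HasDerivAt (fun t => θ (-t)) (-deriv θ (-t)) t := by
    have := HasDerivAt.comp t (hd (-t)) (hasDerivAt_neg t)
    rw [mul_neg_one] at this
    exact this
  have := ((hd t).sub h2).div_const 2
  have h3 := this.deriv
  rw [sub_neg_eq_add] at h3
  exact h3

lemma deriv_zero {θ : ℝ → ℝ} (h : Prof θ) {t : ℝ} (ht : t < 1/4 ∨ 1/2 < t) : deriv θ t = 0 := by
  rcases ht with ht | ht
  · have : θ =ᶠ[𝓝 t] fun _ => 0 := by
      filter_upwards [Iio_mem_nhds ht] with s hs using h.z s (le_of_lt hs)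
    rw [this.deriv_eq]; simp
  · have : θ =ᶠ[𝓝 t] fun _ => 1 := by
      filter_upwards [Ioi_mem_nhds ht] with s hs using h.o s (le_of_lt hs)
    rw [this.deriv_eq]; simp

lemma Th_deriv_le {θ : ℝ → ℝ} (h : Prof θ) (t : ℝ) : |deriv (Th θ) t| ≤ 6 := by
  rw [h.Th_deriv]
  have h1 := h.d t
  have h2 := h.d (-t)
  rw [abs_le] at *
  constructor <;> linarith

lemma Th_deriv_supp {θ : ℝ → ℝ} (h : Prof θ) {t : ℝ} (ht : deriv (Th θ) t ≠ 0) : 1/4 ≤ |t| ∧ |t| ≤ 1/2 := by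
  rw [h.Th_deriv] at ht
  by_contra hc
  apply ht
  rw [h.deriv_zero, h.deriv_zero]; · simp
  · rcases not_and_or.1 hc with h1 | h1
    · left; have := neg_abs_le t; linarith
    · rcases le_total 0 t with h2 | h2
      · left; linarith
      · right; rw [abs_of_nonpos h2] at h1; linarith
  · rcases not_and_or.1 hc with h1 | h1
    · left; have := le_abs_self t; linarith
    · rcases le_total 0 t with h2 | h2
      · right; rw [abs_of_nonneg h2] at h1; linarith
      · left; linarith

lemma Th_le {θ : ℝ → ℝ} (h : Prof θ) (t : ℝ) : |Th θ t| ≤ 1 := by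
  unfold Th
  have h1 := h.n t
  have h2 := h.n (-t)
  have h3 := h.le t
  have h4 := h.le (-t)
  rw [abs_le]; constructor <;> linarith

end Prof

lemma rho_pos {n : ℕ} {ε : ℝ} (hε : ε ≠ 0) (x : Euc (n+1)) : 0 < rho ε x := by
  unfold rho; positivity

lemma rho_ge {n : ℕ} (ε : ℝ) (x : Euc (n+1)) : ‖frontC x‖ ≤ rho ε x := by
  unfold rho
  apply Real.le_sqrt_of_sq_le
  nlinarith [sq_nonneg ε]

lemma rho_zero {n : ℕ} (x : Euc (n+1)) : rho 0 x = ‖frontC x‖ := by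
  simp [rho]

lemma rho_cont {n : ℕ} (ε : ℝ) : Continuous (rho ε : Euc (n+1) → ℝ) := by
  unfold rho
  have : Continuous (fun x : Euc (n+1) => frontC x) := (frL n).continuous
  fun_prop

lemma rho_cont2 {n : ℕ} (x : Euc (n+1)) : Continuous (fun ε => rho ε x) := by
  unfold rho
  fun_prop

lemma ue_deriv {n : ℕ} {θ : ℝ → ℝ} (h : Prof θ) {ε : ℝ} (hε : ε ≠ 0) (x : Euc (n+1)) :
    HasFDerivAt (ue θ ε) (DUe θ ε x) x := by
  have h1 : HasFDerivAt (fun x : Euc (n+1) => ‖frontC x‖^2) ((2 • innerSL ℝ (frontC x)).comp (frL n)) x := by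
    exact (hasStrictFDerivAt_norm_sq (frontC x)).hasFDerivAt.comp x (frL n).hasFDerivAt
  have hr := rho_pos hε x
  have h2 := ((h1.add_const (ε^2)).sqrt (by positivity))
  have h3 : HasFDerivAt (rho ε : Euc (n+1) → ℝ) ((rho ε x)⁻¹ • (innerSL ℝ (frontC x)).comp (frL n)) x := by
    refine h2.congr_fderiv ?_
    ext y
    simp only [rho, _root_.smul_apply, ContinuousLinearMap.comp_apply, smul_eq_mul, nsmul_eq_mul]
    field_simp
    norm_num
  have h4 := (hasDerivAt_inv hr.ne').comp_hasFDerivAt x h3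
  have h5 : HasFDerivAt (fun x : Euc (n+1) => lastC x) (laL n) x := (laL n).hasFDerivAt
  have h6 := h5.mul h4
  have h7 := ((h.Th_sm.differentiable (by simp) (lastC x * (rho ε x)⁻¹)).hasDerivAt).comp_hasFDerivAt x h6
  refine h7.congr_fderiv ?_
  unfold DUe
  congr 1
  ext y
  simp only [_root_.smul_apply, ContinuousLinearMap.comp_apply, smul_eq_mul, _root_.add_apply,
    _root_.sub_apply, Function.comp_apply]
  field_simp
  ring

lemma DUe_supp {n : ℕ} {θ : ℝ → ℝ} (h : Prof θ) {ε : ℝ} {x : Euc (n+1)} (hx : DUe θ ε x ≠ 0) :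
    0 < rho ε x ∧ rho ε x / 4 ≤ |lastC x| ∧ |lastC x| ≤ rho ε x / 2 := by
  have h1 : deriv (Th θ) (lastC x * (rho ε x)⁻¹) ≠ 0 := by
    intro h0; apply hx; unfold DUe; rw [h0, zero_smul]
  have hr0 : 0 ≤ rho ε x := Real.sqrt_nonneg _
  obtain ⟨h2, h3⟩ := h.Th_deriv_supp h1
  have hr : 0 < rho ε x := by
    refine lt_of_le_of_ne hr0 fun h0 => ?_
    rw [← h0] at h2; norm_num at h2
  rw [abs_mul, abs_of_nonneg (inv_nonneg.2 hr0), ← div_eq_mul_inv] at h2 h3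
  rw [le_div_iff₀ hr] at h2
  rw [div_le_iff₀ hr] at h3
  exact ⟨hr, by linarith, by linarith⟩

lemma DUe_le {n : ℕ} {θ : ℝ → ℝ} (h : Prof θ) (ε : ℝ) (x : Euc (n+1)) : ‖DUe θ ε x‖ ≤ 9 * (rho ε x)⁻¹ := by
  have hr0 : 0 ≤ rho ε x := Real.sqrt_nonneg _
  by_cases hx : DUe θ ε x = 0
  · rw [hx, norm_zero]; positivity
  obtain ⟨hr, _, h3⟩ := DUe_supp h hx
  have hin : ‖(innerSL ℝ (frontC x)).comp (frL n)‖ ≤ rho ε x := by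
    refine (ContinuousLinearMap.opNorm_comp_le _ _).trans ?_
    rw [innerSL_apply_norm]
    calc _ ≤ ‖frontC x‖ * 1 := by gcongr; exact frL_norm
      _ ≤ _ := by rw [mul_one]; exact rho_ge ε x
  unfold DUe
  rw [norm_smul, Real.norm_eq_abs]
  have h4 : ‖(rho ε x)⁻¹ • laL n - (lastC x * (rho ε x)⁻¹ ^ 3) • (innerSL ℝ (frontC x)).comp (frL n)‖ ≤ (3/2) * (rho ε x)⁻¹ := by
    refine (norm_sub_le _ _).trans ?_
    rw [norm_smul, norm_smul, Real.norm_of_nonneg (inv_nonneg.2 hr0), norm_mul, Real.norm_eq_abs, norm_pow,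
      Real.norm_of_nonneg (inv_nonneg.2 hr0)]
    calc _ ≤ (rho ε x)⁻¹ * 1 + (rho ε x / 2) * (rho ε x)⁻¹ ^ 3 * rho ε x := by
          gcongr; exact laL_norm
      _ = _ := by field_simp; norm_num
  calc _ ≤ 6 * ((3/2) * (rho ε x)⁻¹) := by gcongr; exact h.Th_deriv_le _
    _ = _ := by ring

lemma DUe_le' {n : ℕ} {θ : ℝ → ℝ} (h : Prof θ) (ε : ℝ) (x : Euc (n+1)) : ‖DUe θ ε x‖ ≤ 14 * ‖x‖ ^ (-1:ℝ) := by
  rw [Real.rpow_neg_one]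
  by_cases hx : DUe θ ε x = 0
  · rw [hx, norm_zero]; positivity
  obtain ⟨hr, h2, h3⟩ := DUe_supp h hx
  refine (DUe_le h ε x).trans ?_
  have h4 : 0 < ‖x‖ := by
    have := abs_last_le x; linarith
  have h5 : ‖x‖ ≤ 3/2 * rho ε x := by
    have := norm_le_split x
    have := rho_ge ε x
    linarith
  rw [← div_eq_mul_inv, ← div_eq_mul_inv, div_le_div_iff₀ hr h4]
  linarith

lemma DUe_meas {n : ℕ} {θ : ℝ → ℝ} (h : Prof θ) (ε : ℝ) : StronglyMeasurable (DUe θ ε : Euc (n+1) → _) := by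
  have h1 : Continuous (deriv (Th θ)) := h.Th_sm.continuous_deriv (by simp)
  have h2 : Measurable (fun x : Euc (n+1) => lastC x) := (laL n).continuous.measurable
  have h3 : Continuous (fun x : Euc (n+1) => (innerSL ℝ (frontC x)).comp (frL n)) := by
    have : Continuous (fun x : Euc (n+1) => frontC x) := (frL n).continuous
    fun_prop
  have h4 : Measurable (fun x : Euc (n+1) => (rho ε x)⁻¹) := (rho_cont ε).measurable.inv
  unfold DUe
  refine StronglyMeasurable.smul (h1.measurable.comp (h2.mul h4)).stronglyMeasurable ?_
  refine StronglyMeasurable.sub (h4.stronglyMeasurable.smul stronglyMeasurable_const) ?_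
  exact StronglyMeasurable.smul (h2.mul (h4.pow_const 3)).stronglyMeasurable h3.stronglyMeasurable

lemma DUe_tendsto {n : ℕ} {θ : ℝ → ℝ} (h : Prof θ) {x : Euc (n+1)} (hx : frontC x ≠ 0) {e : ℕ → ℝ}
    (he : Tendsto e atTop (𝓝 0)) : Tendsto (fun k => DUe θ (e k) x) atTop (𝓝 (DUe θ 0 x)) ∧
      Tendsto (fun k => ue θ (e k) x) atTop (𝓝 (ue θ 0 x)) := by
  have h1 : Continuous (deriv (Th θ)) := h.Th_sm.continuous_deriv (by simp)
  have h2 : Tendsto (fun k => (rho (e k) x)⁻¹) atTop (𝓝 (rho 0 x)⁻¹) := by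
    refine Tendsto.inv₀ (((rho_cont2 x).tendsto 0).comp he) ?_
    rw [rho_zero]; simpa using hx
  constructor
  · unfold DUe
    exact ((h1.tendsto _).comp (h2.const_mul _)).smul ((h2.smul_const _).sub (((h2.pow 3).const_mul _).smul_const _))
  · exact (h.Th_sm.continuous.tendsto _).comp (h2.const_mul _)

lemma uD_eq {n : ℕ} {θ : ℝ → ℝ} (h : Prof θ) {x : Euc (n+1)} (hx : frontC x ≠ 0) : uD θ x = ue θ 0 x := by
  have hr : 0 < ‖frontC x‖ := norm_pos_iff.2 hx
  unfold uD ue Th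
  rw [if_neg hx, rho_zero, ← div_eq_mul_inv]
  rcases lt_trichotomy (lastC x) 0 with h1 | h1 | h1
  · have h2 : lastC x / ‖frontC x‖ < 0 := div_neg_of_neg_of_pos h1 hr
    rw [Real.sign_of_neg h1, abs_of_neg h1, h.z (lastC x / ‖frontC x‖) (by linarith), neg_div]; ring
  · simp [h1]
  · have h2 : 0 < lastC x / ‖frontC x‖ := div_pos h1 hr
    rw [Real.sign_of_pos h1, abs_of_pos h1, h.z (-(lastC x / ‖frontC x‖)) (by linarith)]; ring

lemma uD_meas {n : ℕ} {θ : ℝ → ℝ} (h : Prof θ) : Measurable (uD θ : Euc (n+1) → ℝ) := by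
  have h1 : Measurable (fun x : Euc (n+1) => frontC x) := (frL n).continuous.measurable
  have h2 : Measurable (fun x : Euc (n+1) => lastC x) := (laL n).continuous.measurable
  have h3 : Measurable Real.sign := by
    unfold Real.sign
    exact Measurable.ite measurableSet_Iio measurable_const (Measurable.ite measurableSet_Ioi measurable_const measurable_const)
  unfold uD
  refine Measurable.ite (h1 (measurableSet_singleton 0)) ((h3.comp h2).const_mul _) ?_
  exact ((h3.comp h2).const_mul _).mul (h.sm.continuous.measurable.comp ((h2.abs).div h1.norm))

lemma sign_abs_le (t : ℝ) : |Real.sign t| ≤ 1 := by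
  rcases Real.sign_apply_eq t with h | h | h <;> rw [h] <;> simp

lemma uD_le {n : ℕ} {θ : ℝ → ℝ} (h : Prof θ) (x : Euc (n+1)) : |uD θ x| ≤ 1 := by
  unfold uD
  have h1 := sign_abs_le (lastC x)
  split_ifs
  · rw [abs_mul]; rw [abs_of_pos (by norm_num : (0:ℝ) < 1/2)]; linarith
  · rw [abs_mul, abs_mul, abs_of_pos (by norm_num : (0:ℝ) < 1/2), abs_of_nonneg (h.n _)]
    have := h.le (|lastC x| / ‖frontC x‖)
    have h2 := h.n (|lastC x| / ‖frontC x‖)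
    have h3 := abs_nonneg (Real.sign (lastC x))
    nlinarith

lemma uD_far {n : ℕ} {θ : ℝ → ℝ} (h : Prof θ) {x : Euc (n+1)} (hx : ‖frontC x‖ ≤ |lastC x|) : uD θ x = 1/2 * Real.sign (lastC x) := by
  unfold uD
  split_ifs with h1
  · rfl
  · have hr : 0 < ‖frontC x‖ := norm_pos_iff.2 h1
    rw [h.o, mul_one]
    rw [le_div_iff₀ hr]; linarith

lemma ue_locint {n : ℕ} {θ : ℝ → ℝ} (h : Prof θ) : LocallyIntegrable (uD θ : Euc (n+1) → ℝ) := by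
  have : LocallyIntegrable (fun _ : Euc (n+1) => (1:ℝ)) := continuous_const.locallyIntegrable
  refine this.mono (uD_meas h).aestronglyMeasurable (Eventually.of_forall fun x => ?_)
  simpa using uD_le h x

lemma DUe_locint {n : ℕ} (hn : 1 ≤ n) {θ : ℝ → ℝ} (h : Prof θ) (ε : ℝ) :
    LocallyIntegrable (DUe θ ε : Euc (n+1) → Euc (n+1) →L[ℝ] ℝ) := by
  refine locallyIntegrable_of_norm_le_rpow (C := 14) (α := 1) ?_ ?_ (Eventually.of_forall fun x => DUe_le' h ε x) (DUe_meas h ε).aestronglyMeasurable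
  · simp
  · simp; omega

lemma intL {m : ℕ} {F : Type} [NormedAddCommGroup F] [NormedSpace ℝ F] {G : Euc m → F} (hG : LocallyIntegrable G)
    {φ : Euc m → ℝ} (hφ : Continuous φ) (hc : HasCompactSupport φ) : Integrable fun x => φ x • G x :=
  hG.integrable_smul_left_of_hasCompactSupport hφ hc

lemma intR {m : ℕ} {F : Type} [NormedAddCommGroup F] [NormedSpace ℝ F] {u : Euc m → ℝ} (hG : LocallyIntegrable u)
    {φ : Euc m → F} (hφ : Continuous φ) (hc : HasCompactSupport φ) : Integrable fun x => u x • φ x :=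
  hG.integrable_smul_right_of_hasCompactSupport hφ hc

lemma uD_weak {n : ℕ} (hn : 1 ≤ n) {θ : ℝ → ℝ} (h : Prof θ) :
    HasWeakFDerivOn univ (uD θ : Euc (n+1) → ℝ) (DUe θ 0) := by
  intro φ hφ hc _
  rw [Measure.restrict_univ]
  set e : ℕ → ℝ := fun k => 1 / ((k:ℝ) + 1) with he
  have he0 : ∀ k, e k ≠ 0 := fun k => by simp only [he]; positivity
  have het : Tendsto e atTop (𝓝 0) := tendsto_one_div_add_atTop_nhds_zero_nat
  have hk : ∀ k, ∫ x, ue θ (e k) x • fderiv ℝ φ x = -∫ x, φ x • DUe θ (e k) x := by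
    intro k
    have hd : ∀ x : Euc (n+1), HasFDerivAt (ue θ (e k)) (DUe θ (e k) x) x := ue_deriv h (he0 k)
    have hcont : Continuous (ue θ (e k) : Euc (n+1) → ℝ) := continuous_iff_continuousAt.2 fun x => (hd x).continuousAt
    have i1 : Integrable fun x => ue θ (e k) x • fderiv ℝ φ x := by
      exact intR hcont.locallyIntegrable (hφ.continuous_fderiv (by simp)) (hc.fderiv (𝕜 := ℝ))
    have i2 : Integrable fun x => φ x • DUe θ (e k) x := intL (DUe_locint hn h (e k)) hφ.continuous hc
    have i3 : Integrable fun x => ue θ (e k) x * φ x := by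
      refine Continuous.integrable_of_hasCompactSupport (hcont.mul hφ.continuous) ?_
      exact hc.mul_left
    ext v
    rw [ContinuousLinearMap.integral_apply i1, ContinuousLinearMap.neg_apply, ContinuousLinearMap.integral_apply i2]
    have := integral_mul_fderiv_eq_neg_fderiv_mul_of_integrable (μ := volume) (f := ue θ (e k)) (g := φ) (v := v) ?_ ?_ i3
      (fun x _ => (hd x).differentiableAt) (fun x _ => hφ.differentiable (by simp) x)
    · simp only [_root_.smul_apply, smul_eq_mul]
      rw [this]
      congr 2
      ext x
      rw [(hd x).fderiv, mul_comm]
    · have := i2.apply_continuousLinearMap v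
      simp only [_root_.smul_apply, smul_eq_mul] at this
      refine this.congr (Eventually.of_forall fun x => ?_)
      simp only; rw [(hd x).fderiv, mul_comm]
    · have := i1.apply_continuousLinearMap v
      simpa only [_root_.smul_apply, smul_eq_mul] using this
  have l1 : Tendsto (fun k => ∫ x, ue θ (e k) x • fderiv ℝ φ x) atTop (𝓝 (∫ x, uD θ x • fderiv ℝ φ x)) := by
    refine tendsto_integral_of_dominated_convergence (fun x => ‖fderiv ℝ φ x‖) (fun k => ?_) ?_ (fun k => Eventually.of_forall fun x => ?_) ?_
    · have hd : ∀ x : Euc (n+1), HasFDerivAt (ue θ (e k)) (DUe θ (e k) x) x := ue_deriv h (he0 k)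
      have hcont : Continuous (ue θ (e k) : Euc (n+1) → ℝ) := continuous_iff_continuousAt.2 fun x => (hd x).continuousAt
      exact (hcont.smul (hφ.continuous_fderiv (by simp))).aestronglyMeasurable
    · exact ((hφ.continuous_fderiv (by simp)).integrable_of_hasCompactSupport (hc.fderiv (𝕜 := ℝ))).norm
    · rw [norm_smul, Real.norm_eq_abs]
      exact mul_le_of_le_one_left (norm_nonneg _) (h.Th_le _)
    · filter_upwards [front_null hn] with x hx
      rw [uD_eq h hx]
      exact (DUe_tendsto h hx het).2.smul_const _
  have l2 : Tendsto (fun k => -∫ x, φ x • DUe θ (e k) x) atTop (𝓝 (-∫ x, φ x • DUe θ 0 x)) := by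
    refine Tendsto.neg ?_
    refine tendsto_integral_of_dominated_convergence (fun x => |φ x| * (14 * ‖x‖ ^ (-1:ℝ))) (fun k => ?_) ?_ (fun k => Eventually.of_forall fun x => ?_) ?_
    · exact (hφ.continuous.aestronglyMeasurable).smul (DUe_meas h _).aestronglyMeasurable
    · have : LocallyIntegrable (fun x : Euc (n+1) => 14 * ‖x‖ ^ (-1:ℝ)) := by
        refine locallyIntegrable_of_norm_le_rpow (C := 14) (α := 1) (by simp) (by simp; omega) (Eventually.of_forall fun x => ?_) ?_
        · rw [Real.norm_of_nonneg (by positivity)]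
        · exact ((measurable_norm.pow_const _).const_mul _).aestronglyMeasurable
      exact this.integrable_smul_left_of_hasCompactSupport hφ.continuous.abs hc.abs
    · rw [norm_smul, Real.norm_eq_abs]
      gcongr; exact DUe_le' h _ x
    · filter_upwards [front_null hn] with x hx
      exact (DUe_tendsto h hx het).1.const_smul _
  simp only [hk] at l1
  exact tendsto_nhds_unique l1 l2

noncomputable def uu {n : ℕ} (θ : ℝ → ℝ) (μ : Measure ℝ) (x : Euc (n+1)) : ℝ := ∫ t, uD θ (x - ax t) ∂μ
noncomputable def GG {n : ℕ} (θ : ℝ → ℝ) (μ : Measure ℝ) (x : Euc (n+1)) : Euc (n+1) →L[ℝ] ℝ := ∫ t, DUe θ 0 (x - ax t) ∂μ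

lemma sub_ax_cont {n : ℕ} : Continuous (fun z : Euc (n+1) × ℝ => z.1 - ax z.2) :=
  continuous_fst.sub (ax_cont.comp continuous_snd)

lemma prod_int {n : ℕ} {F : Type} [NormedAddCommGroup F] [NormedSpace ℝ F] {f : Euc (n+1) → F}
    (hm : StronglyMeasurable f) (hf : LocallyIntegrable f) {μ : Measure ℝ} [IsProbabilityMeasure μ]
    (hμ : ∀ᵐ t ∂μ, |t| ≤ 1/2) (R : ℝ) :
    Integrable (fun z : Euc (n+1) × ℝ => f (z.1 - ax z.2)) ((volume.restrict (closedBall 0 R)).prod μ) := by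
  have hms : StronglyMeasurable (fun z : Euc (n+1) × ℝ => f (z.1 - ax z.2)) := hm.comp_measurable sub_ax_cont.measurable
  refine ⟨hms.aestronglyMeasurable, ?_⟩
  have hC : ∫⁻ x in closedBall 0 (R+1), ‖f x‖ₑ < ⊤ :=
    (hf.integrableOn_isCompact (isCompact_closedBall 0 (R+1))).2
  rw [HasFiniteIntegral, lintegral_prod_symm _ hms.enorm.aemeasurable]
  refine lt_of_le_of_lt (b := ∫⁻ _ : ℝ, (∫⁻ x in closedBall 0 (R+1), ‖f x‖ₑ) ∂μ) ?_ (by simpa using hC)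
  refine lintegral_mono_ae ?_
  filter_upwards [hμ] with t ht
  rw [← lintegral_indicator measurableSet_closedBall, ← lintegral_indicator measurableSet_closedBall,
    ← lintegral_sub_right_eq_self ((closedBall 0 (R+1)).indicator fun x => ‖f x‖ₑ) (ax t : Euc (n+1))]
  refine lintegral_mono fun x => ?_
  by_cases hx : x ∈ closedBall (0 : Euc (n+1)) R
  · have h2 : x - ax t ∈ closedBall (0 : Euc (n+1)) (R+1) := by
      rw [mem_closedBall_zero_iff] at *
      refine (norm_sub_le _ _).trans ?_
      rw [ax_norm]; linarith
    rw [indicator_of_mem hx, indicator_of_mem h2]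
  · rw [indicator_of_notMem hx]; exact zero_le

lemma conv_locint {n : ℕ} {F : Type} [NormedAddCommGroup F] [NormedSpace ℝ F] {f : Euc (n+1) → F}
    (hm : StronglyMeasurable f) (hf : LocallyIntegrable f) {μ : Measure ℝ} [IsProbabilityMeasure μ]
    (hμ : ∀ᵐ t ∂μ, |t| ≤ 1/2) : LocallyIntegrable (fun x => ∫ t, f (x - ax t) ∂μ) := by
  rw [locallyIntegrable_iff]
  intro K hK
  obtain ⟨R, hR⟩ := hK.isBounded.subset_closedBall 0
  exact IntegrableOn.mono_set (prod_int hm hf hμ R).integral_prod_left hR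

lemma conv_swap {n : ℕ} {F : Type} [NormedAddCommGroup F] [NormedSpace ℝ F] {f : Euc (n+1) → F}
    (hm : StronglyMeasurable f) (hf : LocallyIntegrable f) {μ : Measure ℝ} [IsProbabilityMeasure μ]
    (hμ : ∀ᵐ t ∂μ, |t| ≤ 1/2) {φ : Euc (n+1) → ℝ} (hφ : Continuous φ) (hc : HasCompactSupport φ) :
    ∫ x, φ x • ∫ t, f (x - ax t) ∂μ = ∫ t, (∫ x, φ x • f (x - ax t)) ∂μ := by
  obtain ⟨R, hR⟩ := hc.isBounded.subset_closedBall 0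
  obtain ⟨M, hM⟩ := hc.exists_bound_of_continuous hφ
  have hz : ∀ x, x ∉ closedBall (0 : Euc (n+1)) R → φ x = 0 := fun x hx => by
    by_contra h0
    exact hx (hR (subset_tsupport _ h0))
  have e1 : ∫ x, φ x • ∫ t, f (x - ax t) ∂μ = ∫ x in closedBall 0 R, φ x • ∫ t, f (x - ax t) ∂μ := by
    rw [setIntegral_eq_integral_of_forall_compl_eq_zero]
    intro x hx; rw [hz x hx, zero_smul]
  have e2 : ∀ t, ∫ x, φ x • f (x - ax t) = ∫ x in closedBall 0 R, φ x • f (x - ax t) := by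
    intro t
    rw [setIntegral_eq_integral_of_forall_compl_eq_zero]
    intro x hx; rw [hz x hx, zero_smul]
  rw [e1]
  simp only [e2, ← integral_smul]
  apply integral_integral_swap
  have := prod_int hm hf hμ R
  exact this.bdd_smul M (hφ.comp continuous_fst).aestronglyMeasurable (Eventually.of_forall fun z => hM z.1)

lemma conv_swap' {n : ℕ} {F : Type} [NormedAddCommGroup F] [NormedSpace ℝ F] [CompleteSpace F] {f : Euc (n+1) → ℝ}
    (hm : StronglyMeasurable f) (hf : LocallyIntegrable f) {μ : Measure ℝ} [IsProbabilityMeasure μ]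
    (hμ : ∀ᵐ t ∂μ, |t| ≤ 1/2) {φ : Euc (n+1) → F} (hφ : Continuous φ) (hc : HasCompactSupport φ) :
    ∫ x, (∫ t, f (x - ax t) ∂μ) • φ x = ∫ t, (∫ x, f (x - ax t) • φ x) ∂μ := by
  obtain ⟨R, hR⟩ := hc.isBounded.subset_closedBall 0
  obtain ⟨M, hM⟩ := hc.exists_bound_of_continuous hφ
  have hz : ∀ x, x ∉ closedBall (0 : Euc (n+1)) R → φ x = 0 := fun x hx => by
    by_contra h0
    exact hx (hR (subset_tsupport _ h0))
  have e1 : ∫ x, (∫ t, f (x - ax t) ∂μ) • φ x = ∫ x in closedBall 0 R, (∫ t, f (x - ax t) ∂μ) • φ x := by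
    rw [setIntegral_eq_integral_of_forall_compl_eq_zero]
    intro x hx; rw [hz x hx, smul_zero]
  have e2 : ∀ t, ∫ x, f (x - ax t) • φ x = ∫ x in closedBall 0 R, f (x - ax t) • φ x := by
    intro t
    rw [setIntegral_eq_integral_of_forall_compl_eq_zero]
    intro x hx; rw [hz x hx, smul_zero]
  rw [e1]
  simp only [e2, ← integral_smul_const]
  apply integral_integral_swap
  have := prod_int hm hf hμ R
  exact this.smul_bdd M (hφ.comp continuous_fst).aestronglyMeasurable (Eventually.of_forall fun z => hM z.1)

lemma weak_conv {n : ℕ} {f : Euc (n+1) → ℝ} {G : Euc (n+1) → Euc (n+1) →L[ℝ] ℝ}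
    (hm : StronglyMeasurable f) (hf : LocallyIntegrable f) (hGm : StronglyMeasurable G) (hG : LocallyIntegrable G)
    (hw : HasWeakFDerivOn univ f G) {μ : Measure ℝ} [IsProbabilityMeasure μ]
    (hμ : ∀ᵐ t ∂μ, |t| ≤ 1/2) : HasWeakFDerivOn univ (fun x => ∫ t, f (x - ax t) ∂μ) (fun x => ∫ t, G (x - ax t) ∂μ) := by
  intro φ hφ hc _
  rw [Measure.restrict_univ, conv_swap' hm hf hμ (hφ.continuous_fderiv (by simp)) (hc.fderiv (𝕜 := ℝ)),
    conv_swap hGm hG hμ hφ.continuous hc, ← integral_neg]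
  congr 1
  ext1 t
  have h1 : ∫ x, f (x - ax t) • fderiv ℝ φ x = ∫ x, f x • fderiv ℝ (fun y => φ (y + ax t)) x := by
    rw [← integral_sub_right_eq_self (fun x => f x • fderiv ℝ (fun y => φ (y + ax t)) x) (ax t : Euc (n+1))]
    congr 1
    ext1 x
    rw [fderiv_comp_add_right, sub_add_cancel]
  have h2 : ∫ x, φ x • G (x - ax t) = ∫ x, φ (x + ax t) • G x := by
    rw [← integral_sub_right_eq_self (fun x => φ (x + ax t) • G x) (ax t : Euc (n+1))]
    congr 1
    ext1 x
    rw [sub_add_cancel]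
  rw [h1, h2]
  have := hw (fun y => φ (y + ax t)) (hφ.comp (contDiff_id.add contDiff_const))
    (hc.comp_homeomorph (Homeomorph.addRight (ax t))) (subset_univ _)
  rwa [Measure.restrict_univ] at this

lemma uu_weak {n : ℕ} (hn : 1 ≤ n) {θ : ℝ → ℝ} (h : Prof θ) {μ : Measure ℝ} [IsProbabilityMeasure μ]
    (hμ : ∀ᵐ t ∂μ, |t| ≤ 1/2) : HasWeakFDerivOn univ (uu θ μ : Euc (n+1) → ℝ) (GG θ μ) :=
  weak_conv (uD_meas h).stronglyMeasurable (ue_locint h) (DUe_meas h 0) (DUe_locint hn h 0) (uD_weak hn h) hμ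

lemma uu_locint {n : ℕ} {θ : ℝ → ℝ} (h : Prof θ) {μ : Measure ℝ} [IsProbabilityMeasure μ]
    (hμ : ∀ᵐ t ∂μ, |t| ≤ 1/2) : LocallyIntegrable (uu θ μ : Euc (n+1) → ℝ) :=
  conv_locint (uD_meas h).stronglyMeasurable (ue_locint h) hμ

lemma GG_locint {n : ℕ} (hn : 1 ≤ n) {θ : ℝ → ℝ} (h : Prof θ) {μ : Measure ℝ} [IsProbabilityMeasure μ]
    (hμ : ∀ᵐ t ∂μ, |t| ≤ 1/2) : LocallyIntegrable (GG θ μ : Euc (n+1) → Euc (n+1) →L[ℝ] ℝ) :=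
  conv_locint (DUe_meas h 0) (DUe_locint hn h 0) hμ

lemma GG_supp {n : ℕ} {θ : ℝ → ℝ} (h : Prof θ) {μ : Measure ℝ} {S : Set ℝ}
    (hμ : ∀ᵐ t ∂μ, t ∈ S) {x : Euc (n+1)} (hx : GG θ μ x ≠ 0) :
    ∃ t ∈ S, 0 < ‖frontC x‖ ∧ ‖frontC x‖ / 4 ≤ |lastC x - t| ∧ |lastC x - t| ≤ ‖frontC x‖ / 2 := by
  by_contra hc
  push Not at hc
  apply hx
  unfold GG
  apply integral_eq_zero_of_ae
  filter_upwards [hμ] with t ht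
  by_contra h0
  have := DUe_supp h h0
  rw [rho_zero, front_sub, front_ax, sub_zero, last_sub, last_ax] at this
  exact absurd this.2.2 (not_le.2 (hc t ht this.1 this.2.1))

lemma GG_le {n : ℕ} {θ : ℝ → ℝ} (h : Prof θ) (μ : Measure ℝ) (x : Euc (n+1)) :
    ‖GG θ μ x‖ₑ ≤ ENNReal.ofReal (9 * ‖frontC x‖⁻¹) * μ (closedBall (lastC x) (‖frontC x‖ / 2)) := by
  unfold GG
  refine (enorm_integral_le_lintegral_enorm _).trans ?_
  rw [← lintegral_indicator_const measurableSet_closedBall]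
  refine lintegral_mono fun t => ?_
  by_cases hx : DUe θ 0 (x - ax t) = 0
  · rw [hx, ← ofReal_norm, norm_zero, ENNReal.ofReal_zero]; exact zero_le
  · have h1 := DUe_supp h hx
    have h2 := DUe_le h 0 (x - ax t)
    rw [rho_zero, front_sub, front_ax, sub_zero, last_sub, last_ax] at h1
    rw [rho_zero, front_sub, front_ax, sub_zero] at h2
    rw [indicator_of_mem]
    · rw [← ofReal_norm]; exact ENNReal.ofReal_le_ofReal h2
    · rw [mem_closedBall, dist_comm, Real.dist_eq]; exact h1.2.2

lemma uu_far {n : ℕ} {θ : ℝ → ℝ} (h : Prof θ) {μ : Measure ℝ} [IsProbabilityMeasure μ]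
    (hμ : ∀ᵐ t ∂μ, |t| ≤ 1/2) {s : ℝ} (hs : s = 1 ∨ s = -1) {x : Euc (n+1)} (hx : ‖x - ax (s * (3/2))‖ ≤ 1/4) :
    uu θ μ x = 1/2 * s := by
  have h1 := (norm_front_le _).trans hx
  have h2 := (abs_last_le _).trans hx
  rw [front_sub, front_ax, sub_zero] at h1
  rw [last_sub, last_ax] at h2
  have h3 : ∀ t : ℝ, |t| ≤ 1/2 → uD θ (x - ax t) = 1/2 * s := by
    intro t ht
    rw [uD_far h]
    · congr 1
      rw [last_sub, last_ax]
      rw [abs_le] at ht h2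
      rcases hs with rfl | rfl
      · rw [Real.sign_of_pos]; linarith
      · rw [Real.sign_of_neg]; linarith
    · rw [front_sub, front_ax, sub_zero, last_sub, last_ax]
      refine h1.trans ?_
      rw [le_abs]
      rw [abs_le] at ht h2
      rcases hs with rfl | rfl
      · left; linarith
      · right; linarith
  unfold uu
  rw [integral_congr_ae (g := fun _ => 1/2 * s)]
  · simp
  · filter_upwards [hμ] with t ht using h3 t ht

lemma H_int {n : ℕ} (μ : Measure ℝ) [IsProbabilityMeasure μ] (r : ℝ) (hr : 0 ≤ r) :
    Measurable (fun x : Euc (n+1) => μ {t | ‖x - ax t‖ ≤ r}) ∧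
    ∫⁻ x : Euc (n+1), μ {t | ‖x - ax t‖ ≤ r} = ENNReal.ofReal (r ^ (n+1)) * volume (ball (0 : Euc (n+1)) 1) := by
  have hc : Continuous (fun z : Euc (n+1) × ℝ => ‖z.1 - ax z.2‖) := sub_ax_cont.norm
  have hS : MeasurableSet {z : Euc (n+1) × ℝ | ‖z.1 - ax z.2‖ ≤ r} := (isClosed_le hc continuous_const).measurableSet
  constructor
  · exact measurable_measure_prodMk_left hS
  · have h1 := Measure.prod_apply (μ := (volume : Measure (Euc (n+1)))) (ν := μ) hS
    have h2 := Measure.prod_apply_symm (μ := (volume : Measure (Euc (n+1)))) (ν := μ) hS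
    rw [h1] at h2
    have h3 : ∀ t : ℝ, volume ((fun x : Euc (n+1) => (x, t)) ⁻¹' {z : Euc (n+1) × ℝ | ‖z.1 - ax z.2‖ ≤ r}) =
        ENNReal.ofReal (r ^ (n+1)) * volume (ball (0 : Euc (n+1)) 1) := by
      intro t
      have := Measure.addHaar_closedBall (volume : Measure (Euc (n+1))) (ax t) hr
      rw [finrank_euclideanSpace_fin] at this
      rw [← this]
      congr 1
    simp only [h3] at h2
    rw [lintegral_const, measure_univ, mul_one] at h2
    exact h2

lemma shell_exists {ρ : ℕ → ℝ} (h : Tendsto ρ atTop (𝓝 0)) {r : ℝ} (hr : 0 < r) (h0 : r ≤ ρ 0) :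
    ∃ j, ρ (j+1) < r ∧ r ≤ ρ j := by
  by_contra hc
  push Not at hc
  have : ∀ j, r ≤ ρ j := by
    intro j
    induction j with
    | zero => exact h0
    | succ j ih =>
      by_contra h1
      exact absurd ih (not_le.2 (hc j (not_le.1 h1)))
  have := ge_of_tendsto' h this
  linarith

lemma shell_bound {lam gam p X A : ℝ} {n N j : ℕ} (hlam : 0 < lam) (hX : 0 < X) (hA : 0 < A)
    (hlp : lam ^ (p - (n+1)) = (1/2:ℝ) ^ (p-1)) {lj : ℝ} (hlj : lj = lam ^ j * X ^ gam) :
    (A / lj) ^ p * ((1/2:ℝ)^j) ^ (p-1) * lj ^ (n+1) = A ^ p * X ^ (-(gam * (p - (n+1)))) := by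
  have hlj0 : 0 < lj := by rw [hlj]; positivity
  rw [Real.div_rpow hA.le hlj0.le]
  have h1 : lj ^ p = lj ^ (p - (n+1)) * lj ^ (n+1) := by
    rw [← Real.rpow_natCast, ← Real.rpow_add hlj0]; congr 1; push_cast; ring
  have h2 : lj ^ (p - (n+1)) = ((1/2:ℝ)^j) ^ (p-1) * X ^ (gam * (p - (n+1))) := by
    rw [hlj, Real.mul_rpow (by positivity) (by positivity), ← Real.rpow_natCast, ← Real.rpow_mul hlam.le, mul_comm (j:ℝ),
      Real.rpow_mul hlam.le, hlp, ← Real.rpow_mul hX.le, ← Real.rpow_natCast (1/2) j, ← Real.rpow_mul (by norm_num), ← Real.rpow_mul (by norm_num),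
      mul_comm (j:ℝ)]
  rw [h1, h2, Real.rpow_neg hX.le]
  have : 0 < ((1/2:ℝ)^j) ^ (p-1) := by positivity
  have : 0 < X ^ (gam * (p - (n+1))) := by positivity
  field_simp

lemma energy_fin {n N : ℕ} {lam lp gam p : ℝ} {l : ℕ → ℝ} (hN : 1 ≤ N) (h : CD lam lp l)
    (hl : l = fun j : ℕ => lam ^ j * (((j : ℝ) + N) / N) ^ gam) (hp : (n:ℝ) + 1 < p)
    (hlp : lam ^ (p - (n+1)) = (1/2:ℝ) ^ (p-1)) (hg : 1 < gam * (p - (n+1))) {θ : ℝ → ℝ} (hθ : Prof θ) :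
    ∫⁻ x in Box (n+1), ‖GG θ (gCantorMeasure l) x‖ₑ ^ p < ⊤ := by
  have : IsProbabilityMeasure (gCantorMeasure l) := h.prob
  set μ := gCantorMeasure l with hμ
  have hn0 : (0:ℝ) ≤ n := Nat.cast_nonneg n
  have hp1 : 1 < p := by linarith
  set c : ℝ := (1 - 2 * lp) / 2 with hc
  have hc0 : 0 < c := by rw [hc]; linarith [h.lp_lt]
  have hlam := h.lam_pos
  set K : ℕ → ℝ := fun j => (9 / (c * l (j+1))) ^ p * ((1/2:ℝ)^j) ^ (p-1) with hK
  have hK0 : ∀ j, 0 ≤ K j := fun j => by have := h.pos (j+1); simp only [hK]; positivity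
  have hpt : ∀ x : Euc (n+1), ‖GG θ μ x‖ₑ ^ p ≤ ENNReal.ofReal ((9 / c) ^ p) +
      ∑' j, ENNReal.ofReal (K j) * μ {t | ‖x - ax t‖ ≤ 2 * (c * l j)} := by
    intro x
    have h1 := GG_le hθ μ x
    rcases (norm_nonneg (frontC x)).eq_or_lt with h0 | h0
    · rw [← h0] at h1
      simp at h1
      rw [h1, ENNReal.zero_rpow_of_pos (by linarith)]
      exact zero_le
    · by_cases h2 : ‖frontC x‖ ≤ c * l 0
      · obtain ⟨j, hj1, hj2⟩ := shell_exists (ρ := fun j => c * l j) (by simpa using h.l_tendsto.const_mul c) h0 h2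
        refine le_trans ?_ le_add_self
        refine le_trans ?_ (ENNReal.le_tsum j)
        have hlj := h.pos (j+1)
        have hlj0 := h.pos j
        set m := μ (closedBall (lastC x) (‖frontC x‖ / 2)) with hm
        have hm1 : m ≤ ENNReal.ofReal ((1/2)^j) := by
          refine (h.ball_le (j+1) _ _ ?_).trans (ENNReal.ofReal_le_ofReal ?_)
          · have := h.gp_lo j
            have : c * l j < (1 - 2 * lp) * l j := by
              apply mul_lt_mul_of_pos_right _ hlj0; rw [hc]; linarith [h.lp_lt]
            linarith
          · exact pow_le_pow_of_le_one (by norm_num) (by norm_num) (Nat.le_succ j)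
        have hm2 : m ≤ μ {t | ‖x - ax t‖ ≤ 2 * (c * l j)} := by
          refine measure_mono fun t ht => ?_
          rw [mem_closedBall, dist_comm, Real.dist_eq] at ht
          rw [mem_ofPred_eq]
          refine (norm_le_split _).trans ?_
          rw [front_sub, front_ax, sub_zero, last_sub, last_ax]
          linarith
        calc ‖GG θ μ x‖ₑ ^ p ≤ (ENNReal.ofReal (9 / (c * l (j+1))) * m) ^ p := by
              gcongr
              refine h1.trans ?_
              gcongr
              rw [← div_eq_mul_inv]
              gcongr
          _ = ENNReal.ofReal (9 / (c * l (j+1))) ^ p * (m ^ (p-1) * m) := by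
              rw [ENNReal.mul_rpow_of_nonneg _ _ (by linarith)]
              congr 1
              have hmt : m ≠ ⊤ := measure_ne_top _ _
              by_cases hm0 : m = 0
              · rw [hm0, ENNReal.zero_rpow_of_pos (by linarith)]; simp
              · conv_rhs => rw [← ENNReal.rpow_one m, ← ENNReal.rpow_mul, ← ENNReal.rpow_add _ _ hm0 hmt]
                congr 1; ring
          _ ≤ ENNReal.ofReal (9 / (c * l (j+1))) ^ p * (ENNReal.ofReal ((1/2)^j) ^ (p-1) * μ {t | ‖x - ax t‖ ≤ 2 * (c * l j)}) := by
              gcongr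
          _ = _ := by
              rw [ENNReal.ofReal_rpow_of_nonneg (by positivity) (by linarith), ENNReal.ofReal_rpow_of_nonneg (by positivity) (by linarith),
                ← mul_assoc, ← ENNReal.ofReal_mul (by positivity)]
      · refine le_trans ?_ le_self_add
        rw [← ENNReal.ofReal_rpow_of_nonneg (by positivity) (by linarith)]
        gcongr
        refine h1.trans ?_
        calc _ ≤ ENNReal.ofReal (9 / c) * 1 := by
              rw [h.l0, mul_one] at h2
              gcongr
              · rw [← div_eq_mul_inv]; gcongr; exact (not_le.1 h2).le
              · exact prob_le_one
          _ = _ := by rw [mul_one]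
  have hV : volume (ball (0 : Euc (n+1)) 1) ≠ ⊤ := measure_ball_lt_top.ne
  refine lt_of_le_of_lt (lintegral_mono hpt) ?_
  rw [lintegral_add_left measurable_const, ENNReal.add_lt_top]
  constructor
  · rw [lintegral_const]
    exact ENNReal.mul_lt_top ENNReal.ofReal_lt_top (by rw [Measure.restrict_apply_univ]; exact box_finite)
  · rw [lintegral_tsum fun j => ((H_int (n := n) μ (2 * (c * l j)) (by have := h.pos j; positivity)).1.const_mul _).aemeasurable]
    set B : ℝ := (9 / (c * lam)) ^ p * (2 * c) ^ (n+1) with hB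
    have hterm : ∀ j, ∫⁻ x in Box (n+1), ENNReal.ofReal (K j) * μ {t | ‖x - ax t‖ ≤ 2 * (c * l j)} ≤
        ENNReal.ofReal (B * (((j : ℝ) + N) / N) ^ (-(gam * (p - (n+1))))) * volume (ball (0 : Euc (n+1)) 1) := by
      intro j
      have hlj := h.pos (j+1)
      have hlj0 := h.pos j
      have hH := H_int (n := n) μ (2 * (c * l j)) (by positivity)
      refine (setLIntegral_le_lintegral _ _).trans ?_
      rw [lintegral_const_mul _ hH.1, hH.2, ← mul_assoc, ← ENNReal.ofReal_mul (hK0 j)]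
      gcongr ENNReal.ofReal ?_ * _
      have hX : 0 < ((j : ℝ) + N) / N := by
        have : (0:ℝ) < N := by exact_mod_cast hN
        positivity
      have := shell_bound (N := N) (A := 9 / (c * lam)) (lam := lam) hlam hX (by positivity) hlp (lj := l j) (j := j) (by rw [hl])
      rw [hB, mul_right_comm ((9 / (c * lam)) ^ p), ← this]
      simp only [hK]
      calc (9 / (c * l (j+1))) ^ p * ((1/2:ℝ)^j) ^ (p-1) * (2 * (c * l j)) ^ (n+1)
          ≤ (9 / (c * (lam * l j))) ^ p * ((1/2:ℝ)^j) ^ (p-1) * (2 * (c * l j)) ^ (n+1) := by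
            gcongr; exact h.lo j
        _ = _ := by
            rw [show 9 / (c * (lam * l j)) = 9 / (c * lam) / l j by rw [div_div, mul_assoc], ← mul_assoc 2 c, mul_pow]; ring
    refine lt_of_le_of_lt (ENNReal.tsum_le_tsum hterm) ?_
    rw [ENNReal.tsum_mul_right]
    refine ENNReal.mul_lt_top ?_ hV.lt_top
    rw [← ENNReal.ofReal_tsum_of_nonneg]
    · exact ENNReal.ofReal_lt_top
    · intro j
      have : (0:ℝ) < N := by exact_mod_cast hN
      rw [hB]
      positivity
    · refine Summable.mul_left _ ?_
      have hNpos : (0:ℝ) < N := by exact_mod_cast hN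
      have hs : Summable fun j : ℕ => (((j + N : ℕ)) : ℝ) ^ (-(gam * (p - (n+1)))) :=
        (_root_.summable_nat_add_iff (f := fun j : ℕ => (j : ℝ) ^ (-(gam * (p - (n+1))))) N).2
          (Real.summable_nat_rpow.2 (by linarith))
      have : (fun j : ℕ => (((j : ℝ) + N) / N) ^ (-(gam * (p - (n+1))))) = fun j : ℕ => (((j + N : ℕ)) : ℝ) ^ (-(gam * (p - (n+1)))) / (N:ℝ) ^ (-(gam * (p - (n+1)))) := by
        ext j
        rw [Real.div_rpow (by positivity) hNpos.le]; push_cast; rfl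
      rw [this]
      exact hs.div_const _

lemma exists_bump (m : ℕ) : ∃ C : ℝ, 0 < C ∧ ∀ r : ℝ, 0 < r → ∃ φ : Euc m → ℝ,
    ContDiff ℝ (⊤ : ℕ∞) φ ∧ tsupport φ ⊆ closedBall 0 r ∧ (∀ x, 0 ≤ φ x) ∧ ∫ x, φ x = 1 ∧
      ∀ x, |φ x| ≤ C * (r ^ m)⁻¹ := by
  have hb0 : 0 < volume.real (closedBall (0 : Euc m) (1/2)) :=
    ENNReal.toReal_pos (measure_closedBall_pos _ _ (by norm_num)).ne' measure_closedBall_lt_top.ne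
  refine ⟨(volume.real (closedBall (0 : Euc m) (1/2)))⁻¹, inv_pos.2 hb0, fun r hr => ?_⟩
  let b : ContDiffBump (0 : Euc m) := ⟨r/2, r, by linarith, by linarith⟩
  refine ⟨b.normed volume, b.contDiff_normed, ?_, fun x => b.nonneg_normed x, b.integral_normed, ?_⟩
  · rw [b.tsupport_normed_eq]
  · intro x
    rw [abs_of_nonneg (b.nonneg_normed x)]
    refine (b.normed_le_div_measure_closedBall_rIn volume x).trans (le_of_eq ?_)
    have h1 : volume.real (closedBall (0 : Euc m) b.rIn) = r ^ m * volume.real (closedBall (0 : Euc m) (1/2)) := by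
      have e1 := Measure.addHaar_closedBall_mul (volume : Measure (Euc m)) (0 : Euc m) hr.le (show (0:ℝ) ≤ 1/2 by norm_num)
      rw [finrank_euclideanSpace_fin] at e1
      have e2 : b.rIn = r * (1/2) := by show r/2 = _; ring
      rw [e2, measureReal_def, e1, ENNReal.toReal_mul, ENNReal.toReal_ofReal (by positivity), measureReal_def]
    rw [h1, one_div, mul_inv, mul_comm]

lemma LS {N : ℕ} (hN : 1 ≤ N) {lam gam e B : ℝ} (hl : 0 < lam) (hg : 0 ≤ gam) (he : 0 ≤ e) (hB : 0 < B)
    (h : B * lam ^ e < 1) : Summable fun j : ℕ => B ^ j * (lam ^ j * (((j:ℝ) + N) / N) ^ gam) ^ e := by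
  set x := B * lam ^ e with hx
  have hx0 : 0 < x := by positivity
  set m := ⌈gam * e⌉₊
  have hNp : (1:ℝ) ≤ N := by exact_mod_cast hN
  have h1 : Summable fun j : ℕ => ((j + 1 : ℕ) : ℝ) ^ m * x ^ (j + 1) :=
    (_root_.summable_nat_add_iff (f := fun j : ℕ => (j:ℝ)^m * x ^ j) 1).2
      (summable_pow_mul_geometric_of_norm_lt_one m (by rw [Real.norm_of_nonneg hx0.le]; exact h))
  refine Summable.of_nonneg_of_le (fun j => by positivity) (fun j => ?_) (h1.mul_left x⁻¹)
  have hy1 : (1:ℝ) ≤ ((j:ℝ) + N) / N := by rw [le_div_iff₀ (by linarith)]; linarith [(Nat.cast_nonneg j : (0:ℝ) ≤ j)]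
  have hy2 : ((j:ℝ) + N) / N ≤ j + 1 := by
    rw [div_le_iff₀ (by linarith)]; nlinarith [(Nat.cast_nonneg j : (0:ℝ) ≤ j)]
  have h2 : (((j:ℝ) + N) / N) ^ (gam * e) ≤ ((j:ℝ)+1) ^ m := by
    calc _ ≤ (((j:ℝ) + N) / N) ^ (m : ℝ) := Real.rpow_le_rpow_of_exponent_le hy1 (Nat.le_ceil _)
      _ = (((j:ℝ) + N) / N) ^ m := Real.rpow_natCast _ _
      _ ≤ _ := by gcongr
  calc B ^ j * (lam ^ j * (((j:ℝ) + N) / N) ^ gam) ^ e = x ^ j * (((j:ℝ) + N) / N) ^ (gam * e) := by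
        rw [Real.mul_rpow (by positivity) (by positivity), ← Real.rpow_mul (by positivity), hx, mul_pow,
          ← Real.rpow_natCast lam, ← Real.rpow_mul hl.le, ← Real.rpow_natCast (lam ^ e), ← Real.rpow_mul hl.le, mul_comm (j:ℝ) e]
        ring
    _ ≤ x ^ j * ((j:ℝ)+1) ^ m := by gcongr
    _ = _ := by push_cast; field_simp; rw [pow_succ]

lemma sum_double (F : ℕ → ℝ) (m : ℕ) : ∑ k ∈ Finset.range (2 * m), F k = ∑ k ∈ Finset.range m, (F (2*k) + F (2*k+1)) := by
  induction m with
  | zero => simp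
  | succ m ih => rw [Finset.sum_range_succ, ← ih, show 2 * (m+1) = 2*m+1+1 by ring, Finset.sum_range_succ, Finset.sum_range_succ]; ring

lemma tele {T : ℕ → ℕ → ℝ} {e : ℕ → ℝ}
    (h : ∀ j, ∑ k ∈ Finset.range (2^j), |T j k - T (j+1) (2*k) - T (j+1) (2*k+1)| ≤ e j) (J : ℕ) :
    |T 0 0| ≤ ∑ k ∈ Finset.range (2^J), |T J k| + ∑ j ∈ Finset.range J, e j := by
  induction J with
  | zero => simp
  | succ J ih =>
    rw [Finset.sum_range_succ, pow_succ, mul_comm (2^J) 2, sum_double]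
    have h1 : ∑ k ∈ Finset.range (2^J), |T J k| ≤ ∑ k ∈ Finset.range (2^J), (|T (J+1) (2*k)| + |T (J+1) (2*k+1)|) +
        ∑ k ∈ Finset.range (2^J), |T J k - T (J+1) (2*k) - T (J+1) (2*k+1)| := by
      rw [← Finset.sum_add_distrib]
      refine Finset.sum_le_sum fun k _ => ?_
      have := abs_add_three (T (J+1) (2*k)) (T (J+1) (2*k+1)) (T J k - T (J+1) (2*k) - T (J+1) (2*k+1))
      refine le_trans (le_of_eq ?_) this
      congr 1; ring
    have := h J
    linarith

lemma holder_set {m : ℕ} {q : ℝ} (hq : 1 < q) {F : Euc m → ℝ≥0∞} (hF : AEMeasurable F) (U : Set (Euc m)) :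
    ∫⁻ x in U, F x ≤ volume U ^ (1 - 1/q) * (∫⁻ x in U, F x ^ q) ^ (1/q) := by
  have hpq : q.HolderConjugate (q / (q-1)) := Real.HolderConjugate.conjExponent hq
  have := ENNReal.lintegral_mul_le_Lp_mul_Lq (volume.restrict U) hpq hF.restrict (aemeasurable_const (b := (1:ℝ≥0∞)))
  simp only [Pi.mul_apply, mul_one, ENNReal.one_rpow, lintegral_const, Measure.restrict_apply_univ, one_mul] at this
  refine this.trans (le_of_eq ?_)
  rw [mul_comm]
  congr 2
  have : q ≠ 0 := by linarith
  have : q - 1 ≠ 0 := by linarith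
  field_simp

lemma LV {m K : ℕ} {q c V Z : ℝ} (hq : 1 < q) (hc : 0 ≤ c) (hV : 0 ≤ V) (hZ : 0 ≤ Z) {F : Euc m → ℝ≥0∞} (hF : AEMeasurable F)
    {U : ℕ → Set (Euc m)} (hU : ∀ k < K, MeasurableSet (U k))
    (hd : ∀ k < K, ∀ k' < K, k ≠ k' → Disjoint (U k) (U k')) (hv : ∀ k < K, volume (U k) ≤ ENNReal.ofReal V)
    (hZ' : ∫⁻ x in ⋃ k ∈ Finset.range K, U k, F x ^ q ≤ ENNReal.ofReal Z) {X : ℕ → ℝ} (hX : ∀ k, 0 ≤ X k)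
    (hXU : ∀ k < K, ENNReal.ofReal (X k) ≤ ENNReal.ofReal c * ∫⁻ x in U k, F x) :
    ∑ k ∈ Finset.range K, X k ≤ c * (K * V) ^ (1 - 1/q) * Z ^ (1/q) := by
  have hq1 : 0 < 1/q := by positivity
  have hq2 : 0 ≤ 1 - 1/q := by rw [sub_nonneg, div_le_one (by linarith)]; exact hq.le
  rw [← ENNReal.ofReal_le_ofReal_iff (by positivity), ENNReal.ofReal_sum_of_nonneg fun k _ => hX k]
  have hd' : Set.PairwiseDisjoint (↑(Finset.range K)) U := by
    intro k hk k' hk' hne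
    exact hd k (by simpa using hk) k' (by simpa using hk') hne
  calc ∑ k ∈ Finset.range K, ENNReal.ofReal (X k) ≤ ∑ k ∈ Finset.range K, ENNReal.ofReal c * ∫⁻ x in U k, F x :=
        Finset.sum_le_sum fun k hk => hXU k (by simpa using hk)
    _ = ENNReal.ofReal c * ∫⁻ x in ⋃ k ∈ Finset.range K, U k, F x := by
        rw [← Finset.mul_sum, lintegral_biUnion_finset hd' (fun k hk => hU k (by simpa using hk))]
    _ ≤ ENNReal.ofReal c * (volume (⋃ k ∈ Finset.range K, U k) ^ (1 - 1/q) * (∫⁻ x in ⋃ k ∈ Finset.range K, U k, F x ^ q) ^ (1/q)) := by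
        gcongr; exact holder_set hq hF _
    _ ≤ ENNReal.ofReal c * (ENNReal.ofReal (K * V) ^ (1 - 1/q) * ENNReal.ofReal Z ^ (1/q)) := by
        gcongr
        calc _ ≤ ∑ k ∈ Finset.range K, volume (U k) := measure_biUnion_finset_le _ _
          _ ≤ ∑ k ∈ Finset.range K, ENNReal.ofReal V := Finset.sum_le_sum fun k hk => hv k (by simpa using hk)
          _ = _ := by
            rw [Finset.sum_const, Finset.card_range, nsmul_eq_mul, ENNReal.ofReal_mul (by positivity), ENNReal.ofReal_natCast]
    _ = _ := by
        rw [ENNReal.ofReal_rpow_of_nonneg (by positivity) hq2, ENNReal.ofReal_rpow_of_nonneg (by positivity) hq1.le,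
          mul_assoc, ENNReal.ofReal_mul hc, ENNReal.ofReal_mul (by positivity)]

lemma choose_eta {p q : ℝ} (hpq : p < q) (hq : 0 < q) (K : ℝ) : ∃ η : ℝ, 0 < η ∧ K * η ^ (p/q) ≤ η / 2 := by
  have h1 : 0 < 1 - p/q := by rw [sub_pos, div_lt_one hq]; exact hpq
  obtain ⟨η, h2, h3⟩ := (((_root_.tendsto_rpow_atTop h1).eventually_ge_atTop (2*K)).and (eventually_gt_atTop 0)).exists
  refine ⟨η, h3, ?_⟩
  have h4 : η = η ^ (1 - p/q) * η ^ (p/q) := by rw [← Real.rpow_add h3]; simp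
  have h5 : 0 < η ^ (p/q) := by positivity
  nlinarith

noncomputable def hh (l : ℕ → ℝ) (j : ℕ) : ℝ := l j / 2 + gp l j / 4

def WW {n : ℕ} (l : ℕ → ℝ) (κ : ℝ) (j k : ℕ) : Set (Euc (n+1)) :=
  {x | ‖frontC x‖ ≤ 2 * (κ * l j) ∧ |lastC x - cc l j k| ≤ hh l j + 2 * (κ * l j)}

def RR {n : ℕ} (l : ℕ → ℝ) (κ : ℝ) (j : ℕ) : Set (Euc (n+1)) :=
  {x | ‖frontC x‖ ≤ 2 * (κ * l j) ∧ ∀ t ∈ CS l, 6 * (κ * l j) ≤ |lastC x - t|}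

lemma frontC_cont {n : ℕ} : Continuous (frontC : Euc (n+1) → Euc n) := (frL n).continuous

lemma lastC_cont {n : ℕ} : Continuous (lastC : Euc (n+1) → ℝ) := (laL n).continuous

lemma ww_meas {n : ℕ} (l : ℕ → ℝ) (κ : ℝ) (j k : ℕ) : MeasurableSet (WW l κ j k : Set (Euc (n+1))) := by
  refine IsClosed.measurableSet ?_
  exact (isClosed_le frontC_cont.norm continuous_const).inter
    (isClosed_le (lastC_cont.sub continuous_const).abs continuous_const)

lemma far_closed {n : ℕ} (l : ℕ → ℝ) (a b : ℝ) :
    IsClosed {x : Euc (n+1) | ‖frontC x‖ ≤ a ∧ ∀ t ∈ CS l, b ≤ |lastC x - t|} := by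
  refine (isClosed_le frontC_cont.norm continuous_const).inter ?_
  have : {x : Euc (n+1) | ∀ t ∈ CS l, b ≤ |lastC x - t|} = ⋂ t ∈ CS l, {x : Euc (n+1) | b ≤ |lastC x - t|} := by
    ext x; simp
  change IsClosed {x : Euc (n+1) | ∀ t ∈ CS l, b ≤ |lastC x - t|}
  rw [this]
  exact isClosed_biInter fun t _ => isClosed_le continuous_const (lastC_cont.sub continuous_const).abs

lemma rr_meas {n : ℕ} (l : ℕ → ℝ) (κ : ℝ) (j : ℕ) : MeasurableSet (RR l κ j : Set (Euc (n+1))) :=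
  (far_closed l _ _).measurableSet

structure KC (lam lp : ℝ) (l : ℕ → ℝ) (κ : ℝ) : Prop extends CD lam lp l where
  kpos : 0 < κ
  kle : κ ≤ 1/32
  kgp : ∀ j, 32 * (κ * l j) ≤ gp l (j+1)

lemma KC.mk' {lam lp : ℝ} {l : ℕ → ℝ} (h : CD lam lp l) : KC lam lp l ((1 - 2 * lp)/32) where
  toCD := h
  kpos := by have := h.lp_lt; linarith
  kle := by have := h.lp_pos; linarith
  kgp j := by have := h.gp_lo j; linarith

namespace KC

lemma kgp' {lam lp : ℝ} {l : ℕ → ℝ} {κ : ℝ} (h : KC lam lp l κ) (j : ℕ) : 32 * (κ * l j) ≤ gp l j :=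
  (h.kgp j).trans (h.gp_anti j)

lemma rpos {lam lp : ℝ} {l : ℕ → ℝ} {κ : ℝ} (h : KC lam lp l κ) (j : ℕ) : 0 < κ * l j := mul_pos h.kpos (h.pos j)

lemma lam_lt {lam lp : ℝ} {l : ℕ → ℝ} {κ : ℝ} (h : KC lam lp l κ) : lam < 1/2 := by
  have h1 := h.lo 0
  have h2 := h.hi 0
  have h3 := h.lp_lt
  rw [h.l0] at h1 h2
  linarith

lemma gp_up {lam lp : ℝ} {l : ℕ → ℝ} {κ : ℝ} (h : KC lam lp l κ) (j : ℕ) : gp l j ≤ 4 / lam * l j := by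
  have h1 := h.lam_lt
  have h0 := h.lam_pos
  cases j with
  | zero =>
    rw [h.l0, mul_one, le_div_iff₀ h0]
    show 4 * lam ≤ 4
    linarith
  | succ j =>
    rw [gp_succ]
    have h2 := h.lo j
    have h3 := h.pos j
    have h4 := h.pos (j+1)
    have : l j ≤ 4 / lam * l (j+1) := by
      rw [div_mul_eq_mul_div, le_div_iff₀ h0]; linarith
    linarith

lemma ww_disj {n : ℕ} {lam lp : ℝ} {l : ℕ → ℝ} {κ : ℝ} (h : KC lam lp l κ) (j k k' : ℕ) (hk : k < 2^j) (hk' : k' < 2^j)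
    (hne : k ≠ k') : Disjoint (WW l κ j k : Set (Euc (n+1))) (WW l κ j k') := by
  rw [Set.disjoint_left]
  rintro x ⟨_, h1⟩ ⟨_, h2⟩
  have h3 := h.cc_sep' j k k' hk hk' hne
  have h4 : |cc l j k' - cc l j k| ≤ |lastC x - cc l j k| + |lastC x - cc l j k'| := by
    have := abs_add_le (lastC x - cc l j k) (cc l j k' - lastC x)
    rw [abs_sub_comm (cc l j k') (lastC x)] at this
    simpa using this
  have h5 := h.kgp' j
  have h6 := h.gp_pos j
  unfold hh at h1 h2
  linarith

lemma ww_vol {n : ℕ} {lam lp : ℝ} {l : ℕ → ℝ} {κ : ℝ} (h : KC lam lp l κ) : ∃ V : ℝ, 0 < V ∧ ∀ j k,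
    volume (WW l κ j k : Set (Euc (n+1))) ≤ ENNReal.ofReal (V * l j ^ (n+1)) := by
  have hlam := h.lam_pos
  set R := 1 + 1/lam with hR
  have hb0 : 0 < volume.real (ball (0 : Euc (n+1)) 1) :=
    ENNReal.toReal_pos (measure_ball_pos _ _ (by norm_num)).ne' measure_ball_lt_top.ne
  refine ⟨R ^ (n+1) * volume.real (ball (0 : Euc (n+1)) 1), by positivity, fun j k => ?_⟩
  have hj := h.pos j
  have hsub : (WW l κ j k : Set (Euc (n+1))) ⊆ closedBall (ax (cc l j k)) (R * l j) := by
    rintro x ⟨h1, h2⟩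
    rw [mem_closedBall, dist_eq_norm]
    refine (norm_le_split _).trans ?_
    rw [front_sub, front_ax, sub_zero, last_sub, last_ax]
    have h3 := h.gp_up j
    have h4 := mul_le_mul_of_nonneg_right h.kle hj.le
    unfold hh at h2
    have : R * l j = l j + 4 / lam * l j / 4 := by rw [hR]; ring
    linarith
  refine (measure_mono hsub).trans ?_
  have e1 := Measure.addHaar_closedBall (volume : Measure (Euc (n+1))) (ax (cc l j k)) (show 0 ≤ R * l j by positivity)
  rw [finrank_euclideanSpace_fin] at e1
  rw [e1, mul_right_comm, ← mul_pow, ENNReal.ofReal_mul (by positivity), measureReal_def,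
    ENNReal.ofReal_toReal measure_ball_lt_top.ne]

lemma ww_box {n : ℕ} {lam lp : ℝ} {l : ℕ → ℝ} {κ : ℝ} (h : KC lam lp l κ) {j : ℕ} (hj : 1 ≤ j) (k : ℕ) :
    (WW l κ j k : Set (Euc (n+1))) ⊆ Box (n+1) := by
  rintro x ⟨h1, h2⟩
  obtain ⟨i, rfl⟩ : ∃ i, j = i + 1 := ⟨j - 1, by omega⟩
  have h0 := h.pos (i+1)
  have h3 := h.l_le_one i
  have h4 := h.cc_abs (i+1) k
  have h5 := h.kgp' (i+1)
  have h6 := mul_le_mul_of_nonneg_right h.kle h0.le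
  have h7 := h.l_le_one (i+1)
  unfold hh at h2
  have h9 : |lastC x| < 1 := by
    have := abs_add_le (lastC x - cc l (i+1) k) (cc l (i+1) k)
    rw [sub_add_cancel] at this
    rw [gp_succ] at *
    linarith
  intro m
  refine Fin.lastCases ?_ (fun m => ?_) m
  · exact h9
  · have : |frontC x m| ≤ ‖frontC x‖ := PiLp.norm_apply_le (frontC x) m
    have e : frontC x m = x m.castSucc := rfl
    rw [e] at this
    linarith

def PP (l : ℕ → ℝ) (j k : ℕ) (s : ℝ) : Prop := |s - cc l j k| ≤ gp l (j+1) / 4 ∨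
      (l j / 2 + gp l (j+1) / 4 ≤ |s - cc l j k| ∧ |s - cc l j k| ≤ l j / 2 + gp l j / 4)

lemma path_sub {n : ℕ} {lam lp : ℝ} {l : ℕ → ℝ} {κ : ℝ} (h : KC lam lp l κ) {j k : ℕ} (hk : k < 2^j) {s : ℝ}
    (hs : PP l j k s) : closedBall (ax s : Euc (n+1)) (2 * (κ * l j)) ⊆ WW l κ j k ∩ RR l κ j := by
  intro x hx
  rw [mem_closedBall, dist_eq_norm] at hx
  have h1 := (norm_front_le _).trans hx
  have h2 := (abs_last_le _).trans hx
  rw [front_sub, front_ax, sub_zero] at h1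
  rw [last_sub, last_ax] at h2
  refine ⟨⟨h1, ?_⟩, h1, fun t ht => ?_⟩
  · have h3 : |s - cc l j k| ≤ hh l j := by
      have := h.gp_anti j
      have := h.pos j
      unfold hh
      rcases hs with hs | hs <;> linarith [h.gp_pos (j+1)]
    have := abs_add_le (lastC x - s) (s - cc l j k)
    rw [sub_add_sub_cancel] at this
    linarith
  · have h3 := h.far ht hk hs
    have h4 := h.kgp j
    have := abs_add_le (s - lastC x) (lastC x - t)
    rw [sub_add_sub_cancel, abs_sub_comm s (lastC x)] at this
    linarith

end KC

structure Bumps (n : ℕ) (l : ℕ → ℝ) (κ C : ℝ) (φ : ℕ → Euc (n+1) → ℝ) : Prop where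
  sm : ∀ j, ContDiff ℝ (⊤ : ℕ∞) (φ j)
  sp : ∀ j, tsupport (φ j) ⊆ closedBall 0 (κ * l j)
  nn : ∀ j x, 0 ≤ φ j x
  one : ∀ j, ∫ x, φ j x = 1
  bd : ∀ j x, |φ j x| ≤ C * ((κ * l j) ^ (n+1))⁻¹

noncomputable def TT {n : ℕ} (f : Euc (n+1) → ℝ) (φ : ℕ → Euc (n+1) → ℝ) (l : ℕ → ℝ) (j k : ℕ) : ℝ :=
  Avg f (φ j) (ax (cc l j k + hh l j)) - Avg f (φ j) (ax (cc l j k - hh l j))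

lemma ax_smul {n : ℕ} (c t : ℝ) : c • (ax t : Euc (n+1)) = ax (c * t) := by
  apply euc_ext
  · rw [← frL_apply, map_smul, frL_apply, front_ax, front_ax, smul_zero]
  · rw [← laL_apply, map_smul, laL_apply, last_ax, last_ax, smul_eq_mul]

lemma ax_add {n : ℕ} (s t : ℝ) : (ax s : Euc (n+1)) + ax t = ax (s + t) := by
  apply euc_ext
  · rw [front_add, front_ax, front_ax, front_ax, add_zero]
  · rw [last_add, last_ax, last_ax, last_ax]

lemma avg_seg {n : ℕ} {f : Euc (n+1) → ℝ} {G : Euc (n+1) → Euc (n+1) →L[ℝ] ℝ}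
    (hf : LocallyIntegrable f) (hG : HasWeakFDerivOn univ f G) (hGi : LocallyIntegrable G)
    {φ : Euc (n+1) → ℝ} {ρ M L : ℝ} (hφ : ContDiff ℝ (⊤ : ℕ∞) φ) (hs : tsupport φ ⊆ closedBall 0 ρ)
    (hM : ∀ x, |φ x| ≤ M) (hM0 : 0 ≤ M) (s s' : ℝ) (hL : |s' - s| ≤ L) (K : Set (Euc (n+1))) (hKm : MeasurableSet K)
    (hK : ∀ τ ∈ Icc (0:ℝ) 1, closedBall (ax (s + τ * (s' - s))) ρ ⊆ K) :
    ENNReal.ofReal |Avg f φ (ax s') - Avg f φ (ax s)| ≤ ENNReal.ofReal (L * M) * ∫⁻ x in K, ‖G x‖ₑ := by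
  have := avg_translate hf hG hφ hs hGi hM hM0 (ax s) (ax (s' - s)) K hKm (fun τ hτ => by
    rw [ax_smul, ax_add]; exact hK τ hτ)
  rw [ax_add, ax_norm, show s + (s' - s) = s' by ring] at this
  refine this.trans ?_
  gcongr

lemma seg_between {s s' a b τ : ℝ} (h1 : a ≤ s) (h2 : s ≤ b) (h3 : a ≤ s') (h4 : s' ≤ b) (hτ : τ ∈ Icc (0:ℝ) 1) :
    a ≤ s + τ * (s' - s) ∧ s + τ * (s' - s) ≤ b := by
  obtain ⟨h5, h6⟩ := hτ
  constructor <;> nlinarith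

lemma five {a b c d e : ℝ} {m : ℝ≥0∞} (ha : ENNReal.ofReal |a| ≤ m) (hb : ENNReal.ofReal |b| ≤ m) (hc : ENNReal.ofReal |c| ≤ m)
    (hd : ENNReal.ofReal |d| ≤ m) (he : ENNReal.ofReal |e| ≤ m) : ENNReal.ofReal |a + b + c + d + e| ≤ 5 * m := by
  have h1 : |a+b+c+d+e| ≤ |a|+|b|+|c|+|d|+|e| := by
    have := abs_add_le (a+b+c+d) e
    have := abs_add_le (a+b+c) d
    have := abs_add_three a b c
    linarith
  calc _ ≤ ENNReal.ofReal (|a|+|b|+|c|+|d|+|e|) := ENNReal.ofReal_le_ofReal h1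
    _ = ENNReal.ofReal |a| + ENNReal.ofReal |b| + ENNReal.ofReal |c| + ENNReal.ofReal |d| + ENNReal.ofReal |e| := by
      rw [ENNReal.ofReal_add (by positivity) (by positivity), ENNReal.ofReal_add (by positivity) (by positivity),
        ENNReal.ofReal_add (by positivity) (by positivity), ENNReal.ofReal_add (by positivity) (by positivity)]
    _ ≤ m + m + m + m + m := by gcongr
    _ = 5 * m := by ring

lemma cc_even (l : ℕ → ℝ) (j k : ℕ) : cc l (j+1) (2*k) = cc l j k - (l j - l (j+1)) / 2 := by
  have h1 : 2 * k / 2 = k := by omega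
  have h2 : ¬ (2 * k % 2 = 1) := by omega
  simp only [cc, h1, h2, if_false]; ring

lemma cc_odd (l : ℕ → ℝ) (j k : ℕ) : cc l (j+1) (2*k+1) = cc l j k + (l j - l (j+1)) / 2 := by
  have h1 : (2 * k + 1) / 2 = k := by omega
  have h2 : (2 * k + 1) % 2 = 1 := by omega
  simp only [cc, h1, h2, if_true]; ring

lemma E_bound {n : ℕ} {lam lp : ℝ} {l : ℕ → ℝ} {κ C : ℝ} (h : KC lam lp l κ) (hC : 0 < C) {φ : ℕ → Euc (n+1) → ℝ}
    (hb : Bumps n l κ C φ) : ∃ C1 : ℝ, 0 < C1 ∧ ∀ {f : Euc (n+1) → ℝ} {G : Euc (n+1) → Euc (n+1) →L[ℝ] ℝ}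
      (_ : LocallyIntegrable f) (_ : HasWeakFDerivOn univ f G) (_ : LocallyIntegrable G) (j k : ℕ) (_ : k < 2^j),
      ENNReal.ofReal |TT f φ l j k - TT f φ l (j+1) (2*k) - TT f φ l (j+1) (2*k+1)| ≤
        ENNReal.ofReal (C1 * (l j ^ n)⁻¹) * ∫⁻ x in WW l κ j k ∩ RR l κ j, ‖G x‖ₑ := by
  have hlam := h.lam_pos
  have hlt := h.lam_lt
  have hκ := h.kpos
  refine ⟨20 / lam * C * ((κ * lam) ^ (n+1))⁻¹, by positivity, fun {f G} hf hG hGi j k hk => ?_⟩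
  set c := cc l j k with hc
  have hlj := h.pos j
  have hlj1 := h.pos (j+1)
  have hr := h.rpos j
  have hr1 := h.rpos (j+1)
  have hr2 : κ * l (j+1) ≤ κ * l j := by have := h.l_le j; gcongr
  set M := C * ((κ * (lam * l j)) ^ (n+1))⁻¹ with hM
  have hM0 : 0 ≤ M := by positivity
  have hM1 : ∀ x, |φ j x| ≤ M := fun x => (hb.bd j x).trans (by
    rw [hM]; gcongr; nlinarith)
  have hM2 : ∀ x, |φ (j+1) x| ≤ M := fun x => (hb.bd (j+1) x).trans (by
    rw [hM]; gcongr; exact h.lo j)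
  have hs2 : tsupport (φ (j+1)) ⊆ closedBall 0 (κ * l j) := (hb.sp (j+1)).trans (closedBall_subset_closedBall hr2)
  set L := 4 / lam * l j with hL
  set K : Set (Euc (n+1)) := WW l κ j k ∩ RR l κ j with hK
  have hKm : MeasurableSet K := (ww_meas l κ j k).inter (rr_meas l κ j)
  have hg1 := h.gp_up j
  have hg2 := h.gp_anti j
  have hg3 := h.gp_pos (j+1)
  have hgs := gp_succ l j
  have hL1 : l j ≤ L := by
    rw [hL, div_mul_eq_mul_div, le_div_iff₀ hlam]; nlinarith
  have hkr : κ * l j ≤ 1/32 * l j := by have := h.kle; gcongr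
  have hsub : ∀ s, KC.PP l j k s → closedBall (ax s : Euc (n+1)) (κ * l j) ⊆ K := fun s hs =>
    (closedBall_subset_closedBall (by linarith)).trans (h.path_sub hk hs)
  have hscale : ∀ s, KC.PP l j k s → ENNReal.ofReal |Avg f (φ j) (ax s) - Avg f (φ (j+1)) (ax s)| ≤
      ENNReal.ofReal (L * M) * ∫⁻ x in K, ‖G x‖ₑ := by
    intro s hs
    refine (avg_scale hf hG (hb.sm j) (hb.sp j) hGi hM1 hM0 (hb.nn j) (hb.one j) (hb.sm (j+1)) hs2 (hb.nn (j+1))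
      (hb.one (j+1)) hM2 hr.le (ax s) K hKm (h.path_sub hk hs)).trans ?_
    gcongr
    linarith
  have hseg : ∀ s s', |s' - s| ≤ L → (∀ τ ∈ Icc (0:ℝ) 1, KC.PP l j k (s + τ * (s' - s))) →
      ENNReal.ofReal |Avg f (φ (j+1)) (ax s') - Avg f (φ (j+1)) (ax s)| ≤
      ENNReal.ofReal (L * M) * ∫⁻ x in K, ‖G x‖ₑ := fun s s' hd hp =>
    avg_seg hf hG hGi (hb.sm (j+1)) hs2 hM2 hM0 s s' hd K hKm (fun τ hτ => hsub _ (hp τ hτ))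
  have hp1 : KC.PP l j k (c + hh l j) := by
    right
    unfold hh
    rw [← hc, show c + (l j / 2 + gp l j / 4) - c = l j / 2 + gp l j / 4 by ring, abs_of_nonneg (by linarith)]
    constructor <;> linarith
  have hp2 : KC.PP l j k (c - hh l j) := by
    right
    unfold hh
    rw [← hc, show c - (l j / 2 + gp l j / 4) - c = -(l j / 2 + gp l j / 4) by ring, abs_neg, abs_of_nonneg (by linarith)]
    constructor <;> linarith
  set δ := (l j - l (j+1)) / 2 with hδ
  set h' := hh l (j+1) with hh'
  have e1 : δ + h' = l j / 2 + gp l (j+1) / 4 := by rw [hδ, hh']; unfold hh; ring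
  have e2 : h' - δ = - gp l (j+1) / 4 := by rw [hδ, hh', hgs]; unfold hh; rw [hgs]; ring
  have e3 : hh l j = l j / 2 + gp l j / 4 := rfl
  have t1 := hscale _ hp1
  have t5 := hscale _ hp2
  rw [abs_sub_comm] at t5
  have t2 := hseg (c + (δ + h')) (c + hh l j) (by rw [e1, e3, abs_le]; constructor <;> linarith) (by
    intro τ hτ
    have := seg_between (a := c + (l j / 2 + gp l (j+1) / 4)) (b := c + (l j / 2 + gp l j / 4)) (s := c + (δ + h')) (s' := c + hh l j)
      (by linarith) (by linarith) (by linarith) (by linarith) hτ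
    right
    rw [← hc, abs_of_nonneg (by linarith)]
    constructor <;> linarith)
  have t4 := hseg (c - hh l j) (c - (δ + h')) (by rw [e1, e3, abs_le]; constructor <;> linarith) (by
    intro τ hτ
    have := seg_between (a := c - (l j / 2 + gp l j / 4)) (b := c - (l j / 2 + gp l (j+1) / 4)) (s := c - hh l j) (s' := c - (δ + h'))
      (by linarith) (by linarith) (by linarith) (by linarith) hτ
    right
    rw [← hc, abs_of_nonpos (by linarith)]
    constructor <;> linarith)
  have t3 := hseg (c + (h' - δ)) (c - (h' - δ)) (by rw [e2, abs_le]; constructor <;> linarith) (by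
    intro τ hτ
    have := seg_between (a := c - gp l (j+1) / 4) (b := c + gp l (j+1) / 4) (s := c + (h' - δ)) (s' := c - (h' - δ))
      (by linarith) (by linarith) (by linarith) (by linarith) hτ
    left
    rw [← hc, abs_le]
    constructor <;> linarith)
  have t := five t1 t2 t3 t4 t5
  have eq : TT f φ l j k - TT f φ l (j+1) (2*k) - TT f φ l (j+1) (2*k+1) =
      Avg f (φ j) (ax (c + hh l j)) - Avg f (φ (j + 1)) (ax (c + hh l j)) +
                (Avg f (φ (j + 1)) (ax (c + hh l j)) - Avg f (φ (j + 1)) (ax (c + (δ + h')))) +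
              (Avg f (φ (j + 1)) (ax (c - (h' - δ))) - Avg f (φ (j + 1)) (ax (c + (h' - δ)))) +
            (Avg f (φ (j + 1)) (ax (c - (δ + h'))) - Avg f (φ (j + 1)) (ax (c - hh l j))) +
          (Avg f (φ (j + 1)) (ax (c - hh l j)) - Avg f (φ j) (ax (c - hh l j))) := by
    unfold TT
    rw [cc_even, cc_odd, ← hc, ← hδ, ← hh', show c - δ + h' = c + (h' - δ) by ring, show c - δ - h' = c - (δ + h') by ring,
      show c + δ + h' = c + (δ + h') by ring, show c + δ - h' = c - (h' - δ) by ring]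
    ring
  rw [eq]
  refine t.trans (le_of_eq ?_)
  rw [← mul_assoc]
  congr 1
  rw [show (5:ℝ≥0∞) = ENNReal.ofReal 5 by simp, ← ENNReal.ofReal_mul (by norm_num)]
  congr 1
  rw [hL, hM, ← mul_assoc κ lam, mul_pow, pow_succ (l j)]
  field_simp
  ring

lemma T_bound {n : ℕ} {lam lp : ℝ} {l : ℕ → ℝ} {κ C : ℝ} (h : KC lam lp l κ) (hC : 0 < C) {φ : ℕ → Euc (n+1) → ℝ}
    (hb : Bumps n l κ C φ) : ∃ C2 : ℝ, 0 < C2 ∧ ∀ {f : Euc (n+1) → ℝ} {G : Euc (n+1) → Euc (n+1) →L[ℝ] ℝ}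
      (_ : LocallyIntegrable f) (_ : HasWeakFDerivOn univ f G) (_ : LocallyIntegrable G) (j k : ℕ),
      ENNReal.ofReal |TT f φ l j k| ≤ ENNReal.ofReal (C2 * (l j ^ n)⁻¹) * ∫⁻ x in WW l κ j k, ‖G x‖ₑ := by
  have hlam := h.lam_pos
  have hκ := h.kpos
  refine ⟨(1 + 2 / lam) * C * (κ ^ (n+1))⁻¹, by positivity, fun {f G} hf hG hGi j k => ?_⟩
  have hlj := h.pos j
  have hr := h.rpos j
  have hg := h.gp_up j
  have hg0 := h.gp_pos j
  set c := cc l j k with hc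
  have e3 : hh l j = l j / 2 + gp l j / 4 := rfl
  have := avg_seg hf hG hGi (hb.sm j) (hb.sp j) (M := C * ((κ * l j) ^ (n+1))⁻¹) (L := (1 + 2 / lam) * l j)
    (hb.bd j) (by positivity) (c - hh l j) (c + hh l j)
    (by
      rw [show c + hh l j - (c - hh l j) = l j + gp l j / 2 by rw [e3]; ring, abs_of_nonneg (by linarith)]
      have : (1 + 2/lam) * l j = l j + 4 / lam * l j / 2 := by ring
      linarith) (WW l κ j k) (ww_meas l κ j k) (by
      intro τ hτ
      have := seg_between (a := c - hh l j) (b := c + hh l j) (s := c - hh l j) (s' := c + hh l j)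
        (by linarith) (by linarith) (by linarith) (by linarith) hτ
      intro x hx
      rw [mem_closedBall, dist_eq_norm] at hx
      have h1 := (norm_front_le _).trans hx
      have h2 := (abs_last_le _).trans hx
      rw [front_sub, front_ax, sub_zero] at h1
      rw [last_sub, last_ax, abs_le] at h2
      refine ⟨by linarith, ?_⟩
      rw [← hc, abs_le]
      constructor <;> linarith)
  refine this.trans (le_of_eq ?_)
  congr 2
  rw [mul_pow, pow_succ (l j)]
  field_simp

lemma T_mod {n : ℕ} {lam lp : ℝ} {l : ℕ → ℝ} {κ C : ℝ} (h : KC lam lp l κ) {φ : ℕ → Euc (n+1) → ℝ}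
    (hb : Bumps n l κ C φ) {f vbar : Euc (n+1) → ℝ} (hf : LocallyIntegrable f)
    (hv : ∀ᵐ x ∂(volume.restrict (Box (n + 1))), vbar x = f x) {ω : ℝ → ℝ}
    (hω : ∀ x ∈ Box (n + 1), ∀ y ∈ Box (n + 1), |vbar x - vbar y| ≤ ω (dist x y)) {j : ℕ} (hj : 1 ≤ j) (k : ℕ) :
    |TT f φ l j k| ≤ ω (2 * hh l j) := by
  have hr := h.rpos j
  have hh0 : 0 < hh l j := by
    have := h.pos j
    have := h.gp_pos j
    unfold hh; linarith
  set c := cc l j k with hc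
  set z : Euc (n+1) := ax (c - hh l j) with hz
  set ζ : Euc (n+1) := ax (2 * hh l j) with hζ
  have hzz : ax (c + hh l j) = z + ζ := by rw [hz, hζ, ax_add]; congr 1; ring
  have hcs := hcs_of (hb.sp j)
  have i1 : Integrable fun y => f (y + ζ) * φ j (y - z) := by
    have := (loc_mul hf ((hb.sm j).continuous.comp (continuous_id.sub continuous_const)) (hcs_shift hcs (z + ζ))).comp_add_right ζ
    simpa [Function.comp_def, add_sub_add_right_eq_sub] using this
  have i2 : Integrable fun y => f y * φ j (y - z) :=
    loc_mul hf ((hb.sm j).continuous.comp (continuous_id.sub continuous_const)) (hcs_shift hcs z)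
  have e1 : Avg f (φ j) (z + ζ) = ∫ y, f (y + ζ) * φ j (y - z) := by
    unfold Avg
    rw [← integral_add_right_eq_self _ ζ]
    simp only [add_sub_add_right_eq_sub]
  have e2 : TT f φ l j k = ∫ y, (f (y + ζ) * φ j (y - z) - f y * φ j (y - z)) := by
    rw [integral_sub i1 i2, ← e1]
    unfold TT
    rw [← hc, hzz]; rfl
  rw [ae_restrict_iff' box_measurable] at hv
  have hv2 : ∀ᵐ y : Euc (n+1), y + ζ ∈ Box (n+1) → vbar (y + ζ) = f (y + ζ) :=
    (measurePreserving_add_right (volume : Measure (Euc (n+1))) ζ).quasiMeasurePreserving.ae hv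
  have ip : Integrable fun y => φ j (y - z) :=
    ((hb.sm j).continuous.integrable_of_hasCompactSupport hcs).comp_sub_right z
  have e3 : ∫ y, ω (2 * hh l j) * φ j (y - z) = ω (2 * hh l j) := by
    rw [integral_const_mul, integral_sub_right_eq_self (φ j) z, hb.one, mul_one]
  rw [e2, ← e3, ← Real.norm_eq_abs]
  refine norm_integral_le_of_norm_le (ip.const_mul _) ?_
  filter_upwards [hv, hv2] with y h1 h2
  rw [← sub_mul, norm_mul, Real.norm_eq_abs, Real.norm_of_nonneg (hb.nn j _)]
  by_cases hy : κ * l j < ‖y - z‖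
  · rw [supp_zero (hb.sp j) hy]; simp
  · push Not at hy
    refine mul_le_mul_of_nonneg_right ?_ (hb.nn j _)
    have g1 := (norm_front_le _).trans hy
    have g2 := (abs_last_le _).trans hy
    rw [hz, front_sub, front_ax, sub_zero] at g1
    rw [hz, last_sub, last_ax, abs_le] at g2
    have m1 : y ∈ Box (n+1) := by
      refine h.ww_box hj k ⟨by linarith, ?_⟩
      rw [← hc, abs_le]; constructor <;> linarith
    have m2 : y + ζ ∈ Box (n+1) := by
      refine h.ww_box hj k ⟨by rw [front_add, hζ, front_ax, add_zero]; linarith, ?_⟩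
      rw [← hc, last_add, hζ, last_ax, abs_le]; constructor <;> linarith
    rw [← h1 m1, ← h2 m2]
    refine (hω _ m2 _ m1).trans (le_of_eq ?_)
    congr 1
    rw [dist_eq_norm, add_sub_cancel_left, hζ, ax_norm, abs_of_pos (by linarith)]

lemma weak_add_loc {m : ℕ} {u v : Euc m → ℝ} {G H : Euc m → Euc m →L[ℝ] ℝ}
    (hu : LocallyIntegrable u) (hv : LocallyIntegrable v) (hG : LocallyIntegrable G) (hH : LocallyIntegrable H)
    (h1 : HasWeakFDerivOn univ u G) (h2 : HasWeakFDerivOn univ v H) :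
    HasWeakFDerivOn univ (fun x => u x + v x) (fun x => G x + H x) := by
  intro φ hφ hc hs
  have e1 := h1 φ hφ hc hs
  have e2 := h2 φ hφ hc hs
  simp only [add_smul, smul_add]
  simp only [Measure.restrict_univ] at *
  have hd : Continuous (fderiv ℝ φ) := hφ.continuous_fderiv (by simp)
  have hdc : HasCompactSupport (fderiv ℝ φ) := hc.fderiv ℝ
  rw [integral_add (intR hu hd hdc) (intR hv hd hdc), integral_add (intL hG hφ.continuous hc) (intL hH hφ.continuous hc), e1, e2]
  abel

lemma locint_add {m : ℕ} {F : Type} [NormedAddCommGroup F] {u v : Euc m → F}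
    (hu : LocallyIntegrable u) (hv : LocallyIntegrable v) : LocallyIntegrable fun x => u x + v x := hu.add hv

lemma locint_smul {m : ℕ} {F : Type} [NormedAddCommGroup F] [NormedSpace ℝ F] {u : Euc m → F} (c : ℝ)
    (hu : LocallyIntegrable u) : LocallyIntegrable fun x => c • u x := hu.smul c

lemma locint_box {m : ℕ} {F : Type} [NormedAddCommGroup F] {u : Euc m → F}
    (hu : LocallyIntegrable u) : IntegrableOn u (Box m) :=
  (hu.integrableOn_isCompact (isCompact_closedBall 0 (m:ℝ))).mono_set box_bdd

noncomputable def extn {n : ℕ} {F : Type} [AddCommGroup F] [Module ℝ F] (η : ℝ) (u v : Euc (n+1) → F) (x : Euc (n+1)) : F :=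
  η • u x + (Box (n+1)).indicator (fun x => v x - η • u x) x

lemma ext_in {n : ℕ} {F : Type} [AddCommGroup F] [Module ℝ F] (η : ℝ) (u v : Euc (n+1) → F) {x : Euc (n+1)} (hx : x ∈ Box (n+1)) :
    extn η u v x = v x := by simp [extn, hx]

lemma ext_out {n : ℕ} {F : Type} [AddCommGroup F] [Module ℝ F] (η : ℝ) (u v : Euc (n+1) → F) {x : Euc (n+1)} (hx : x ∉ Box (n+1)) :
    extn η u v x = η • u x := by simp [extn, hx]

lemma ext_facts {n : ℕ} {η : ℝ} {u v : Euc (n+1) → ℝ} {Gu G : Euc (n+1) → Euc (n+1) →L[ℝ] ℝ}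
    (hu : LocallyIntegrable u) (hGu : LocallyIntegrable Gu) (hw : HasWeakFDerivOn univ u Gu)
    (hz : ZeroBoundary (Box (n + 1)) (fun x => v x - η * u x) (fun x => G x - η • Gu x)) :
    LocallyIntegrable (extn η u v) ∧ LocallyIntegrable (extn η Gu G) ∧ HasWeakFDerivOn univ (extn η u v) (extn η Gu G) := by
  obtain ⟨h1, h2, h3⟩ := hz
  exact ⟨locint_add (locint_smul η hu) h1.locallyIntegrable, locint_add (locint_smul η hGu) h2.locallyIntegrable,
    weak_add_loc (locint_smul η hu) h1.locallyIntegrable (locint_smul η hGu) h2.locallyIntegrable (weak_smul η hw) h3⟩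

lemma GG_rr {n : ℕ} {lam lp : ℝ} {l : ℕ → ℝ} {κ : ℝ} (h : KC lam lp l κ) {θ : ℝ → ℝ} (hθ : Prof θ) {j : ℕ}
    {x : Euc (n+1)} (hx : x ∈ RR l κ j) : GG θ (gCantorMeasure l) x = 0 := by
  by_contra hc
  obtain ⟨t, ht, h1, h2, h3⟩ := GG_supp hθ h.ae_mem hc
  have h4 := hx.1
  have h5 := hx.2 t ht
  have h6 := h.rpos j
  linarith

lemma exists_weight' {n : ℕ} {lam lp : ℝ} {l : ℕ → ℝ} {κ : ℝ} (h : KC lam lp l κ) {θ : ℝ → ℝ} (hθ : Prof θ)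
    {α α' : ℝ} (hα : 0 < α) (hα' : α < α') :
    ∃ a : Euc (n+1) → ℝ, (∀ x, 0 ≤ a x) ∧ Measurable a ∧ InHolderCls α (closure (Box (n+1))) a ∧
      (∀ j, ∀ x ∈ RR l κ j, l j ^ α' ≤ a x) ∧ ∀ x, GG θ (gCantorMeasure l) x ≠ 0 → a x = 0 := by
  obtain ⟨a, h1, h2, h3, h4, h5⟩ := exists_weight (m := n+1) hα hα' h.kpos h.pos h.l_le_pow
    (fun j => {x : Euc (n+1) | ‖frontC x‖ ≤ 3 * (κ * l j) ∧ ∀ t ∈ CS l, 5 * (κ * l j) ≤ |lastC x - t|})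
    (fun j => (far_closed l _ _).measurableSet)
  refine ⟨a, h1, h2, h3, fun j x hx => h4 j x ?_, fun x hx => h5 x fun j => ?_⟩
  · intro y hy
    rw [mem_closedBall, dist_eq_norm] at hy
    have g1 := (norm_front_le _).trans hy
    have g2 := (abs_last_le _).trans hy
    rw [front_sub] at g1
    rw [last_sub] at g2
    refine ⟨?_, fun t ht => ?_⟩
    · have := norm_add_le (frontC y - frontC x) (frontC x)
      rw [sub_add_cancel] at this
      linarith [hx.1]
    · have := abs_add_le (lastC x - lastC y) (lastC y - t)
      rw [sub_add_sub_cancel, abs_sub_comm (lastC x) (lastC y)] at this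
      linarith [hx.2 t ht]
  · obtain ⟨t, ht, e1, e2, e3⟩ := GG_supp hθ h.ae_mem hx
    rw [Set.disjoint_left]
    rintro y hy ⟨g3, g4⟩
    rw [mem_closedBall, dist_eq_norm] at hy
    have g1 := (norm_front_le _).trans hy
    have g2 := (abs_last_le _).trans hy
    rw [front_sub] at g1
    rw [last_sub] at g2
    have g5 := g4 t ht
    have f1 := norm_sub_norm_le (frontC x) (frontC y)
    rw [norm_sub_rev] at f1
    have f2 := abs_add_le (lastC y - lastC x) (lastC x - t)
    rw [sub_add_sub_cancel] at f2
    have := h.rpos j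
    linarith

lemma lev_eq {n j : ℕ} {C V Y x β q : ℝ} (hV : 0 ≤ V) (hY : 0 ≤ Y) (hx : 0 < x) (hq : 0 < q) :
    C * (x ^ n)⁻¹ * (((2^j : ℕ) : ℝ) * (V * x ^ (n+1))) ^ (1 - 1/q) * (x ^ (-β) * Y) ^ (1/q) =
      C * V ^ (1 - 1/q) * Y ^ (1/q) * (((2:ℝ) ^ (1 - 1/q)) ^ j * x ^ (1 - (n + 1 + β)/q)) := by
  have e1 : (((2^j : ℕ) : ℝ) * (V * x ^ (n+1))) ^ (1 - 1/q) = ((2:ℝ) ^ (1 - 1/q)) ^ j * (V ^ (1 - 1/q) * (x ^ (n+1)) ^ (1 - 1/q)) := by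
    push_cast
    rw [Real.mul_rpow (by positivity) (by positivity), Real.mul_rpow hV (by positivity),
      ← Real.rpow_natCast (2 : ℝ) j, ← Real.rpow_mul (by norm_num), ← Real.rpow_natCast ((2:ℝ) ^ (1 - 1/q)) j, ← Real.rpow_mul (by norm_num),
      mul_comm (j:ℝ)]
  have e2 : (x ^ (-β) * Y) ^ (1/q) = (x ^ (-β)) ^ (1/q) * Y ^ (1/q) := Real.mul_rpow (Real.rpow_nonneg hx.le _) hY
  have e : x ^ (1 - (n + 1 + β)/q) = (x ^ n)⁻¹ * (x ^ (n+1)) ^ (1 - 1/q) * (x ^ (-β)) ^ (1/q) := by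
    rw [← Real.rpow_natCast x n, ← Real.rpow_natCast x (n+1), ← Real.rpow_neg hx.le, ← Real.rpow_mul hx.le, ← Real.rpow_mul hx.le,
      ← Real.rpow_add hx, ← Real.rpow_add hx]
    congr 1
    push_cast
    field_simp
    ring
  rw [e, e1, e2]
  generalize (x ^ (-β)) ^ (1/q) = A1
  generalize (x ^ (n+1)) ^ (1 - 1/q) = A2
  generalize ((2:ℝ) ^ (1 - 1/q)) ^ j = A3
  ring

lemma exp_lt {n : ℕ} (hn : 1 ≤ n) {p β q D lam : ℝ} (hp : (n:ℝ) + 1 < p) (hβ : 0 ≤ β) (hq : p + β * (p-1) / n < q)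
    (hD : D = (p - ((n : ℝ) + 1)) / (p - 1)) (hlam : lam = 2 ^ (-1 / D)) :
    (2:ℝ) ^ (1 - 1/q) * lam ^ (1 - (n + 1 + β)/q) < 1 := by
  have hn0 : (0:ℝ) < n := by exact_mod_cast hn
  have hp1 : 0 < p - 1 := by linarith
  have hpd : 0 < p - ((n:ℝ) + 1) := by linarith
  have hq0 : 0 < q := by
    have : 0 ≤ β * (p-1) / n := by positivity
    linarith
  rw [hlam, ← Real.rpow_mul (by norm_num), ← Real.rpow_add (by norm_num)]
  apply Real.rpow_lt_one_of_one_lt_of_neg (by norm_num)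
  have h1 : p * n + β * (p-1) < q * n := by
    have : p + β * (p-1) / n = (p * n + β * (p-1)) / n := by field_simp
    rw [this, div_lt_iff₀ hn0] at hq
    exact hq
  have : 1 - 1/q + -1/D * (1 - (n + 1 + β)/q) = (p * n + β * (p-1) - q * n) / (q * (p - (n+1))) := by
    rw [hD]
    field_simp
    ring
  rw [this]
  exact div_neg_of_neg_of_pos (by linarith) (by positivity)

lemma mod_est {N j : ℕ} (hN : 1 ≤ N) {lam gam D x : ℝ} (hl : 0 < lam) (hD : 0 < D) (hg : 0 < gam) (h1 : lam ^ D = 1/2)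
    (hx : x = lam ^ j * (((j:ℝ) + N) / N) ^ gam) (hx2 : x ≤ (1/2)^j) :
    (x/2) ^ D * Real.log (Real.exp 1 + (x/2)⁻¹) ^ (-(gam * D)) ≤ 2 * Real.log 2 ^ (-(gam * D)) * (1/2)^(j+1) := by
  have hNp : (1:ℝ) ≤ N := by exact_mod_cast hN
  set y := ((j:ℝ) + N) / N with hy
  have hy1 : (1:ℝ) ≤ y := by rw [hy, le_div_iff₀ (by linarith)]; linarith [(Nat.cast_nonneg j : (0:ℝ) ≤ j)]
  have hy2 : y ≤ j + 1 := by
    rw [hy, div_le_iff₀ (by linarith)]; nlinarith [(Nat.cast_nonneg j : (0:ℝ) ≤ j)]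
  have hx0 : 0 < x := by rw [hx]; positivity
  have hl2 : 0 < Real.log 2 := Real.log_pos (by norm_num)
  have e1 : (x/2) ^ D ≤ (1/2)^j * y ^ (gam * D) := by
    calc (x/2)^D ≤ x ^ D := by gcongr; linarith
      _ = _ := by
        rw [hx, Real.mul_rpow (by positivity) (by positivity), ← Real.rpow_mul (by positivity), ← Real.rpow_natCast, ← Real.rpow_mul hl.le,
          mul_comm (j:ℝ), Real.rpow_mul hl.le, h1, Real.rpow_natCast]
  have e2 : y * Real.log 2 ≤ Real.log (Real.exp 1 + (x/2)⁻¹) := by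
    calc y * Real.log 2 ≤ (j+1) * Real.log 2 := by gcongr
      _ = Real.log (2 ^ (j+1)) := by rw [Real.log_pow]; push_cast; ring
      _ ≤ _ := by
        apply Real.log_le_log (by positivity)
        have h3 : (2:ℝ)^(j+1) ≤ (x/2)⁻¹ := by
          rw [le_inv_comm₀ (by positivity) (by positivity)]
          calc x / 2 ≤ (1/2)^j/2 := by gcongr
            _ = _ := by rw [pow_succ, one_div, inv_pow, mul_inv]; rfl
        linarith [Real.exp_pos 1]
  have e3 : Real.log (Real.exp 1 + (x/2)⁻¹) ^ (-(gam * D)) ≤ y ^ (-(gam*D)) * Real.log 2 ^ (-(gam*D)) := by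
    rw [← Real.mul_rpow (by positivity) hl2.le]
    exact Real.rpow_le_rpow_of_nonpos (by positivity) e2 (by have : 0 < gam * D := by positivity
                                                             linarith)
  calc _ ≤ ((1/2)^j * y ^ (gam * D)) * (y ^ (-(gam*D)) * Real.log 2 ^ (-(gam*D))) := by
        have : 0 ≤ Real.log (Real.exp 1 + (x/2)⁻¹) ^ (-(gam * D)) := Real.rpow_nonneg ((by positivity : 0 ≤ y * Real.log 2).trans e2) _
        gcongr
    _ = _ := by
      rw [Real.rpow_neg (by positivity) (gam * D), pow_succ]
      have : y ^ (gam * D) ≠ 0 := by positivity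
      field_simp

lemma Z_bound {n : ℕ} {lam lp : ℝ} {l : ℕ → ℝ} {κ : ℝ} (h : KC lam lp l κ) {θ : ℝ → ℝ} (hθ : Prof θ) {a : Euc (n+1) → ℝ}
    {β q η Y : ℝ} (hq : 0 < q) (ha : ∀ j, ∀ x ∈ RR l κ j, l j ^ β ≤ a x)
    {G : Euc (n+1) → Euc (n+1) →L[ℝ] ℝ} (hY : ∫⁻ x in Box (n+1), ENNReal.ofReal (a x) * ‖G x‖ₑ ^ q ≤ ENNReal.ofReal Y)
    (j : ℕ) {U : Set (Euc (n+1))} (hU : MeasurableSet U) (hUR : U ⊆ RR l κ j) :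
    ∫⁻ x in U, ‖extn η (GG θ (gCantorMeasure l)) G x‖ₑ ^ q ≤ ENNReal.ofReal (l j ^ (-β) * Y) := by
  have hlj := h.pos j
  calc ∫⁻ x in U, ‖extn η (GG θ (gCantorMeasure l)) G x‖ₑ ^ q
      ≤ ∫⁻ x in U, ENNReal.ofReal (l j ^ (-β)) * (Box (n+1)).indicator (fun x => ENNReal.ofReal (a x) * ‖G x‖ₑ ^ q) x := by
        refine setLIntegral_mono' hU fun x hx => ?_
        by_cases hB : x ∈ Box (n+1)
        · rw [ext_in η _ _ hB, indicator_of_mem hB, ← mul_assoc, ← ENNReal.ofReal_mul (by positivity)]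
          have h1 : 1 ≤ l j ^ (-β) * a x := by
            calc 1 = l j ^ (-β) * l j ^ β := by rw [← Real.rpow_add hlj]; simp
              _ ≤ _ := by gcongr; exact ha j x (hUR hx)
          calc ‖G x‖ₑ ^ q = ENNReal.ofReal 1 * ‖G x‖ₑ ^ q := by simp
            _ ≤ _ := by gcongr ENNReal.ofReal ?_ * _
        · rw [ext_out η _ _ hB, GG_rr h hθ (hUR hx), smul_zero]
          rw [← ofReal_norm, norm_zero, ENNReal.ofReal_zero, ENNReal.zero_rpow_of_pos hq]; exact zero_le
    _ ≤ ∫⁻ x, ENNReal.ofReal (l j ^ (-β)) * (Box (n+1)).indicator (fun x => ENNReal.ofReal (a x) * ‖G x‖ₑ ^ q) x :=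
        setLIntegral_le_lintegral _ _
    _ = ENNReal.ofReal (l j ^ (-β)) * ∫⁻ x in Box (n+1), ENNReal.ofReal (a x) * ‖G x‖ₑ ^ q := by
        rw [lintegral_const_mul' _ _ ENNReal.ofReal_ne_top, lintegral_indicator box_measurable]
    _ ≤ _ := by rw [ENNReal.ofReal_mul (by positivity)]; gcongr

lemma lev_sum {n : ℕ} {lam lp : ℝ} {l : ℕ → ℝ} {κ : ℝ} (h : KC lam lp l κ) {β q Y V c : ℝ} (hq : 1 < q) (hY : 0 ≤ Y) (hV : 0 ≤ V) (hc : 0 ≤ c)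
    (j : ℕ) {F : Euc (n+1) → ℝ≥0∞} (hF : AEMeasurable F) {U : ℕ → Set (Euc (n+1))} (hU : ∀ k, MeasurableSet (U k))
    (hUW : ∀ k, U k ⊆ WW l κ j k) (hv : ∀ k, volume (WW l κ j k : Set (Euc (n+1))) ≤ ENNReal.ofReal (V * l j ^ (n+1)))
    (hZ : ∫⁻ x in ⋃ k ∈ Finset.range (2^j), U k, F x ^ q ≤ ENNReal.ofReal (l j ^ (-β) * Y)) {X : ℕ → ℝ}
    (hX : ∀ k < 2^j, ENNReal.ofReal |X k| ≤ ENNReal.ofReal (c * (l j ^ n)⁻¹) * ∫⁻ x in U k, F x) :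
    ∑ k ∈ Finset.range (2^j), |X k| ≤ c * V ^ (1 - 1/q) * Y ^ (1/q) * (((2:ℝ) ^ (1 - 1/q)) ^ j * l j ^ (1 - (n + 1 + β)/q)) := by
  have hlj := h.pos j
  rw [← lev_eq (β := β) hV hY hlj (by linarith)]
  exact LV hq (by positivity) (by positivity) (by positivity) hF (fun k _ => hU k)
    (fun k hk k' hk' hne => (h.ww_disj j k k' hk hk' hne).mono (hUW k) (hUW k')) (fun k _ => (measure_mono (hUW k)).trans (hv k)) hZ
    (fun k => abs_nonneg _) hX

lemma T00 {n : ℕ} {lam lp : ℝ} {l : ℕ → ℝ} {κ C : ℝ} (h : KC lam lp l κ) {φ : ℕ → Euc (n+1) → ℝ}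
    (hb : Bumps n l κ C φ) {θ : ℝ → ℝ} (hθ : Prof θ) {η : ℝ} (v : Euc (n+1) → ℝ) :
    TT (extn η (uu θ (gCantorMeasure l)) v) φ l 0 0 = η := by
  have : IsProbabilityMeasure (gCantorMeasure l) := h.prob
  have hμ : ∀ᵐ t ∂(gCantorMeasure l), |t| ≤ 1/2 := h.ae_mem.mono fun t ht => h.CS_abs ht
  have key : ∀ s : ℝ, s = 1 ∨ s = -1 → Avg (extn η (uu θ (gCantorMeasure l)) v) (φ 0) (ax (s * (3/2))) = η * (1/2 * s) := by
    intro s hs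
    have h1 : ∀ y, extn η (uu θ (gCantorMeasure l)) v y * φ 0 (y - ax (s * (3/2))) = η * (1/2 * s) * φ 0 (y - ax (s * (3/2))) := by
      intro y
      by_cases hy : ‖y - ax (s * (3/2))‖ ≤ 1/32
      · rw [ext_out, uu_far hθ hμ hs (by linarith), smul_eq_mul]
        intro hB
        have h2 := (abs_last_le _).trans hy
        rw [last_sub, last_ax] at h2
        have h3 : |lastC y| < 1 := hB _
        rw [abs_le] at h2
        rw [abs_lt] at h3
        rcases hs with rfl | rfl <;> linarith
      · rw [supp_zero (hb.sp 0)]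
        · simp
        · rw [h.l0, mul_one]; exact lt_of_le_of_lt h.kle (not_le.1 hy)
    unfold Avg
    simp_rw [h1]
    rw [integral_const_mul, integral_sub_right_eq_self (φ 0), hb.one, mul_one]
  have e : hh l 0 = 3/2 := by simp [hh, gp, h.l0]; norm_num
  have k1 := key 1 (Or.inl rfl)
  have k2 := key (-1) (Or.inr rfl)
  unfold TT
  rw [e, show cc l 0 0 = 0 from rfl, show (0:ℝ) + 3/2 = 1 * (3/2) by ring, show (0:ℝ) - 3/2 = (-1) * (3/2) by ring, k1, k2]
  ring

lemma zero_energy {n : ℕ} {p q c : ℝ} (hp : 0 < p) (hq : 0 < q) (hc : 0 ≤ c) {a : Euc (n+1) → ℝ} {G : Euc (n+1) → Euc (n+1) →L[ℝ] ℝ}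
    (ha : ∀ x, G x ≠ 0 → a x = 0) :
    energyOf (Box (n + 1)) (fun x t => t ^ p / p + a x * t ^ q / q) (fun x => ‖c • G x‖) =
      ENNReal.ofReal (c ^ p / p) * ∫⁻ x in Box (n+1), ‖G x‖ₑ ^ p := by
  unfold energyOf
  rw [← lintegral_const_mul' _ _ ENNReal.ofReal_ne_top]
  refine lintegral_congr fun x => ?_
  have h1 : a x * ‖c • G x‖ ^ q / q = 0 := by
    by_cases hx : G x = 0
    · rw [hx, smul_zero, norm_zero, Real.zero_rpow hq.ne']; simp
    · rw [ha x hx]; simp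
  show ENNReal.ofReal (‖c • G x‖ ^ p / p + a x * ‖c • G x‖ ^ q / q) = _
  rw [h1, add_zero, norm_smul, Real.norm_of_nonneg hc, Real.mul_rpow hc (norm_nonneg _), ← ofReal_norm,
    ENNReal.ofReal_rpow_of_nonneg (norm_nonneg _) hp.le, ← ENNReal.ofReal_mul (by positivity)]
  congr 1; ring

lemma weight_le {n : ℕ} {p q : ℝ} (hp : 0 < p) (hq : 0 < q) {a : Euc (n+1) → ℝ} (ha : ∀ x, 0 ≤ a x) (G : Euc (n+1) → Euc (n+1) →L[ℝ] ℝ) :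
    ∫⁻ x in Box (n+1), ENNReal.ofReal (a x) * ‖G x‖ₑ ^ q ≤
      ENNReal.ofReal q * energyOf (Box (n + 1)) (fun x t => t ^ p / p + a x * t ^ q / q) (fun x => ‖G x‖) := by
  unfold energyOf
  rw [← lintegral_const_mul' _ _ ENNReal.ofReal_ne_top]
  refine lintegral_mono fun x => ?_
  show ENNReal.ofReal (a x) * ‖G x‖ₑ ^ q ≤ ENNReal.ofReal q * ENNReal.ofReal (‖G x‖ ^ p / p + a x * ‖G x‖ ^ q / q)
  rw [← ofReal_norm, ENNReal.ofReal_rpow_of_nonneg (norm_nonneg _) hq.le, ← ENNReal.ofReal_mul (ha x), ← ENNReal.ofReal_mul hq.le]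
  refine ENNReal.ofReal_le_ofReal ?_
  rw [mul_add, mul_div_cancel₀ _ hq.ne']
  have : 0 ≤ q * (‖G x‖ ^ p / p) := by positivity
  linarith

lemma no_int {n : ℕ} {lam lp : ℝ} {l : ℕ → ℝ} {κ C : ℝ} (h : KC lam lp l κ) (hC : 0 < C) {φ : ℕ → Euc (n+1) → ℝ}
    (hb : Bumps n l κ C φ) {f : Euc (n+1) → ℝ} {H G : Euc (n+1) → Euc (n+1) →L[ℝ] ℝ} (hf : LocallyIntegrable f)
    (hH : LocallyIntegrable H) (hw : HasWeakFDerivOn univ f H) (hHG : ∀ x ∈ Box (n+1), H x = G x) {s η : ℝ} (hη : 0 < η) (hs : 1 < s)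
    (hsum : Summable fun j : ℕ => ((2:ℝ) ^ (1 - 1/s)) ^ j * l j ^ (1 - ((n:ℝ) + 1 + 0)/s))
    (hT : ∀ J, η / 2 ≤ ∑ k ∈ Finset.range (2^J), |TT f φ l J k|) :
    ¬ MemLp (fun x => ‖G x‖) (ENNReal.ofReal s) (volume.restrict (Box (n + 1))) := by
  intro hm
  obtain ⟨V, hV, hv⟩ := h.ww_vol (n := n)
  obtain ⟨C2, hC2, hTb⟩ := T_bound h hC hb
  have hfin : ∫⁻ x in Box (n+1), ‖G x‖ₑ ^ s < ⊤ := by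
    have h1 := hm.eLpNorm_lt_top
    rw [eLpNorm_lt_top_iff_lintegral_rpow_enorm_lt_top (by simp; linarith) ENNReal.ofReal_ne_top,
      ENNReal.toReal_ofReal (by linarith)] at h1
    simpa using h1
  set Y := (∫⁻ x in Box (n+1), ‖G x‖ₑ ^ s).toReal with hY
  have hYe : ∫⁻ x in Box (n+1), ‖G x‖ₑ ^ s = ENNReal.ofReal Y := (ENNReal.ofReal_toReal hfin.ne).symm
  have hlim := (hsum.tendsto_atTop_zero).const_mul (C2 * V ^ (1 - 1/s) * Y ^ (1/s))
  rw [mul_zero] at hlim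
  obtain ⟨J, hJ1, hJ2⟩ := ((hlim.eventually_lt_const (half_pos hη)).and (eventually_ge_atTop 1)).exists
  refine absurd (hT J) (not_le.2 (lt_of_le_of_lt ?_ hJ1))
  refine lev_sum (β := 0) h hs ENNReal.toReal_nonneg hV.le hC2.le J (F := fun x => ‖H x‖ₑ) hH.aestronglyMeasurable.enorm
    (U := fun k => WW l κ J k) (fun k => ww_meas l κ J k) (fun k => subset_rfl) (fun k => hv J k) ?_ (fun k _ => hTb hf hw hH J k)
  rw [neg_zero, Real.rpow_zero, one_mul, ← hYe]
  have hsub : (⋃ k ∈ Finset.range (2^J), (WW l κ J k : Set (Euc (n+1)))) ⊆ Box (n+1) :=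
    iUnion₂_subset fun k _ => h.ww_box hJ2 k
  refine (lintegral_mono_set hsub).trans (le_of_eq ?_)
  exact setLIntegral_congr_fun box_measurable fun x hx => by simp only [hHG x hx]

lemma no_mod {n N : ℕ} {lam lp : ℝ} {l : ℕ → ℝ} {κ C : ℝ} (h : KC lam lp l κ) {φ : ℕ → Euc (n+1) → ℝ}
    (hb : Bumps n l κ C φ) {f v : Euc (n+1) → ℝ} (hf : LocallyIntegrable f) (hfv : ∀ x ∈ Box (n+1), f x = v x) {gam D η : ℝ}
    (hN : 1 ≤ N) (hD : 0 < D) (hg : 0 < gam) (h1 : lam ^ D = 1/2) (hl : l = fun j : ℕ => lam ^ j * (((j : ℝ) + N) / N) ^ gam)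
    (hη : 0 < η) (hT : ∀ J, η / 2 ≤ ∑ k ∈ Finset.range (2^J), |TT f φ l J k|) (ω₁ : ℝ → ℝ)
    (hω : Tendsto (fun t : ℝ => ω₁ t / (t ^ D * Real.log (Real.exp 1 + t⁻¹) ^ (-(gam * D)))) (𝓝[>] (0 : ℝ)) (𝓝 0)) :
    ¬ ∃ vbar : Euc (n + 1) → ℝ, (∀ᵐ x ∂(volume.restrict (Box (n + 1))), vbar x = v x) ∧
        ∀ x ∈ Box (n + 1), ∀ y ∈ Box (n + 1), |vbar x - vbar y| ≤ ω₁ (dist x y) := by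
  rintro ⟨vbar, hv1, hv2⟩
  have hv1' : ∀ᵐ x ∂(volume.restrict (Box (n + 1))), vbar x = f x := by
    filter_upwards [hv1, ae_restrict_mem box_measurable] with x h2 h3
    rw [h2, hfv x h3]
  set M := 2 * Real.log 2 ^ (-(gam * D)) with hM
  have hM0 : 0 < M := by have := Real.log_pos (by norm_num : (1:ℝ) < 2); positivity
  have ht : Tendsto (fun j => l j / 2) atTop (𝓝[>] 0) := by
    rw [tendsto_nhdsWithin_iff]
    refine ⟨by simpa using h.l_tendsto.div_const 2, Eventually.of_forall fun j => ?_⟩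
    exact half_pos (h.pos j)
  obtain ⟨j, hj⟩ := ((hω.comp ht).eventually_lt_const (show 0 < η / (4 * M) by positivity)).exists
  have hlj := h.pos j
  simp only [Function.comp] at hj
  have hlog : 0 < Real.log (Real.exp 1 + (l j / 2)⁻¹) := by
    apply Real.log_pos
    have := Real.add_one_lt_exp (one_ne_zero)
    have : 0 < (l j / 2)⁻¹ := by positivity
    linarith
  rw [div_lt_iff₀ (by positivity)] at hj
  have hme := mod_est hN h.lam_pos hD hg h1 (x := l j) (j := j) (by rw [hl]) (h.l_le_pow j)
  have hhj : 2 * hh l (j+1) = l j / 2 := by simp only [hh, gp]; ring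
  have hb2 : ω₁ (l j / 2) < η / 2 * (1/2)^(j+1) := by
    calc _ < _ := hj
      _ ≤ η / (4 * M) * (M * (1/2)^(j+1)) := by gcongr
      _ = η / 4 * (1/2)^(j+1) := by field_simp
      _ < _ := by gcongr; linarith
  have h3 : ∑ k ∈ Finset.range (2^(j+1)), |TT f φ l (j+1) k| ≤ 2^(j+1) * ω₁ (l j / 2) := by
    calc _ ≤ ∑ k ∈ Finset.range (2^(j+1)), ω₁ (l j / 2) := Finset.sum_le_sum fun k _ => by
          rw [← hhj]; exact T_mod h hb hf hv1' hv2 (by omega) k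
      _ = _ := by simp
  have h4 : (2:ℝ)^(j+1) * ω₁ (l j / 2) < 2^(j+1) * (η / 2 * (1/2)^(j+1)) := by gcongr
  have h5 : (2:ℝ)^(j+1) * (η / 2 * (1/2)^(j+1)) = η / 2 := by
    rw [one_div, inv_pow]; field_simp
  linarith [hT (j+1)]

/-- **superdimensional double phase minimizer.** For `p > d`, `α > 0`,
`q > p + α(p−1)/(d−1)`, `𝔇 = (p−d)/(p−1)`, `λ = 2^{−1/𝔇}` and `γ > 1/(𝔇(p−1))`, there are a
nonnegative Hölder weight `a ∈ C^α(Ω̄)`, a boundary datum `η u` (`u` the superdimensional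
competitor built from the `(λ,γ)`-Cantor measure), and a minimizer `v` of the double phase
functional among Sobolev functions with the same boundary values, such that `∇v ∉ L^s(Ω)`
for any `s > p`, and no representative of `v` admits a modulus of continuity `ω₁` with
`ω₁(ρ) = o(ρ^𝔇 (log(e+ρ⁻¹))^{−γ𝔇})` as `ρ → 0` (here `d = n+1 ≥ 2`). -/
theorem double_phase_super_singular_minimizer
    {n : ℕ} (hn : 1 ≤ n) (p α q gam D lam : ℝ) (hp : (n : ℝ) + 1 < p) (hα : 0 < α)
    (hq : p + α * (p - 1) / (n : ℝ) < q)
    (hD : D = (p - ((n : ℝ) + 1)) / (p - 1)) (hlam : lam = 2 ^ (-1 / D))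
    (hgam : 1 / (D * (p - 1)) < gam) :
    ∃ (l : ℕ → ℝ) (θ : ℝ → ℝ) (a : Euc (n + 1) → ℝ) (η : ℝ)
      (u v : Euc (n + 1) → ℝ)
      (Gu G : Euc (n + 1) → Euc (n + 1) →L[ℝ] ℝ),
      IsCantorLengths lam gam l ∧ IsProfile θ ∧
      -- the weight
      (∀ x, 0 ≤ a x) ∧ InHolderCls α (closure (Box (n + 1))) a ∧
      -- the boundary datum `g = η u`, `u` the superdimensional competitor
      0 < η ∧
      (∀ x : Euc (n + 1),
        u x = ∫ t : ℝ, uD θ (snocC (frontC x) (lastC x - t)) ∂(gCantorMeasure l)) ∧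
      W11On (Box (n + 1)) u Gu ∧
      energyOf (Box (n + 1)) (fun x t => t ^ p / p + a x * t ^ q / q)
        (fun x => ‖Gu x‖) < ⊤ ∧
      -- `v` is a minimizer with boundary values `η u`
      W11On (Box (n + 1)) v G ∧
      energyOf (Box (n + 1)) (fun x t => t ^ p / p + a x * t ^ q / q)
        (fun x => ‖G x‖) < ⊤ ∧
      ZeroBoundary (Box (n + 1)) (fun x => v x - η * u x) (fun x => G x - η • Gu x) ∧
      (∀ (w : Euc (n + 1) → ℝ) (Gw : Euc (n + 1) → Euc (n + 1) →L[ℝ] ℝ),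
        W11On (Box (n + 1)) w Gw →
        ZeroBoundary (Box (n + 1)) (fun x => w x - η * u x) (fun x => Gw x - η • Gu x) →
        energyOf (Box (n + 1)) (fun x t => t ^ p / p + a x * t ^ q / q)
            (fun x => ‖G x‖) ≤
          energyOf (Box (n + 1)) (fun x t => t ^ p / p + a x * t ^ q / q)
            (fun x => ‖Gw x‖)) ∧
      -- (i) no higher integrability
      (∀ s : ℝ, p < s →
        ¬ MemLp (fun x => ‖G x‖) (ENNReal.ofReal s) (volume.restrict (Box (n + 1)))) ∧
      -- (ii) the modulus of continuity of `v` is not better than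
      -- `C ρ^𝔇 (log(e+ρ⁻¹))^{−γ𝔇}`
      (∀ ω₁ : ℝ → ℝ, (∀ t : ℝ, 0 < t → 0 ≤ ω₁ t) →
        Tendsto (fun t : ℝ =>
            ω₁ t / (t ^ D * Real.log (Real.exp 1 + t⁻¹) ^ (-(gam * D))))
          (𝓝[>] (0 : ℝ)) (𝓝 0) →
        ¬ ∃ vbar : Euc (n + 1) → ℝ,
            (∀ᵐ x ∂(volume.restrict (Box (n + 1))), vbar x = v x) ∧
            ∀ x ∈ Box (n + 1), ∀ y ∈ Box (n + 1),
              |vbar x - vbar y| ≤ ω₁ (dist x y)) := by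
  have hn1 : (1:ℝ) ≤ n := by exact_mod_cast hn
  have hn0 : (0:ℝ) < n := by linarith
  have hp1 : 0 < p - 1 := by linarith
  have hp0 : 0 < p := by linarith
  have hpd : 0 < p - ((n:ℝ) + 1) := by linarith
  have hD0 : 0 < D := by rw [hD]; positivity
  have hD1 : D < 1 := by rw [hD, div_lt_one hp1]; linarith
  have hDp : D * (p - 1) = p - ((n:ℝ) + 1) := by rw [hD]; field_simp
  have hl0 : 0 < lam := by rw [hlam]; positivity
  have hlD : lam ^ D = 1/2 := by
    rw [hlam, ← Real.rpow_mul (by norm_num), div_mul_cancel₀ _ hD0.ne', Real.rpow_neg_one]; norm_num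
  have hl1 : lam < 1/2 := by
    rw [hlam, show (1/2:ℝ) = 2 ^ (-1:ℝ) by rw [Real.rpow_neg_one]; norm_num]
    refine Real.rpow_lt_rpow_of_exponent_lt (by norm_num) ?_
    rw [div_lt_iff₀ hD0]; linarith
  have hg0 : 0 < gam := lt_trans (by positivity) hgam
  have hg1 : 1 < gam * (p - (n+1)) := by
    rw [← hDp, ← div_lt_iff₀ (by positivity)]; exact hgam
  have hlp : lam ^ (p - ((n:ℝ)+1)) = (1/2:ℝ) ^ (p-1) := by
    rw [← hDp, Real.rpow_mul hl0.le, hlD]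
  obtain ⟨α', hα', hq'⟩ : ∃ α', α < α' ∧ p + α' * (p - 1) / (n:ℝ) < q := by
    have hc : Tendsto (fun t : ℝ => p + t * (p - 1) / (n:ℝ)) (𝓝[>] α) (𝓝 (p + α * (p - 1) / (n:ℝ))) := by
      refine (Continuous.tendsto ?_ α).mono_left nhdsWithin_le_nhds
      fun_prop
    obtain ⟨t, h1, h2⟩ := ((hc.eventually_lt_const hq).and self_mem_nhdsWithin).exists
    exact ⟨t, h2, h1⟩
  have hα0 : 0 < α' := hα.trans hα'
  have hpq : p < q := by
    have : 0 < α' * (p - 1) / (n:ℝ) := by positivity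
    linarith
  have hq0 : 0 < q := by linarith
  have hexp : ∀ β s : ℝ, 0 ≤ β → p + β * (p - 1) / (n:ℝ) < s → 0 ≤ 1 - ((n:ℝ) + 1 + β) / s := by
    intro β s hβ hs
    have h1 : β ≤ β * (p - 1) / (n:ℝ) := by
      rw [le_div_iff₀ hn0]; exact mul_le_mul_of_nonneg_left (by linarith) hβ
    rw [sub_nonneg, div_le_one (by linarith)]; linarith
  obtain ⟨N, lp, hN, hCD, hIC⟩ := exists_lengths hl0 hl1 hg0
  set l : ℕ → ℝ := fun j => lam ^ j * (((j : ℝ) + N) / N) ^ gam with hl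
  have hsumm : ∀ β s : ℝ, 0 ≤ β → p + β * (p - 1) / (n:ℝ) < s →
      Summable fun j : ℕ => ((2:ℝ) ^ (1 - 1/s)) ^ j * l j ^ (1 - ((n:ℝ) + 1 + β)/s) := fun β s hβ hs =>
    LS hN hl0 hg0.le (hexp β s hβ hs) (by positivity) (exp_lt hn hp hβ hs hD hlam)
  obtain ⟨θ, t1, t2, t3, t4, t5, t6⟩ := exists_profile
  have hθ : Prof θ := ⟨t1, t2, t3, t4, t5, t6⟩
  have hK := KC.mk' hCD
  set κ := (1 - 2 * lp) / 32
  obtain ⟨C, hC, hbump⟩ := exists_bump (n+1)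
  choose φ b1 b2 b3 b4 b5 using fun j => hbump (κ * l j) (hK.rpos j)
  have hb : Bumps n l κ C φ := ⟨b1, b2, b3, b4, b5⟩
  obtain ⟨a, ha0, ham, haH, haR, haG⟩ := exists_weight' (n := n) hK hθ hα hα'
  have : IsProbabilityMeasure (gCantorMeasure l) := hCD.prob
  have hμ : ∀ᵐ t ∂(gCantorMeasure l), |t| ≤ 1/2 := hCD.ae_mem.mono fun t ht => hCD.CS_abs ht
  have hE := energy_fin hN hCD hl hp hlp hg1 hθ
  have hu := uu_locint (n := n) hθ hμ
  have hGu := GG_locint hn hθ hμ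
  have hw := uu_weak hn hθ hμ
  set u : Euc (n+1) → ℝ := uu θ (gCantorMeasure l) with hudef
  set Gu : Euc (n+1) → Euc (n+1) →L[ℝ] ℝ := GG θ (gCantorMeasure l) with hGudef
  set E := (∫⁻ x in Box (n+1), ‖Gu x‖ₑ ^ p).toReal with hEdef
  have hEe : ∫⁻ x in Box (n+1), ‖Gu x‖ₑ ^ p = ENNReal.ofReal E := (ENNReal.ofReal_toReal hE.ne).symm
  have hE0 : 0 ≤ E := ENNReal.toReal_nonneg
  obtain ⟨V, hV, hv⟩ := hK.ww_vol (n := n)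
  obtain ⟨C1, hC1, hEb⟩ := E_bound hK hC hb
  have hsq := hsumm α' q hα0.le hq'
  set bb : ℕ → ℝ := fun j => ((2:ℝ) ^ (1 - 1/q)) ^ j * l j ^ (1 - ((n:ℝ) + 1 + α')/q) with hbb
  have hbb0 : ∀ j, 0 ≤ bb j := fun j => by have := hCD.pos j; positivity
  obtain ⟨η, hη, hηK⟩ := choose_eta hpq hq0 (C1 * V ^ (1 - 1/q) * (q / p * E) ^ (1/q) * ∑' j, bb j)
  have hzu : ∀ c : ℝ, 0 ≤ c → energyOf (Box (n + 1)) (fun x t => t ^ p / p + a x * t ^ q / q) (fun x => ‖c • Gu x‖) =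
      ENNReal.ofReal (c ^ p / p * E) := fun c hc => by
    rw [zero_energy hp0 hq0 hc haG, hEe, ← ENNReal.ofReal_mul (by positivity)]
  have hW : W11On (Box (n+1)) u Gu := ⟨locint_box hu, locint_box hGu, weak_mono hw⟩
  have hWη : W11On (Box (n+1)) (fun x => η * u x) (fun x => η • Gu x) :=
    ⟨locint_box (locint_smul η hu), locint_box (locint_smul η hGu), weak_smul η (weak_mono hw)⟩
  obtain ⟨v, G, hvW, hvZ, hvE, hmin⟩ := exists_minimizer (p := p) (q := q) (by linarith) (by linarith) ha0 ham _ _ hWη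
    (by rw [hzu η hη.le]; exact ENNReal.ofReal_lt_top)
  rw [hzu η hη.le] at hvE
  obtain ⟨hf, hH, hfw⟩ := ext_facts hu hGu hw hvZ
  have hY : ∫⁻ x in Box (n+1), ENNReal.ofReal (a x) * ‖G x‖ₑ ^ q ≤ ENNReal.ofReal (η ^ p * (q / p * E)) := by
    refine (weight_le hp0 hq0 ha0 G).trans ?_
    rw [show η ^ p * (q / p * E) = q * (η ^ p / p * E) by ring, ENNReal.ofReal_mul hq0.le]
    gcongr
  have hT : ∀ J, η / 2 ≤ ∑ k ∈ Finset.range (2^J), |TT (extn η u v) φ l J k| := by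
    intro J
    have h1 := tele (T := fun j k => TT (extn η u v) φ l j k)
      (e := fun j => C1 * V ^ (1 - 1/q) * (η ^ p * (q / p * E)) ^ (1/q) * bb j) (fun j => by
        refine lev_sum hK (by linarith) (by positivity) hV.le hC1.le j (F := fun x => ‖extn η Gu G x‖ₑ) hH.aestronglyMeasurable.enorm
          (U := fun k => WW l κ j k ∩ RR l κ j) (fun k => (ww_meas l κ j k).inter (rr_meas l κ j)) (fun k => inter_subset_left)
          (fun k => hv j k) ?_ (fun k hk => hEb hf hfw hH j k hk)
        refine Z_bound hK hθ hq0 haR hY j ?_ (iUnion₂_subset fun k _ => inter_subset_right)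
        exact Finset.measurableSet_biUnion _ fun k _ => (ww_meas l κ j k).inter (rr_meas l κ j)) J
    rw [show TT (extn η u v) φ l 0 0 = η from T00 hK hb hθ v, abs_of_pos hη, ← Finset.mul_sum] at h1
    have h2 : ∑ j ∈ Finset.range J, bb j ≤ ∑' j, bb j := hsq.sum_le_tsum _ fun j _ => hbb0 j
    have h3 : (η ^ p * (q / p * E)) ^ (1/q) = η ^ (p/q) * (q / p * E) ^ (1/q) := by
      rw [Real.mul_rpow (by positivity) (by positivity), ← Real.rpow_mul hη.le, mul_one_div]
    have h4 : C1 * V ^ (1 - 1/q) * (η ^ p * (q / p * E)) ^ (1/q) * ∑ j ∈ Finset.range J, bb j ≤ η / 2 := by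
      refine le_trans ?_ hηK
      rw [h3]
      calc _ ≤ C1 * V ^ (1 - 1/q) * (η ^ (p/q) * (q / p * E) ^ (1/q)) * ∑' j, bb j := by gcongr
        _ = _ := by ring
    linarith
  refine ⟨l, θ, a, η, u, v, Gu, G, hIC, hθ.isProfile, ha0, haH, hη, fun x => ?_, hW, ?_, hvW,
    lt_of_le_of_lt hvE ENNReal.ofReal_lt_top, hvZ, hmin, fun s hs => ?_, fun ω₁ _ hω => ?_⟩
  · simp_rw [snoc_eq]; rfl
  · have := hzu 1 zero_le_one
    simp only [one_smul] at this
    rw [this]; exact ENNReal.ofReal_lt_top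
  · exact no_int hK hC hb hf hH hfw (fun x hx => ext_in η _ _ hx) hη (by linarith)
      (hsumm 0 s le_rfl (by simpa using hs)) hT
  · exact no_mod hK hb hf (fun x hx => ext_in η _ _ hx) hN hD0 hg0 hlD hl hη hT ω₁ hω
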